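/- arXiv:1811.08733 — 2 statements merged into one kernel-verified Lean document; each statement's English description precedes it below -/
import Mathlib

section
/- Every nonzero polynomial tau-function of the DKP hierarchy in the odd sector V_1, i.e. every nonzero τ ∈ ℂ[t_1,t_3,t_5,…] satisfying the BKP bilinear identity (the bosonic form of the DKP hierarchy on V_1), is of the form τ = a · Pf(A) for some n ≥ 0, integers λ_1 > λ_2 > ⋯ > λ_{2n+1} ≥ 0, sequences c_1,…,c_{2n+1} of complex numbers, constants b_1,…,b_{2n+1} ∈ ℂ, and nonzero a ∈ ℂ, where A is the (2n+2)×(2n+2) skew-symmetric matrix with rows and columns indexed by 0,1,…,2n+1, entries A_{0,j} = ρ_{λ_j}(t̃ + c_j; b_j) for 1 ≤ j ≤ 2n+1 and A_{i,j} = ρ_{λ_i,λ_j}(t̃ + c_i, t̃ + c_j; b_i, b_j) for 1 ≤ i < j ≤ 2n+1. -/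
/- ## Setup: the ring `B = ℂ[t₁,t₃,t₅,…]`, elementary Schur polynomials,
   vertex-operator coefficients, and the BKP bilinear identity. -/

noncomputable section

open MvPolynomial

/-- The polynomial ring `B = ℂ[t₁,t₃,t₅,…]`; variable `i` represents `t_{2i+1}`. -/
abbrev BRing : Type := MvPolynomial ℕ ℂ

/-- The universal elementary Schur polynomials `s_n`, defined by
`exp (∑_{j≥1} t_j z^j) = ∑_{n≥0} s_n(t) z^n`; here the variable `j` (for `j ≥ 1`)
represents `t_j`.  They satisfy `s_0 = 1` and `(n+1) s_{n+1} = ∑_{j=1}^{n+1} j t_j s_{n+1-j}`. -/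
def schurPoly : ℕ → MvPolynomial ℕ ℂ
  | 0 => 1
  | n + 1 =>
      ((n + 1 : ℂ))⁻¹ •
        ∑ j ∈ Finset.range (n + 1),
          ((j + 1 : ℂ)) • (MvPolynomial.X (j + 1) * schurPoly (n - j))
  termination_by n => n
  decreasing_by omega

/-- `s_n(c)` for a complex sequence `c = (c_1, c_2, …)` (the entry `c 0` is ignored). -/
def sC (n : ℕ) (c : ℕ → ℂ) : ℂ := MvPolynomial.eval c (schurPoly n)

/-- `s_n` evaluated on a sequence of elements of `B`. -/
def sB (n : ℕ) (c : ℕ → BRing) : BRing := MvPolynomial.aeval c (schurPoly n)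

/-- The sequence `t̃ = (t₁, 0, t₃, 0, t₅, 0, …)` of elements of `B`. -/
def tTilde : ℕ → BRing := fun j => if j % 2 = 1 then MvPolynomial.X ((j - 1) / 2) else 0

/-- The sequence `t̃ + c` for a constant sequence `c`. -/
def tShift (c : ℕ → ℂ) : ℕ → BRing := fun j => tTilde j + MvPolynomial.C (c j)

/-- `s̃_m = s_m(t̃) ∈ B` for `m ≥ 0`, and `0` for `m < 0`; these are the coefficients of
`exp (∑_{j>0 odd} t_j z^j)`. -/
def sTildeZ (m : ℤ) : BRing :=
  if 0 ≤ m then MvPolynomial.aeval tTilde (schurPoly m.toNat) else 0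

/-- `s_m(-t̃) ∈ B` for `m ≥ 0`, and `0` for `m < 0`; the coefficients of
`exp (-∑_{j>0 odd} t_j z^j)`. -/
def sTildeNegZ (m : ℤ) : BRing :=
  if 0 ≤ m then MvPolynomial.aeval (fun j => -(tTilde j)) (schurPoly m.toNat) else 0

/-- `p(t₁ - 2w, t₃ - (2/3)w³, t₅ - (2/5)w⁵, …)` as a polynomial in `w` (which stands for
`z⁻¹`) over `B`: this is `exp (-2∑_{j>0 odd} (1/j) ∂/∂t_j z^{-j}) p` by Taylor's formula. -/
def shiftMinus (p : BRing) : Polynomial BRing :=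
  MvPolynomial.aeval
    (fun i => Polynomial.C (MvPolynomial.X i) -
      Polynomial.C (MvPolynomial.C ((2 : ℂ) / ((2 * i + 1 : ℕ) : ℂ))) *
        Polynomial.X ^ (2 * i + 1)) p

/-- `p(t₁ + 2w, t₃ + (2/3)w³, …)`, i.e. `exp (2∑_{j>0 odd} (1/j) ∂/∂t_j z^{-j}) p`. -/
def shiftPlus (p : BRing) : Polynomial BRing :=
  MvPolynomial.aeval
    (fun i => Polynomial.C (MvPolynomial.X i) +
      Polynomial.C (MvPolynomial.C ((2 : ℂ) / ((2 * i + 1 : ℕ) : ℂ))) *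
        Polynomial.X ^ (2 * i + 1)) p

/-- The coefficient of `z^m` in
`exp (∑_{j>0 odd} t_j z^j) exp (-2∑_{j>0 odd} (1/j)(∂/∂t_j) z^{-j}) τ`. -/
def leftCoeff (τ : BRing) (m : ℤ) : BRing :=
  ∑ᶠ k : ℕ, sTildeZ (m + k) * (shiftMinus τ).coeff k

/-- The coefficient of `z^m` in
`exp (-∑_{j>0 odd} t_j z^j) exp (2∑_{j>0 odd} (1/j)(∂/∂t_j) z^{-j}) τ`. -/
def rightCoeff (τ : BRing) (m : ℤ) : BRing :=
  ∑ᶠ k : ℕ, sTildeNegZ (m + k) * (shiftPlus τ).coeff k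

/-- `ℂ[t₁,t₃,…] ⊗ ℂ[t'₁,t'₃,…]`, realized as polynomials in two families of variables. -/
abbrev BRing2 : Type := MvPolynomial (ℕ ⊕ ℕ) ℂ

/-- The embedding `p(t) ↦ p(t) ∈ ℂ[t] ⊗ ℂ[t']` on the first factor. -/
def inL : BRing →+* BRing2 := (MvPolynomial.rename Sum.inl).toRingHom

/-- The embedding `p(t') ↦ p(t') ∈ ℂ[t] ⊗ ℂ[t']` on the second factor. -/
def inR : BRing →+* BRing2 := (MvPolynomial.rename Sum.inr).toRingHom

/-- The BKP bilinear identity on `τ ∈ ℂ[t₁,t₃,t₅,…]`: the coefficient of `z⁰` in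
`(exp(∑ t_j z^j) exp(-2∑ (1/j)∂_{t_j} z^{-j}) τ)(t) ·
 (exp(-∑ t'_j z^j) exp(2∑ (1/j)∂_{t'_j} z^{-j}) τ)(t')`
equals `τ(t) τ(t')` (all sums over odd `j > 0`; only finitely many summands below
are nonzero since `τ` is a polynomial). -/
def SatisfiesBKP (τ : BRing) : Prop :=
  ∑ᶠ m : ℤ, inL (leftCoeff τ m) * inR (rightCoeff τ (-m)) = inL τ * inR τ

/-- The MDKP bilinear identity on a pair `(τ₀, τ₁)`. -/
def SatisfiesMDKP (τ₀ τ₁ : BRing) : Prop :=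
  ∑ᶠ m : ℤ, inL (leftCoeff τ₀ m) * inR (rightCoeff τ₁ (-m)) = inL τ₁ * inR τ₀

/-- The condition on a permutation `σ` appearing in the definition of the Pfaffian:
`σ(2i-1) < σ(2i)` for all `i`, and `σ(1) < σ(3) < ⋯` (with 0-based indices here). -/
def pfaffianCond {m : ℕ} (σ : Equiv.Perm (Fin m)) : Prop :=
  (∀ i : Fin (m / 2),
      σ ⟨2 * i.val, by have := i.isLt; omega⟩ < σ ⟨2 * i.val + 1, by have := i.isLt; omega⟩) ∧
  (∀ i j : Fin (m / 2), i < j →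
      σ ⟨2 * i.val, by have := i.isLt; omega⟩ < σ ⟨2 * j.val, by have := j.isLt; omega⟩)

open scoped Classical in
/-- The Pfaffian `Pf(A) = ∑_σ sgn(σ) ∏_i a_{σ(2i-1),σ(2i)}` of a (skew-symmetric) matrix;
it is intended to be used for matrices of even size `m = 2n`. -/
def pfaffian {R : Type*} [CommRing R] {m : ℕ} (A : Matrix (Fin m) (Fin m) R) : R :=
  ∑ σ : Equiv.Perm (Fin m),
    if pfaffianCond σ then
      (Equiv.Perm.sign σ : ℤ) •
        ∏ i : Fin (m / 2),
          A (σ ⟨2 * i.val, by have := i.isLt; omega⟩)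
            (σ ⟨2 * i.val + 1, by have := i.isLt; omega⟩)
    else 0

/-- The skew-symmetric matrix with `(i,j)`-entry `f i j` for `i < j`. -/
def skewOf {R : Type*} [CommRing R] {m : ℕ} (f : Fin m → Fin m → R) :
    Matrix (Fin m) (Fin m) R :=
  Matrix.of fun i j => if i < j then f i j else if j < i then -f j i else 0

/-- `χ_{λ,μ}(c,c') = (1/2) s_λ(c) s_μ(c') + ∑_{ℓ=1}^{μ} (-1)^ℓ s_{λ+ℓ}(c) s_{μ-ℓ}(c')`,
for `λ > μ ≥ 0` and sequences `c, c'` of elements of `B`. -/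
def chiB (l μ : ℕ) (c c' : ℕ → BRing) : BRing :=
  (2 : ℂ)⁻¹ • (sB l c * sB μ c') +
    ∑ ℓ ∈ Finset.Icc 1 μ, ((-1 : ℂ) ^ ℓ) • (sB (l + ℓ) c * sB (μ - ℓ) c')

/-- The skew-symmetric matrix `( χ_{λ_i,λ_j}(t̃+c_i, t̃+c_j) )_{i,j}`. -/
def chiMatrix {m : ℕ} (lam : Fin m → ℕ) (c : Fin m → ℕ → ℂ) :
    Matrix (Fin m) (Fin m) BRing :=
  skewOf fun i j => chiB (lam i) (lam j) (tShift (c i)) (tShift (c j))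

/-- `√2` as a complex number. -/
def sqrt2 : ℂ := (Real.sqrt 2 : ℂ)

/-- `ρ_{λ,μ}(c,c';b,b') = (s_λ(c)/√2 - b)(s_μ(c')/√2 + b')
  + ∑_{ℓ=1}^{μ} (-1)^ℓ s_{λ+ℓ}(c) s_{μ-ℓ}(c')` for `λ > μ ≥ 0`. -/
def rhoB (l μ : ℕ) (c c' : ℕ → BRing) (b b' : ℂ) : BRing :=
  (sqrt2⁻¹ • sB l c - MvPolynomial.C b) * (sqrt2⁻¹ • sB μ c' + MvPolynomial.C b') +
    ∑ ℓ ∈ Finset.Icc 1 μ, ((-1 : ℂ) ^ ℓ) • (sB (l + ℓ) c * sB (μ - ℓ) c')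

/-- `ρ_λ(c;b) = s_λ(c)/√2 + b`. -/
def rho1B (l : ℕ) (c : ℕ → BRing) (b : ℂ) : BRing :=
  sqrt2⁻¹ • sB l c + MvPolynomial.C b

/-- The `2n × 2n` skew-symmetric matrix `( ρ_{λ_i,λ_j}(t̃+c_i, t̃+c_j; b_i, b_j) )_{i,j}`
(for an even number `m = 2n` of rows of `λ`). -/
def rhoMatrixEven {m : ℕ} (lam : Fin m → ℕ) (c : Fin m → ℕ → ℂ) (b : Fin m → ℂ) :
    Matrix (Fin m) (Fin m) BRing :=
  skewOf fun i j => rhoB (lam i) (lam j) (tShift (c i)) (tShift (c j)) (b i) (b j)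

/-- For an odd number `m` of parts `λ_1 > ⋯ > λ_m ≥ 0`, the `(m+1) × (m+1)`
skew-symmetric matrix with rows/columns indexed by `0, 1, …, m`, whose `(0,j)`-entry is
`ρ_{λ_j}(t̃+c_j; b_j)` and whose `(i,j)`-entry for `1 ≤ i < j` is
`ρ_{λ_i,λ_j}(t̃+c_i, t̃+c_j; b_i, b_j)`. -/
def rhoMatrixOdd {m : ℕ} (lam : Fin m → ℕ) (c : Fin m → ℕ → ℂ) (b : Fin m → ℂ) :
    Matrix (Fin (m + 1)) (Fin (m + 1)) BRing :=
  skewOf fun i j =>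
    if i.val = 0 then
      if hj : j.val = 0 then 0
      else
        rho1B (lam ⟨j.val - 1, by have := j.isLt; omega⟩)
          (tShift (c ⟨j.val - 1, by have := j.isLt; omega⟩))
          (b ⟨j.val - 1, by have := j.isLt; omega⟩)
    else
      if hj : j.val = 0 then 0
      else
        rhoB (lam ⟨i.val - 1, by have := i.isLt; omega⟩)
          (lam ⟨j.val - 1, by have := j.isLt; omega⟩)
          (tShift (c ⟨i.val - 1, by have := i.isLt; omega⟩))
          (tShift (c ⟨j.val - 1, by have := j.isLt; omega⟩))
          (b ⟨i.val - 1, by have := i.isLt; omega⟩)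
          (b ⟨j.val - 1, by have := j.isLt; omega⟩)

/-- The DKP tau-function `ρ_λ(t̃; c_1,…,c_k; b_1,…,b_k)` attached to an extended strict
partition `λ` with `k` parts: a Pfaffian of size `k` if `k` is even, and of size `k+1`
(with an extra 0-th row built from the `ρ_{λ_j}`) if `k` is odd. -/
def rhoTau {k : ℕ} (lam : Fin k → ℕ) (c : Fin k → ℕ → ℂ) (b : Fin k → ℂ) : BRing :=
  if k % 2 = 0 then pfaffian (rhoMatrixEven lam c b)
  else pfaffian (rhoMatrixOdd lam c b)

/-- The operators `φ̂_j` (`j ∈ ℤ`) on `B`, defined by the generating series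
`∑_{j∈ℤ} φ̂_j z^{-j} = (1/√2) exp(∑_{k>0 odd} t_k z^k) exp(-∑_{k>0 odd} (2/k) ∂_{t_k} z^{-k})`. -/
def phiHat (j : ℤ) (p : BRing) : BRing :=
  sqrt2⁻¹ • ∑ᶠ k : ℕ, sTildeZ ((k : ℤ) - j) * (shiftMinus p).coeff k

/-- `a : ℤ → ℂ` vanishes for all sufficiently negative indices. -/
def BddBelowSupport (a : ℤ → ℂ) : Prop := ∃ N : ℤ, ∀ j < N, a j = 0

/-- The operator `v = ∑_{j∈ℤ} a_j φ̂_j` on `B` (a finite sum on each polynomial,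
when `a` has support bounded below). -/
def vOp (a : ℤ → ℂ) (p : BRing) : BRing := ∑ᶠ j : ℤ, a j • phiHat j p

/-- Evaluation at `t = 0`, `ev₀ : B → ℂ` (the vacuum expectation value). -/
def ev0 : BRing → ℂ := MvPolynomial.eval (fun _ => 0)

/-- The "`√2` times `φ̂_j`" vertex operator coefficients (without the `1/√2` factor),
used for the type `D` construction. -/
def vertexB (j : ℤ) (p : BRing) : BRing :=
  ∑ᶠ k : ℕ, sTildeZ ((k : ℤ) - j) * (shiftMinus p).coeff k

/-- `B_D = ℂ[θ] ⊗ B` with `θ` a Grassmann variable: the pair `(p₀, p₁)` represents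
`p₀ + θ p₁`. -/
abbrev BD : Type := BRing × BRing

/-- The operators `Φ̂_j` (`j ∈ ℤ`) on `B_D`, defined by
`∑_j Φ̂_j z^{-j} = (1/√2)(θ + ∂/∂θ) exp(∑ t_k z^k) exp(-∑ (2/k) ∂_{t_k} z^{-k})`. -/
def PhiHatD (j : ℤ) (p : BD) : BD :=
  sqrt2⁻¹ • (vertexB j p.2, vertexB j p.1)

/-- `Ψ = (θ - ∂/∂θ)/√2` on `B_D`. -/
def PsiD (p : BD) : BD := sqrt2⁻¹ • (-p.2, p.1)

/-- The type `D` fermions `φ̂_a`, `a ∈ ½ + ℤ`, where the integer `m` encodes the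
half-integer index `a = m + ½`:  `φ̂_{-i-½} = Φ̂_{-i}` and `φ̂_{i+½} = (-1)^i Φ̂_i`
for `i ≥ 1`, `φ̂_{-½} = (Φ̂_0 + Ψ)/√2`, `φ̂_{½} = (Φ̂_0 - Ψ)/√2`. -/
def phiD (m : ℤ) (p : BD) : BD :=
  if m ≤ -2 then PhiHatD (m + 1) p
  else if m = -1 then sqrt2⁻¹ • (PhiHatD 0 p + PsiD p)
  else if m = 0 then sqrt2⁻¹ • (PhiHatD 0 p - PsiD p)
  else ((-1 : ℂ) ^ m) • PhiHatD m p

end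


noncomputable section
open MvPolynomial

section SchurGen
variable {R : Type*} [CommRing R] [Algebra ℂ R]

/-- Schur polynomials evaluated in an algebra. -/
def sG (n : ℕ) (c : ℕ → R) : R := MvPolynomial.aeval c (schurPoly n)

theorem sG_zero (c : ℕ → R) : sG 0 c = 1 := by
  simp [sG, schurPoly]

theorem sG_rec (c : ℕ → R) (n : ℕ) :
    ((n + 1 : ℂ)) • sG (n + 1) c =
      ∑ j ∈ Finset.range (n + 1), ((j + 1 : ℂ)) • (c (j + 1) * sG (n - j) c) := by
  have hn : (n + 1 : ℂ) ≠ 0 := by exact_mod_cast Nat.succ_ne_zero n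
  simp only [sG]
  rw [schurPoly, map_smul, smul_smul, mul_inv_cancel₀ hn, one_smul, map_sum]
  simp

theorem sG_unique (c : ℕ → R) (f : ℕ → R) (h0 : f 0 = 1)
    (h : ∀ n : ℕ, ((n + 1 : ℂ)) • f (n + 1) =
      ∑ j ∈ Finset.range (n + 1), ((j + 1 : ℂ)) • (c (j + 1) * f (n - j))) (n : ℕ) :
    f n = sG n c := by
  induction n using Nat.strong_induction_on with
  | _ n ih =>
    cases n with
    | zero => rw [h0, sG_zero]
    | succ n =>
      have hn : (n + 1 : ℂ) ≠ 0 := by exact_mod_cast Nat.succ_ne_zero n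
      have : ((n + 1 : ℂ)) • f (n + 1) = ((n + 1 : ℂ)) • sG (n + 1) c := by
        rw [h, sG_rec]
        refine Finset.sum_congr rfl fun j hj => ?_
        rw [ih (n - j) (by omega)]
      have h2 := congrArg (fun x => ((n + 1 : ℂ))⁻¹ • x) this
      simpa [smul_smul, inv_mul_cancel₀ hn] using h2

theorem sG_map {R' : Type*} [CommRing R'] [Algebra ℂ R'] (φ : R →ₐ[ℂ] R') (c : ℕ → R) (n : ℕ) :
    φ (sG n c) = sG n (fun j => φ (c j)) := by
  unfold sG
  rw [← AlgHom.comp_apply, MvPolynomial.comp_aeval]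

/-- generating series -/
def sSer (c : ℕ → R) : PowerSeries R := PowerSeries.mk fun n => sG n c
def dSer (c : ℕ → R) : PowerSeries R := PowerSeries.mk fun n => ((n + 1 : ℂ)) • c (n + 1)

theorem sSer_deriv (c : ℕ → R) :
    PowerSeries.derivative R (sSer c) = dSer c * sSer c := by
  ext n
  rw [PowerSeries.coeff_derivative, PowerSeries.coeff_mul,
    Finset.Nat.sum_antidiagonal_eq_sum_range_succ
      (fun i j => PowerSeries.coeff i (dSer c) * PowerSeries.coeff j (sSer c))]
  simp only [sSer, dSer, PowerSeries.coeff_mk, smul_mul_assoc]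
  rw [Nat.succ_eq_add_one, ← sG_rec, Algebra.smul_def, mul_comm]
  simp

theorem eq_sSer (c : ℕ → R) (F : PowerSeries R) (h0 : PowerSeries.coeff 0 F = 1)
    (h : PowerSeries.derivative R F = dSer c * F) : F = sSer c := by
  ext n
  rw [sSer, PowerSeries.coeff_mk]
  refine sG_unique c (fun n => PowerSeries.coeff n F) h0 (fun n => ?_) n
  have := congrArg (PowerSeries.coeff n) h
  rw [PowerSeries.coeff_derivative, PowerSeries.coeff_mul,
    Finset.Nat.sum_antidiagonal_eq_sum_range_succ
      (fun i j => PowerSeries.coeff i (dSer c) * PowerSeries.coeff j F)] at this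
  simp only [dSer, PowerSeries.coeff_mk, smul_mul_assoc] at this
  rw [← Nat.succ_eq_add_one n, ← this, Algebra.smul_def, mul_comm]
  simp

theorem sSer_add (c c' : ℕ → R) : sSer (fun j => c j + c' j) = sSer c * sSer c' := by
  symm
  apply eq_sSer
  · rw [PowerSeries.coeff_mul]; simp [sSer, sG_zero]
  · rw [Derivation.leibniz, sSer_deriv, sSer_deriv]
    have : dSer (fun j => c j + c' j) = dSer c + dSer c' := by
      ext n; simp [dSer]
    rw [this]; simp only [smul_eq_mul]; ring

theorem sG_add (c c' : ℕ → R) (n : ℕ) : sG n (fun j => c j + c' j) =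
    ∑ k ∈ Finset.range (n + 1), sG k c * sG (n - k) c' := by
  have := congrArg (PowerSeries.coeff n) (sSer_add c c')
  rw [PowerSeries.coeff_mul, Finset.Nat.sum_antidiagonal_eq_sum_range_succ
      (fun i j => PowerSeries.coeff i (sSer c) * PowerSeries.coeff j (sSer c'))] at this
  simpa [sSer] using this

theorem sG_const_zero (n : ℕ) : sG n (fun _ => (0 : R)) = if n = 0 then 1 else 0 := by
  symm
  refine sG_unique (R := R) _ (fun n => if n = 0 then 1 else 0) (by simp) (fun n => ?_) n
  simp

theorem sG_sign (c : ℕ → R) (n : ℕ) :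
    sG n (fun j => ((-1 : ℂ) ^ j) • c j) = ((-1 : ℂ) ^ n) • sG n c := by
  symm
  refine sG_unique (R := R) _ (fun n => ((-1 : ℂ) ^ n) • sG n c) (by simp [sG_zero])
    (fun n => ?_) n
  rw [smul_comm, sG_rec, Finset.smul_sum]
  refine Finset.sum_congr rfl fun j hj => ?_
  have hj : j ≤ n := by simpa [Nat.lt_succ_iff] using hj
  rw [smul_comm]
  congr 1
  rw [smul_mul_smul_comm, ← pow_add]
  congr 2; omega

/-- coefficients of (1-x)/(1+x) -/
def qc (n : ℕ) : ℂ := if n = 0 then 1 else 2 * (-1) ^ n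

theorem qc_sum (n : ℕ) : (∑ j ∈ Finset.range (n + 1),
    (if j % 2 = 0 then (-2 : ℂ) else 0) * qc (n - j)) = (n + 1) * qc (n + 1) := by
  have h2 : ∀ n, (∑ j ∈ Finset.range (n + 2 + 1),
    (if j % 2 = 0 then (-2 : ℂ) else 0) * qc (n + 2 - j)) =
    (∑ j ∈ Finset.range (n + 1),
    (if j % 2 = 0 then (-2 : ℂ) else 0) * qc (n - j)) + (-2) * qc (n + 2) := by
    intro n
    rw [Finset.sum_range_succ', Finset.sum_range_succ']
    have : ∀ x, (x + 1 + 1) % 2 = x % 2 := fun x => by omega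
    simp [this]
  induction n using Nat.twoStepInduction with
  | zero => simp [qc]
  | one => simp [qc, Finset.sum_range_succ]; norm_num
  | more n ih _ =>
    rw [h2, ih]
    simp [qc, pow_succ]; ring

theorem sG_q (w : R) (n : ℕ) :
    sG n (fun j => if j % 2 = 1 then (-(2 : ℂ) / j) • w ^ j else 0) = qc n • w ^ n := by
  symm
  refine sG_unique (R := R) _ (fun n => qc n • w ^ n) (by simp [qc]) (fun n => ?_) n
  rw [smul_smul, ← qc_sum, Finset.sum_smul]
  refine Finset.sum_congr rfl fun j hj => ?_
  have hj : j ≤ n := by simpa [Nat.lt_succ_iff] using hj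
  have hn : (j + 1 : ℂ) ≠ 0 := by exact_mod_cast Nat.succ_ne_zero j
  by_cases h : j % 2 = 0
  · have h' : (j + 1) % 2 = 1 := by omega
    simp only [h, h', if_true]
    rw [smul_mul_smul_comm, ← pow_add, smul_smul]
    rw [show j + 1 + (n - j) = n + 1 by omega, ← mul_assoc]
    congr 2
    push_cast; field_simp
  · have h' : ¬ (j + 1) % 2 = 1 := by omega
    simp [h, h']

end SchurGen

theorem sB_eq (n : ℕ) (c : ℕ → BRing) : sB n c = sG n c := rfl

theorem sC_surj (a : ℕ → ℂ) (h0 : a 0 = 1) : ∃ c : ℕ → ℂ, ∀ n, sG n c = a n := by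
  let A : PowerSeries ℂ := PowerSeries.mk a
  let G : PowerSeries ℂ := PowerSeries.derivative ℂ A * A⁻¹
  refine ⟨fun n => (n : ℂ)⁻¹ * PowerSeries.coeff (n - 1) G, fun n => ?_⟩
  have hA : PowerSeries.constantCoeff A ≠ 0 := by
    rw [← PowerSeries.coeff_zero_eq_constantCoeff_apply]; simp [A, h0]
  have := eq_sSer (fun n : ℕ => (n : ℂ)⁻¹ * PowerSeries.coeff (n - 1) G) A (by simp [A, h0]) (by
    have : dSer (fun n : ℕ => (n : ℂ)⁻¹ * PowerSeries.coeff (n - 1) G) = G := by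
      ext n
      have hn : (n + 1 : ℂ) ≠ 0 := by exact_mod_cast Nat.succ_ne_zero n
      simp [dSer, hn]
    rw [this]
    simp only [G]
    rw [mul_assoc, PowerSeries.inv_mul_cancel _ hA, mul_one])
  have h := congrArg (PowerSeries.coeff n) this
  simpa [A, sSer] using h.symm

end


noncomputable section
open MvPolynomial

/-- `shiftMinus` as an algebra homomorphism. -/
def shA : BRing →ₐ[ℂ] Polynomial BRing :=
  MvPolynomial.aeval
    (fun i => Polynomial.C (MvPolynomial.X i) -
      Polynomial.C (MvPolynomial.C ((2 : ℂ) / ((2 * i + 1 : ℕ) : ℂ))) *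
        Polynomial.X ^ (2 * i + 1))

theorem shA_eq (p : BRing) : shiftMinus p = shA p := rfl

/-- coefficients of the shift -/
def Dk (k : ℕ) : BRing →ₗ[ℂ] BRing :=
  ((Polynomial.lcoeff BRing k).restrictScalars ℂ) ∘ₗ shA.toLinearMap

theorem Dk_apply (k : ℕ) (p : BRing) : Dk k p = (shA p).coeff k := rfl

/-- the number `2/(2l+1)` -/
def cl (l : ℕ) : ℂ := (2 : ℂ) / ((2 * l + 1 : ℕ) : ℂ)

theorem Dk_bound (p : BRing) : ∃ N : ℕ, ∀ k, N ≤ k → Dk k p = 0 :=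
  ⟨(shA p).natDegree + 1, fun k hk => Polynomial.coeff_eq_zero_of_natDegree_lt (show (shA p).natDegree < k by omega)⟩

theorem Dk_zero (p : BRing) : Dk 0 p = p := by
  rw [Dk_apply, Polynomial.coeff_zero_eq_eval_zero]
  have : (((Polynomial.aeval (0 : BRing)).restrictScalars ℂ).comp shA) = AlgHom.id ℂ BRing := by
    ext i : 1
    simp [shA]
  have h := congrArg (fun f => f p) this
  simpa [Polynomial.aeval_def] using h

theorem Dk_one (k : ℕ) : Dk k 1 = if k = 0 then 1 else 0 := by
  rw [Dk_apply, map_one, Polynomial.coeff_one]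

theorem Dk_C (k : ℕ) (a : ℂ) : Dk k (C a) = if k = 0 then C a else 0 := by
  rw [← mul_one (C a), ← MvPolynomial.smul_eq_C_mul, map_smul, Dk_one]
  split_ifs <;> simp

theorem Dk_X_mul (k l : ℕ) (p : BRing) : Dk k (X l * p) =
    X l * Dk k p - if 2 * l + 1 ≤ k then cl l • Dk (k - (2 * l + 1)) p else 0 := by
  simp only [Dk_apply, map_mul]
  have : shA (X l) = Polynomial.C (MvPolynomial.X l) -
      Polynomial.C (MvPolynomial.C (cl l)) * Polynomial.X ^ (2 * l + 1) := by
    simp [shA, cl]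
  rw [this, sub_mul, Polynomial.coeff_sub, Polynomial.coeff_C_mul, mul_assoc,
    Polynomial.coeff_C_mul, Polynomial.coeff_X_pow_mul']
  congr 1
  split_ifs
  · rw [MvPolynomial.smul_eq_C_mul]
  · simp

theorem shA_tShift (c : ℕ → ℂ) (j : ℕ) : shA (tShift c j) =
    (Polynomial.C (tShift c j)) +
      (if j % 2 = 1 then (-(2 : ℂ) / j) • (Polynomial.X : Polynomial BRing) ^ j else 0) := by
  unfold tShift tTilde
  have hC : shA (C (c j)) = Polynomial.C (C (c j)) := by
    rw [← MvPolynomial.algebraMap_eq, AlgHom.commutes]; rfl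
  split_ifs with h
  · rw [map_add, hC]
    have e : 2 * ((j - 1) / 2) + 1 = j := by omega
    simp only [shA, MvPolynomial.aeval_X, e, map_add]
    have : (-(2 : ℂ) / j) • (Polynomial.X : Polynomial BRing) ^ j =
      - (Polynomial.C (C (2 / (j : ℂ))) * Polynomial.X ^ j) := by
      rw [neg_div, neg_smul, Algebra.smul_def]; rfl
    rw [this]; ring
  · simp [hC]

theorem Dk_sB (k n : ℕ) (c : ℕ → ℂ) : Dk k (sB n (tShift c)) =
    if k ≤ n then qc k • sB (n - k) (tShift c) else 0 := by
  rw [Dk_apply, sB_eq, sG_map]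
  simp only [shA_tShift]
  rw [sG_add]
  simp only [sG_q]
  have hC : ∀ m, sG m (fun j => (Polynomial.C (tShift c j) : Polynomial BRing)) =
      Polynomial.C (sB m (tShift c)) := by
    intro m
    exact (sG_map (Polynomial.CAlgHom (R := ℂ) (A := BRing)) (tShift c) m).symm
  simp only [hC, Polynomial.finsetSum_coeff, Polynomial.coeff_C_mul, Polynomial.coeff_smul,
    Polynomial.coeff_X_pow]
  split_ifs with h
  · rw [Finset.sum_eq_single (n - k)]
    · rw [if_pos (by omega), show n - (n - k) = k by omega]
      simp
    · intro b hb hbk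
      have : b ≤ n := by simpa [Nat.lt_succ_iff] using hb
      rw [if_neg (by omega)]; simp
    · intro hh; exact absurd (Finset.mem_range.2 (by omega)) hh
  · refine Finset.sum_eq_zero fun b hb => ?_
    rw [if_neg (by omega)]; simp

theorem tShift_zero : tShift (fun _ => 0) = tTilde := by
  funext j; simp [tShift]

theorem sTildeZ_nat (n : ℕ) : sTildeZ n = sB n tTilde := by
  simp [sTildeZ, sB]

theorem sTildeZ_neg {m : ℤ} (h : m < 0) : sTildeZ m = 0 := by
  simp [sTildeZ, h]

theorem sTildeZ_zero : sTildeZ 0 = 1 := by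
  have := sTildeZ_nat 0
  rw [sB_eq, sG_zero] at this
  simpa using this

theorem Dk_sTildeZ (k : ℕ) (m : ℤ) : Dk k (sTildeZ m) = qc k • sTildeZ (m - k) := by
  rcases lt_or_ge m 0 with h | h
  · rw [sTildeZ_neg h, sTildeZ_neg (by omega)]; simp
  · obtain ⟨n, rfl⟩ := Int.eq_ofNat_of_zero_le h
    rw [sTildeZ_nat, ← tShift_zero, Dk_sB, tShift_zero]
    split_ifs with hk
    · rw [← sTildeZ_nat]; congr 2; omega
    · rw [sTildeZ_neg (by omega)]; simp

/-- The operator with coefficient sequence β. -/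
def OpB (β : ℕ → BRing) : BRing →ₗ[ℂ] BRing :=
  ((Polynomial.lsum fun k => LinearMap.mulLeft BRing (β k)).restrictScalars ℂ) ∘ₗ shA.toLinearMap

theorem OpB_eq (β : ℕ → BRing) (p : BRing) (N : ℕ) (h : ∀ k, N ≤ k → Dk k p = 0) :
    OpB β p = ∑ k ∈ Finset.range N, β k * Dk k p := by
  have : OpB β p = (shA p).sum (fun k q => β k * q) := rfl
  rw [this, Polynomial.sum_eq_of_subset (s := Finset.range N)]
  · rfl
  · simp
  · intro k hk
    by_contra hc
    exact Polynomial.mem_support_iff.1 hk (h k (by simpa using hc))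

/-- √2 φ_j -/
def psi (j : ℤ) : BRing →ₗ[ℂ] BRing := OpB fun k => sTildeZ ((k : ℤ) - j)

theorem psi_eq (j : ℤ) (p : BRing) (N : ℕ) (h : ∀ k, N ≤ k → Dk k p = 0) :
    psi j p = ∑ k ∈ Finset.range N, sTildeZ ((k : ℤ) - j) * Dk k p := OpB_eq _ _ _ h

theorem psi_X_mul (j : ℤ) (l : ℕ) (p : BRing) :
    psi j (X l * p) = X l * psi j p - cl l • psi (j - (2 * l + 1 : ℕ)) p := by
  obtain ⟨N, hN⟩ := Dk_bound p
  rw [psi_eq j p (2 * l + 1 + N) (fun k hk => hN k (by omega)), psi_eq _ p N hN,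
    psi_eq j (X l * p) (2 * l + 1 + N)]
  · simp only [Dk_X_mul, mul_sub, Finset.sum_sub_distrib]
    congr 1
    · rw [Finset.mul_sum]
      refine Finset.sum_congr rfl fun k _ => by ring
    · rw [Finset.sum_range_add, Finset.sum_eq_zero, zero_add, Finset.smul_sum]
      · refine Finset.sum_congr rfl fun k _ => ?_
        rw [if_pos (by omega), show 2 * l + 1 + k - (2 * l + 1) = k by omega, mul_smul_comm]
        congr 3; push_cast; ring
      · intro k hk
        rw [if_neg (by simpa using hk), mul_zero]
  · intro k hk
    rw [Dk_X_mul, hN k (by omega)]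
    split_ifs
    · rw [hN _ (by omega)]; simp
    · simp

theorem psi_one (j : ℤ) : psi j 1 = sTildeZ (-j) := by
  rw [psi_eq j 1 1 (fun k hk => by rw [Dk_one, if_neg (by omega)])]
  simp [Dk_one]

theorem tTilde_sign (j : ℕ) : ((-1 : ℂ) ^ j) • tTilde j = - tTilde j := by
  unfold tTilde
  split_ifs with h
  · rw [(Nat.odd_iff.2 h).neg_one_pow]; simp
  · simp

theorem sB_neg (n : ℕ) : sG n (fun j => - tTilde j) = ((-1 : ℂ) ^ n) • sB n tTilde := by
  rw [sB_eq, ← sG_sign]; simp only [tTilde_sign]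

theorem sT_conv (T : ℕ) : ∑ r ∈ Finset.range (T + 1),
    ((-1 : ℂ) ^ r) • (sB r tTilde * sB (T - r) tTilde) = if T = 0 then 1 else 0 := by
  rw [← sG_const_zero (R := BRing)]
  have := sG_add (fun j => - tTilde j) tTilde T
  simp only [neg_add_cancel, sB_neg, smul_mul_assoc] at this
  rw [this]; rfl

theorem sum_qc (h : ℤ → BRing) (N : ℕ) :
    ∑ k ∈ Finset.range (N + 1), (if k = 0 then (1 : ℂ) else 2) • (h k + h (-k)) =
      (2 : ℂ) • ∑ b ∈ Finset.Icc (-(N : ℤ)) N, h b := by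
  induction N with
  | zero => simp [two_smul]
  | succ N ih =>
    rw [Finset.sum_range_succ, ih]
    have : Finset.Icc (-((N + 1 : ℕ) : ℤ)) ((N + 1 : ℕ) : ℤ) =
        insert ((N + 1 : ℕ) : ℤ) (insert (-((N + 1 : ℕ) : ℤ)) (Finset.Icc (-(N : ℤ)) N)) := by
      ext x; simp only [Finset.mem_Icc, Finset.mem_insert]; omega
    rw [this, Finset.sum_insert, Finset.sum_insert, if_neg (by omega), ← smul_add]
    · congr 1; ring
    · simp
    · simp only [Finset.mem_Icc, Finset.mem_insert]; omega

theorem sTZ_conv (m n : ℤ) (N : ℕ) (hm : |m| ≤ N) (hn : |n| ≤ N) :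
    ∑ b ∈ Finset.Icc (-(N : ℤ)) N, ((-1 : ℂ) ^ b) • (sTildeZ (m + b) * sTildeZ (n - b)) =
      if m + n = 0 then C ((-1 : ℂ) ^ m) else 0 := by
  rw [abs_le] at hm hn
  rcases lt_or_ge (m + n) 0 with h | h
  · rw [if_neg (by omega)]
    refine Finset.sum_eq_zero fun b _ => ?_
    rcases lt_or_ge (m + b) 0 with h1 | h1
    · rw [sTildeZ_neg h1]; simp
    · rw [sTildeZ_neg (m := n - b) (by omega)]; simp
  · obtain ⟨T, hT⟩ := Int.eq_ofNat_of_zero_le h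
    have key := sT_conv T
    rw [hT]
    have e1 : ∑ b ∈ Finset.Icc (-(N : ℤ)) N,
        ((-1 : ℂ) ^ b) • (sTildeZ (m + b) * sTildeZ (n - b)) =
        ∑ r ∈ Finset.range (T + 1), ((-1 : ℂ) ^ ((r : ℤ) - m)) •
          (sB r tTilde * sB (T - r) tTilde) := by
      symm
      refine Finset.sum_of_injOn (fun r : ℕ => (r : ℤ) - m) ?_ ?_ ?_ ?_
      · intro a _ b _ hab; simpa using hab
      · intro r hr
        simp only [Finset.coe_range, Set.mem_Iio, Finset.coe_Icc, Set.mem_Icc] at hr ⊢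
        omega
      · intro b hb hb'
        rcases lt_or_ge (m + b) 0 with h1 | h1
        · rw [sTildeZ_neg h1]; simp
        rcases lt_or_ge (n - b) 0 with h2 | h2
        · rw [sTildeZ_neg h2]; simp
        exfalso
        apply hb'
        refine ⟨(m + b).toNat, ?_, ?_⟩
        · simp only [Finset.coe_range, Set.mem_Iio]; omega
        · simp only; omega
      · intro r hr
        have hr : r ≤ T := by simpa [Nat.lt_succ_iff] using hr
        rw [← sTildeZ_nat, ← sTildeZ_nat]
        congr 3 <;> omega
    rw [e1]
    have e2 : ∀ r : ℕ, ((-1 : ℂ) ^ ((r : ℤ) - m)) = (-1) ^ m * (-1) ^ r := by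
      intro r
      rw [zpow_sub₀ (by norm_num), zpow_natCast, div_eq_mul_inv, mul_comm, ← zpow_neg]
      congr 1
      rw [zpow_neg, ← inv_zpow]; norm_num
    simp only [e2, mul_smul]
    rw [← Finset.smul_sum, key]
    by_cases hT0 : T = 0
    · simp [hT0, MvPolynomial.smul_eq_C_mul]
    · simp [hT0]

theorem psi_psi_one (i j : ℤ) (N : ℕ) (h : |j| ≤ N) : psi i (psi j 1) =
    ∑ k ∈ Finset.range (N + 1), qc k • (sTildeZ (-i + k) * sTildeZ (-j - k)) := by
  rw [abs_le] at h
  rw [psi_one, psi_eq i _ (N + 1)]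
  · refine Finset.sum_congr rfl fun k _ => ?_
    rw [Dk_sTildeZ, mul_smul_comm]; congr 3; ring
  · intro k hk
    rw [Dk_sTildeZ, sTildeZ_neg (by omega)]; simp

theorem clifford_one (i j : ℤ) : psi i (psi j 1) + psi j (psi i 1) =
    if i + j = 0 then C (2 * (-1 : ℂ) ^ i) else 0 := by
  obtain ⟨N, hN1, hN2⟩ : ∃ N : ℕ, |i| ≤ N ∧ |j| ≤ N :=
    ⟨(max |i| |j|).toNat, by omega, by omega⟩
  rw [psi_psi_one i j N hN2, psi_psi_one j i N hN1, ← Finset.sum_add_distrib]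
  have := sum_qc (fun b => ((-1 : ℂ) ^ b) • (sTildeZ (-i + b) * sTildeZ (-j - b))) N
  rw [sTZ_conv (-i) (-j) N (by rwa [abs_neg]) (by rwa [abs_neg])] at this
  have hl : (2 : ℂ) • (if -i + -j = 0 then (C ((-1 : ℂ) ^ (-i)) : BRing) else 0) =
      if i + j = 0 then C (2 * (-1 : ℂ) ^ i) else 0 := by
    have : (-i + -j = 0) ↔ (i + j = 0) := by omega
    simp only [this]
    have e : (-1 : ℂ) ^ (-i) = (-1) ^ i := by rw [zpow_neg, ← inv_zpow]; norm_num
    split_ifs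
    · rw [e, MvPolynomial.smul_eq_C_mul, ← map_mul]
    · simp
  rw [← hl, ← this]
  refine Finset.sum_congr rfl fun k _ => ?_
  have e : ((-1 : ℂ)) ^ (-(k : ℤ)) = (-1) ^ k := by
    rw [zpow_neg, ← inv_zpow, zpow_natCast]; norm_num
  simp only [e, zpow_natCast, ← smul_add, ← sub_eq_add_neg, sub_neg_eq_add, smul_smul]
  rw [mul_comm (sTildeZ (-i - k))]
  congr 1
  unfold qc
  split_ifs with hk <;> simp [hk]

theorem clifford (i j : ℤ) (p : BRing) : psi i (psi j p) + psi j (psi i p) =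
    (if i + j = 0 then 2 * (-1 : ℂ) ^ i else 0) • p := by
  induction p using MvPolynomial.induction_on generalizing i j with
  | C a =>
    have := clifford_one i j
    rw [← mul_one (C a), ← MvPolynomial.smul_eq_C_mul]
    simp only [map_smul]
    rw [← smul_add, this, smul_comm]
    congr 1
    split_ifs <;> simp [MvPolynomial.smul_eq_C_mul]
  | add p q hp hq =>
    simp only [map_add, smul_add]
    rw [← hp, ← hq]; abel
  | mul_X p l hp =>
    rw [mul_comm p]
    simp only [psi_X_mul, map_sub, map_smul]
    have h1 := hp i j
    have h2 := hp (i - (2 * l + 1 : ℕ)) j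
    have h3 := hp i (j - (2 * l + 1 : ℕ))
    have hs : (-1 : ℂ) ^ (i - (2 * l + 1 : ℕ)) = - (-1) ^ i := by
      rw [zpow_sub₀ (by norm_num), zpow_natCast, (show Odd (2 * l + 1) from ⟨l, rfl⟩).neg_one_pow]
      rw [div_neg, div_one]
    rw [hs, show i - ((2 * l + 1 : ℕ) : ℤ) + j = i + (j - (2 * l + 1 : ℕ)) by ring] at h2
    have h4 : psi (i - (2 * l + 1 : ℕ)) (psi j p) + psi j (psi (i - (2 * l + 1 : ℕ)) p) +
      (psi i (psi (j - (2 * l + 1 : ℕ)) p) + psi (j - (2 * l + 1 : ℕ)) (psi i p)) = 0 := by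
      rw [h2, h3, ← add_smul]
      split_ifs <;> simp
    rw [← mul_smul_comm, ← h1]
    have h5 := congrArg (fun x => cl l • x) h4
    simp only [smul_zero, smul_add] at h5
    linear_combination (-1 : BRing) * h5

end


noncomputable section
open MvPolynomial

theorem sB_tShift (n : ℕ) (c : ℕ → ℂ) : sB n (tShift c) =
    ∑ i ∈ Finset.range (n + 1), sG i c • sTildeZ ((n : ℤ) - i) := by
  have h := sG_add (fun j => (C (c j) : BRing)) tTilde n
  have e : (fun j => (C (c j) : BRing) + tTilde j) = tShift c := by
    funext j; rw [tShift, add_comm]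
  rw [e] at h
  rw [sB_eq, h]
  refine Finset.sum_congr rfl fun i hi => ?_
  have hi : i ≤ n := by simpa [Nat.lt_succ_iff] using hi
  have hC : sG i (fun j => (C (c j) : BRing)) = C (sG i c) :=
    (sG_map (Algebra.ofId ℂ BRing) c i).symm
  rw [hC, MvPolynomial.smul_eq_C_mul, ← sB_eq, ← sTildeZ_nat]
  congr 2; omega

/-- the fermion `∑ s_i(c) φ_{i-l}` -/
def vv (l : ℕ) (c : ℕ → ℂ) : BRing →ₗ[ℂ] BRing :=
  sqrt2⁻¹ • OpB (fun k => sB (k + l) (tShift c))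

theorem vv_trunc (l : ℕ) (c : ℕ → ℂ) (p : BRing) : ∃ M₀ : ℕ, ∀ M, M₀ ≤ M →
    vv l c p = ∑ i ∈ Finset.range M, (sqrt2⁻¹ * sG i c) • psi ((i : ℤ) - l) p := by
  obtain ⟨N, hN⟩ := Dk_bound p
  refine ⟨N + l, fun M hM => ?_⟩
  rw [vv, LinearMap.smul_apply, OpB_eq _ _ N hN]
  simp only [mul_smul]
  rw [← Finset.smul_sum]
  congr 1
  simp only [psi_eq _ p N hN, Finset.smul_sum]
  rw [Finset.sum_comm]
  refine Finset.sum_congr rfl fun k hk => ?_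
  have hk : k < N := by simpa using hk
  rw [sB_tShift, Finset.sum_mul]
  rw [Finset.sum_subset (s₂ := Finset.range M)]
  · refine Finset.sum_congr rfl fun i _ => ?_
    rw [smul_mul_assoc]; congr 3; push_cast; ring
  · intro x hx
    simp only [Finset.mem_range] at hx ⊢
    omega
  · intro x _ hx
    rw [sTildeZ_neg]
    · simp
    · simp only [Finset.mem_range] at hx
      omega

/-- anticommutator constants -/
def kap (l : ℕ) (c : ℕ → ℂ) (j : ℤ) : ℂ :=
  if j ≤ l then sqrt2⁻¹ * sG (l - j).toNat c * (2 * (-1) ^ j) else 0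

theorem vv_anti (l : ℕ) (c : ℕ → ℂ) (j : ℤ) (p : BRing) :
    psi j (vv l c p) + vv l c (psi j p) = kap l c j • p := by
  obtain ⟨M₁, h₁⟩ := vv_trunc l c p
  obtain ⟨M₂, h₂⟩ := vv_trunc l c (psi j p)
  set M := max (max M₁ M₂) ((l - j).toNat + 1) with hM
  rw [h₁ M (by omega), h₂ M (by omega), map_sum, ← Finset.sum_add_distrib]
  simp only [map_smul, ← smul_add, clifford]
  unfold kap
  split_ifs with h
  · rw [Finset.sum_eq_single (l - j).toNat]
    · rw [if_pos (by omega), smul_smul]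
    · intro b _ hb
      rw [if_neg (by omega)]; simp
    · intro hh
      exact absurd (Finset.mem_range.2 (by omega)) hh
  · rw [zero_smul]
    refine Finset.sum_eq_zero fun i _ => ?_
    rw [if_neg (by omega)]; simp

/-- iterated application of operators to `1` -/
def wick : (m : ℕ) → (Fin m → (BRing →ₗ[ℂ] BRing)) → BRing
  | 0, _ => 1
  | m + 1, v => v 0 (wick m fun i => v i.succ)

theorem wick_move (x : BRing →ₗ[ℂ] BRing) (ε : ℂ) (hx : x 1 = ε • 1) (m : ℕ)
    (v : Fin (m + 1) → (BRing →ₗ[ℂ] BRing)) (κ : Fin (m + 1) → ℂ)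
    (h : ∀ i p, x (v i p) + v i (x p) = κ i • p) :
    x (wick (m + 1) v) = ∑ l : Fin (m + 1), ((-1) ^ (l : ℕ) * κ l) •
      wick m (fun i => v (l.succAbove i)) + ((-1) ^ (m + 1) * ε) • wick (m + 1) v := by
  induction m with
  | zero =>
    have := h 0 1
    rw [hx, map_smul] at this
    simp [wick, ← this]
  | succ m ih =>
    rw [wick]
    have h0 := h 0 (wick (m + 1) fun i => v i.succ)
    rw [ih (fun i => v i.succ) (fun i => κ i.succ) (fun i p => h i.succ p)] at h0
    rw [eq_sub_of_add_eq h0, map_add, map_sum, Fin.sum_univ_succ (n := m + 1)]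
    simp only [map_smul, Fin.succAbove_zero, Fin.val_zero, pow_zero, one_mul, Fin.val_succ]
    have hw : ∀ l : Fin (m + 1), wick (m + 1) (fun i => v (l.succ.succAbove i)) =
        v 0 (wick m fun i => v (l.succAbove i).succ) := by
      intro l; simp [wick]
    simp only [hw]
    rw [pow_succ _ (m + 1)]
    simp only [pow_succ _ (_ : ℕ), mul_neg_one, neg_mul, neg_smul, Finset.sum_neg_distrib]
    abel

theorem tri (R : ℕ → BRing) (N : ℕ) (hN : ∀ k, N ≤ k → R k = 0)
    (h : ∀ j : ℕ, 1 ≤ j → ∑ k ∈ Finset.range N, sTildeZ ((k : ℤ) - j) * R k = 0) :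
    ∀ k, 1 ≤ k → R k = 0 := by
  have key : ∀ n k, 1 ≤ k → N ≤ k + n → R k = 0 := by
    intro n
    induction n with
    | zero => intro k _ hk; exact hN k hk
    | succ n ih =>
      intro k hk1 hk
      by_cases hkN : N ≤ k
      · exact hN k hkN
      have := h k hk1
      rw [Finset.sum_eq_single k] at this
      · simpa [sTildeZ_zero] using this
      · intro b _ hb
        rcases lt_or_gt_of_ne hb with hb | hb
        · rw [sTildeZ_neg (by omega), zero_mul]
        · rw [ih b (by omega) (by omega), mul_zero]
      · intro hh; exact absurd (Finset.mem_range.2 (by omega)) hh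
  intro k hk
  exact key N k hk (by omega)

theorem wick_D (m : ℕ) (hm : Even m) (v : Fin (m + 1) → (BRing →ₗ[ℂ] BRing))
    (κ : Fin (m + 1) → ℤ → ℂ) (h : ∀ i j p, psi j (v i p) + v i (psi j p) = κ i j • p) (k : ℕ) :
    Dk k (wick (m + 1) v) = ∑ l : Fin (m + 1), ((-1 : ℂ) ^ (l : ℕ)) •
      (Dk k (v l 1) * wick m (fun i => v (l.succAbove i))) := by
  set P := wick (m + 1) v with hP
  set W : Fin (m + 1) → BRing := fun l => wick m (fun i => v (l.succAbove i)) with hW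
  let R : ℕ → BRing := fun k => Dk k P - ∑ l : Fin (m + 1), ((-1 : ℂ) ^ (l : ℕ)) •
      (Dk k (v l 1) * W l)
  suffices hR : ∀ k, R k = 0 from sub_eq_zero.1 (hR k)
  obtain ⟨N, hN1, hN2⟩ : ∃ N, (∀ k, N ≤ k → Dk k P = 0) ∧
      ∀ l, ∀ k, N ≤ k → Dk k (v l 1) = 0 := by
    obtain ⟨N₀, h₀⟩ := Dk_bound P
    choose N₁ h₁ using fun l => Dk_bound (v l 1)
    refine ⟨N₀ + ∑ l, N₁ l, fun k hk => h₀ k (by omega), fun l k hk => h₁ l k ?_⟩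
    have := Finset.single_le_sum (f := N₁) (fun i _ => Nat.zero_le _) (Finset.mem_univ l)
    omega
  have hRN : ∀ k, N ≤ k → R k = 0 := by
    intro k hk
    simp only [R]
    rw [hN1 k hk]
    simp [hN2 _ k hk]
  have hF : ∀ j : ℤ, ∑ k ∈ Finset.range N, sTildeZ ((k : ℤ) - j) * R k =
      psi j P - ∑ l : Fin (m + 1), ((-1 : ℂ) ^ (l : ℕ)) • (psi j (v l 1) * W l) := by
    intro j
    rw [psi_eq j P N hN1]
    simp only [psi_eq j _ N (hN2 _), R, mul_sub, Finset.sum_sub_distrib]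
    congr 1
    simp only [Finset.mul_sum, Finset.sum_mul, Finset.smul_sum]
    rw [Finset.sum_comm]
    refine Finset.sum_congr rfl fun l _ => Finset.sum_congr rfl fun k _ => ?_
    rw [mul_smul_comm, mul_assoc]
  have hR0 : R 0 = P - ∑ l : Fin (m + 1), ((-1 : ℂ) ^ (l : ℕ)) • (v l 1 * W l) := by
    simp only [R, Dk_zero]
  have hF2 : ∀ (j : ℤ) (ε : ℂ), psi j 1 = ε • 1 →
      ∑ k ∈ Finset.range N, sTildeZ ((k : ℤ) - j) * R k = - (ε • R 0) := by
    intro j ε hε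
    rw [hF, wick_move (psi j) ε hε m v (fun i => κ i j) (fun i p => h i j p)]
    have hv : ∀ l, psi j (v l 1) = κ l j • 1 - ε • v l 1 := by
      intro l
      rw [← h l j 1, hε, map_smul]; abel
    simp only [hv, hR0, (hm.add_one).neg_one_pow, sub_mul, smul_sub, Finset.sum_sub_distrib,
      smul_mul_assoc, one_mul, mul_smul, Finset.smul_sum, neg_smul, one_smul,
      smul_comm ε]
    rw [← hP]
    simp only [W]
    abel
  have hRk : ∀ k, 1 ≤ k → R k = 0 := by
    refine tri R N hRN fun j hj => ?_
    rw [hF2 j 0]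
    · simp
    · rw [psi_one, sTildeZ_neg (by omega)]; simp
  intro k
  rcases Nat.eq_zero_or_pos k with rfl | hk
  · by_cases hN0 : N = 0
    · exact hRN 0 (by omega)
    have h0 := hF2 0 1 (by rw [psi_one]; simp [sTildeZ_zero])
    rw [Finset.sum_eq_single 0] at h0
    · have h1 : R 0 = - R 0 := by simpa [sTildeZ_zero] using h0
      exact self_eq_neg.1 h1
    · intro b _ hb
      rw [hRk b (by omega), mul_zero]
    · intro hh; exact absurd (Finset.mem_range.2 (by omega)) hh
  · exact hRk k hk

theorem wick_Op (β : ℕ → BRing) (m : ℕ) (hm : Even m) (v : Fin (m + 1) → (BRing →ₗ[ℂ] BRing))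
    (κ : Fin (m + 1) → ℤ → ℂ) (h : ∀ i j p, psi j (v i p) + v i (psi j p) = κ i j • p) :
    OpB β (wick (m + 1) v) = ∑ l : Fin (m + 1), ((-1 : ℂ) ^ (l : ℕ)) •
      (OpB β (v l 1) * wick m (fun i => v (l.succAbove i))) := by
  obtain ⟨N, hN1, hN2⟩ : ∃ N, (∀ k, N ≤ k → Dk k (wick (m + 1) v) = 0) ∧
      ∀ l, ∀ k, N ≤ k → Dk k (v l 1) = 0 := by
    obtain ⟨N₀, h₀⟩ := Dk_bound (wick (m + 1) v)
    choose N₁ h₁ using fun l => Dk_bound (v l 1)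
    refine ⟨N₀ + ∑ l, N₁ l, fun k hk => h₀ k (by omega), fun l k hk => h₁ l k ?_⟩
    have := Finset.single_le_sum (f := N₁) (fun i _ => Nat.zero_le _) (Finset.mem_univ l)
    omega
  rw [OpB_eq β _ N hN1]
  simp only [OpB_eq β _ N (hN2 _), wick_D m hm v κ h, Finset.mul_sum, Finset.sum_mul,
    Finset.smul_sum]
  rw [Finset.sum_comm]
  refine Finset.sum_congr rfl fun l _ => Finset.sum_congr rfl fun k _ => ?_
  rw [mul_smul_comm, mul_assoc]

theorem vv_one (l : ℕ) (c : ℕ → ℂ) : vv l c 1 = sqrt2⁻¹ • sB l (tShift c) := by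
  rw [vv, LinearMap.smul_apply, OpB_eq _ _ 1 (fun k hk => by rw [Dk_one, if_neg (by omega)])]
  simp [Dk_one]

theorem sqrt2_sq : sqrt2 * sqrt2 = 2 := by
  unfold sqrt2
  rw [← Complex.ofReal_mul, Real.mul_self_sqrt (by norm_num)]; norm_num

theorem sqrt2_ne : sqrt2 ≠ 0 := by
  intro h
  have := sqrt2_sq
  rw [h] at this; norm_num at this

theorem sqrt2_inv_sq : sqrt2⁻¹ * sqrt2⁻¹ = 2⁻¹ := by
  rw [← mul_inv, sqrt2_sq]

theorem vv_vv_one (l μ : ℕ) (c c' : ℕ → ℂ) :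
    vv l c (vv μ c' 1) = rhoB l μ (tShift c) (tShift c') 0 0 := by
  rw [vv_one, map_smul, vv, LinearMap.smul_apply, OpB_eq _ _ (μ + 1), rhoB]
  · simp only [Dk_sB]
    rw [Finset.sum_range_succ', smul_smul, sqrt2_inv_sq, smul_add, Finset.smul_sum, add_comm]
    congr 1
    · simp only [map_zero, sub_zero, add_zero, smul_mul_smul_comm, sqrt2_inv_sq]
      simp [qc]
    · rw [show Finset.Icc 1 μ = Finset.Ico 1 (μ + 1) by
        ext x; simp only [Finset.mem_Icc, Finset.mem_Ico]; omega, Finset.sum_Ico_eq_sum_range, Nat.add_sub_cancel]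
      refine Finset.sum_congr rfl fun k hk => ?_
      have hk : k < μ := by simpa using hk
      rw [if_pos (by omega), mul_smul_comm, smul_smul, add_comm 1 k, add_comm l]
      congr 1
      simp [qc]
  · intro k hk
    rw [Dk_sB, if_neg (by omega)]

theorem rho1B_vv (l : ℕ) (c : ℕ → ℂ) : rho1B l (tShift c) 0 = vv l c 1 := by
  rw [vv_one, rho1B]; simp

end


noncomputable section
open MvPolynomial

/-- perms sending `0` to `i` -/
def pH {n : ℕ} (i : Fin (n + 1)) (e : Equiv.Perm (Fin n)) : Equiv.Perm (Fin (n + 1)) :=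
  (Fin.cycleRange i).symm * Equiv.Perm.decomposeFin.symm (0, e)

theorem pH_zero {n : ℕ} (i : Fin (n + 1)) (e : Equiv.Perm (Fin n)) : pH i e 0 = i := by
  simp [pH]

theorem pH_succ {n : ℕ} (i : Fin (n + 1)) (e : Equiv.Perm (Fin n)) (k : Fin n) :
    pH i e k.succ = i.succAbove (e k) := by
  simp [pH]

theorem pH_sign {n : ℕ} (i : Fin (n + 1)) (e : Equiv.Perm (Fin n)) :
    Equiv.Perm.sign (pH i e) = (-1) ^ (i : ℕ) * Equiv.Perm.sign e := by
  have : (Fin.cycleRange i).symm = (Fin.cycleRange i)⁻¹ := rfl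
  rw [pH, this, Equiv.Perm.sign_mul, Equiv.Perm.sign_inv, Fin.sign_cycleRange]
  simp

theorem pH_inj {n : ℕ} : Function.Injective
    (fun x : Fin (n + 1) × Equiv.Perm (Fin n) => pH x.1 x.2) := by
  rintro ⟨i, e⟩ ⟨i', e'⟩ h
  simp only at h
  have h0 : i = i' := by rw [← pH_zero i e, h, pH_zero]
  subst h0
  have : e = e' := by
    ext k : 1
    have := congrArg (fun s => s k.succ) h
    simpa [pH_succ] using this
  rw [this]

theorem pH_surj {n : ℕ} (σ : Equiv.Perm (Fin (n + 1))) : ∃ i e, pH i e = σ := by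
  have := ((Fintype.bijective_iff_injective_and_card
    (fun x : Fin (n + 1) × Equiv.Perm (Fin n) => pH x.1 x.2)).2
      ⟨pH_inj, Fintype.card_congr Equiv.Perm.decomposeFin.symm⟩).2 σ
  obtain ⟨⟨i, e⟩, h⟩ := this
  exact ⟨i, e, h⟩

/-- perms sending `0` to `0` and `1` to `l+1` -/
def pG {m : ℕ} (l : Fin (m + 1)) (e : Equiv.Perm (Fin m)) : Equiv.Perm (Fin (m + 2)) :=
  pH 0 (pH l e)

theorem pG_zero {m : ℕ} (l : Fin (m + 1)) (e : Equiv.Perm (Fin m)) (h : 0 < m + 2) :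
    pG l e ⟨0, h⟩ = 0 := pH_zero _ _

theorem pG_one {m : ℕ} (l : Fin (m + 1)) (e : Equiv.Perm (Fin m)) (h : 1 < m + 2) :
    pG l e ⟨1, h⟩ = l.succ := by
  have := pH_succ 0 (pH l e) 0
  rw [pH_zero, Fin.succAbove_zero] at this
  exact this

theorem pG_add_two {m : ℕ} (l : Fin (m + 1)) (e : Equiv.Perm (Fin m)) (x : ℕ) (h : x + 2 < m + 2) :
    pG l e ⟨x + 2, h⟩ = (l.succAbove (e ⟨x, by omega⟩)).succ := by
  exact (pH_succ 0 (pH l e) (Fin.succ ⟨x, by omega⟩)).trans (by rw [pH_succ, Fin.succAbove_zero])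

theorem pG_sign {m : ℕ} (l : Fin (m + 1)) (e : Equiv.Perm (Fin m)) :
    Equiv.Perm.sign (pG l e) = (-1) ^ (l : ℕ) * Equiv.Perm.sign e := by
  rw [pG, pH_sign, pH_sign]; simp

theorem pG_inj {m : ℕ} : Function.Injective
    (fun x : Fin (m + 1) × Equiv.Perm (Fin m) => pG x.1 x.2) := by
  rintro ⟨i, e⟩ ⟨i', e'⟩ h
  have h1 := @pH_inj (m + 1) (0, pH i e) (0, pH i' e') h
  exact @pH_inj m (i, e) (i', e') (Prod.mk.inj h1).2

theorem pG_cond {m : ℕ} (l : Fin (m + 1)) (e : Equiv.Perm (Fin m)) :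
    pfaffianCond (pG l e) ↔ pfaffianCond e := by
  have hlt : ∀ a b : Fin m, (l.succAbove a).succ < (l.succAbove b).succ ↔ a < b := by
    intro a b
    rw [Fin.succ_lt_succ_iff, (Fin.strictMono_succAbove l).lt_iff_lt]
  constructor
  · rintro ⟨h1, h2⟩
    refine ⟨fun i => ?_, fun i j hij => ?_⟩
    · have := h1 ⟨i.val + 1, by omega⟩
      simp only [show 2 * (i.val + 1) = 2 * i.val + 2 by ring,
        show 2 * i.val + 2 + 1 = 2 * i.val + 1 + 2 by ring, pG_add_two, hlt] at this
      exact this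
    · have := h2 ⟨i.val + 1, by omega⟩ ⟨j.val + 1, by omega⟩ (by
        rw [Fin.lt_def] at hij ⊢; simpa using hij)
      simp only [show ∀ x, 2 * (x + 1) = 2 * x + 2 from fun x => by ring, pG_add_two, hlt] at this
      exact this
  · rintro ⟨h1, h2⟩
    refine ⟨?_, ?_⟩
    · rintro ⟨i, hi⟩
      cases i with
      | zero =>
        simp only [Nat.mul_zero, Nat.zero_add, pG_zero, pG_one]
        exact Fin.succ_pos l
      | succ i =>
        simp only [show 2 * (i + 1) = 2 * i + 2 by ring,
          show 2 * i + 2 + 1 = 2 * i + 1 + 2 by ring, pG_add_two, hlt]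
        exact h1 ⟨i, by omega⟩
    · rintro ⟨i, hi⟩ ⟨j, hj⟩ hij
      rw [Fin.lt_def] at hij
      simp only at hij
      obtain ⟨j, rfl⟩ : ∃ j', j = j' + 1 := ⟨j - 1, by omega⟩
      cases i with
      | zero =>
        simp only [Nat.mul_zero, pG_zero,
          show 2 * (j + 1) = 2 * j + 2 by ring, pG_add_two]
        exact Fin.succ_pos _
      | succ i =>
        simp only [show ∀ x, 2 * (x + 1) = 2 * x + 2 from fun x => by ring, pG_add_two, hlt]
        exact h2 ⟨i, by omega⟩ ⟨j, by omega⟩ (by rw [Fin.lt_def]; simp only; omega)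

theorem cond_pG {m : ℕ} (hm : Even m) (σ : Equiv.Perm (Fin (m + 2))) (h : pfaffianCond σ) :
    ∃ l e, pG l e = σ := by
  obtain ⟨r, hr⟩ := hm
  have h0 : σ 0 = 0 := by
    obtain ⟨x, hx⟩ := σ.surjective 0
    obtain ⟨x, hxm⟩ := x
    rcases Nat.even_or_odd' x with ⟨i, hi | hi⟩
    · subst hi
      rcases Nat.eq_zero_or_pos i with rfl | hpos
      · exact hx
      · have := h.2 ⟨0, by omega⟩ ⟨i, by omega⟩ (by rw [Fin.lt_def]; exact hpos)
        simp only [hx] at this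
        exact absurd this (Fin.not_lt_zero _)
    · subst hi
      have := h.1 ⟨i, by omega⟩
      simp only [hx] at this
      exact absurd this (Fin.not_lt_zero _)
  obtain ⟨i, e, rfl⟩ := pH_surj σ
  rw [pH_zero] at h0
  subst h0
  obtain ⟨l, e', rfl⟩ := pH_surj e
  exact ⟨l, e', rfl⟩

theorem pfaffian_expand {R : Type*} [CommRing R] {m : ℕ} (hm : Even m)
    (A : Matrix (Fin (m + 2)) (Fin (m + 2)) R) :
    pfaffian A = ∑ l : Fin (m + 1), ((-1 : R) ^ (l : ℕ)) * (A 0 l.succ *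
      pfaffian (A.submatrix (fun i => (l.succAbove i).succ) (fun i => (l.succAbove i).succ))) := by
  classical
  unfold pfaffian
  simp only [Finset.mul_sum]
  rw [← Finset.sum_product' (s := Finset.univ) (t := Finset.univ)
    (f := fun (l : Fin (m + 1)) (e : Equiv.Perm (Fin m)) => (-1 : R) ^ (l : ℕ) * (A 0 l.succ *
      (if pfaffianCond e then
      (Equiv.Perm.sign e : ℤ) •
        ∏ i : Fin (m / 2),
          (A.submatrix (fun i => (l.succAbove i).succ) (fun i => (l.succAbove i).succ))
            (e ⟨2 * i.val, by have := i.isLt; omega⟩)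
            (e ⟨2 * i.val + 1, by have := i.isLt; omega⟩)
      else 0)))]
  symm
  refine Finset.sum_of_injOn (fun x => pG x.1 x.2) (pG_inj.injOn) (by simp) ?_ ?_
  · intro σ _ hσ
    rw [if_neg]
    intro hc
    apply hσ
    obtain ⟨l, e, rfl⟩ := cond_pG hm σ hc
    exact ⟨(l, e), by simp, rfl⟩
  · rintro ⟨l, e⟩ _
    simp only [pG_cond]
    split_ifs with hc
    · have hd : m / 2 + 1 = (m + 2) / 2 := by omega
      rw [← Fintype.prod_equiv (finCongr hd) (fun i : Fin (m / 2 + 1) =>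
        A (pG l e ⟨2 * i.val, by have := i.isLt; omega⟩)
          (pG l e ⟨2 * i.val + 1, by have := i.isLt; omega⟩)) _ (fun i => rfl)]
      rw [Fin.prod_univ_succ]
      simp only [Fin.val_zero, Nat.mul_zero, Nat.zero_add, pG_zero, pG_one, Fin.val_succ,
        show ∀ x, 2 * (x + 1) = 2 * x + 2 from fun x => by ring,
        show ∀ x, 2 * x + 2 + 1 = 2 * x + 1 + 2 from fun x => by ring, pG_add_two,
        Matrix.submatrix_apply, pG_sign, zsmul_eq_mul]
      push_cast
      ring
    · simp

theorem skewOf_submatrix {R : Type*} [CommRing R] {m k : ℕ} (f : Fin m → Fin m → R)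
    (g : Fin k → Fin m) (hg : StrictMono g) :
    (skewOf f).submatrix g g = skewOf (fun i j => f (g i) (g j)) := by
  ext i j
  simp [skewOf, hg.lt_iff_lt]

theorem sm_aux {m : ℕ} (l : Fin (m + 1)) :
    StrictMono (fun i : Fin m => (l.succAbove i).succ) :=
  fun _ _ h => Fin.succ_lt_succ_iff.2 (Fin.strictMono_succAbove l h)

theorem pf_even (n : ℕ) : ∀ (lam : Fin (2 * n) → ℕ) (c : Fin (2 * n) → ℕ → ℂ),
    wick (2 * n) (fun i => vv (lam i) (c i)) =
      pfaffian (skewOf fun i j => vv (lam i) (c i) (vv (lam j) (c j) 1)) := by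
  induction n with
  | zero =>
    intro lam c
    have : pfaffianCond (1 : Equiv.Perm (Fin (2 * 0))) :=
      ⟨fun i => i.elim0, fun i => i.elim0⟩
    simp only [wick, pfaffian, Nat.mul_zero] at this ⊢
    rw [Finset.sum_eq_single 1]
    · rw [if_pos this]; simp
    · intro b _ hb
      exact absurd (Subsingleton.elim b 1) hb
    · simp
  | succ n ih =>
    intro lam c
    change Fin (2 * n + 2) → ℕ at lam
    change Fin (2 * n + 2) → ℕ → ℂ at c
    change wick (2 * n + 1 + 1) (fun i => vv (lam i) (c i)) = pfaffian (m := 2 * n + 2)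
      (skewOf fun i j => vv (lam i) (c i) (vv (lam j) (c j) 1))
    rw [pfaffian_expand (even_two_mul n), wick]
    have := wick_Op (fun k => sB (k + lam 0) (tShift (c 0))) (2 * n) (even_two_mul n)
      (fun i => vv (lam i.succ) (c i.succ)) (fun i => kap (lam i.succ) (c i.succ))
      (fun i j p => vv_anti _ _ _ _)
    have h2 : vv (lam 0) (c 0) (wick (2 * n + 1) fun i => vv (lam i.succ) (c i.succ)) =
      sqrt2⁻¹ • OpB (fun k => sB (k + lam 0) (tShift (c 0)))
        (wick (2 * n + 1) fun i => vv (lam i.succ) (c i.succ)) := rfl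
    rw [h2, this, Finset.smul_sum]
    refine Finset.sum_congr rfl fun l _ => ?_
    rw [skewOf_submatrix _ _ (sm_aux l), ← ih (fun i => lam (l.succAbove i).succ)
      (fun i => c (l.succAbove i).succ)]
    have h3 : (skewOf fun i j => vv (lam i) (c i) (vv (lam j) (c j) 1)) 0 l.succ =
      sqrt2⁻¹ • OpB (fun k => sB (k + lam 0) (tShift (c 0))) (vv (lam l.succ) (c l.succ) 1) := by
      simp [skewOf, Fin.succ_pos, vv]
    rw [h3, smul_comm, smul_mul_assoc, Algebra.smul_def ((-1 : ℂ) ^ (l : ℕ))]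
    simp

theorem rmo_zero {m : ℕ} (lam : Fin m → ℕ) (c : Fin m → ℕ → ℂ) (l : Fin m) :
    rhoMatrixOdd lam c (fun _ => 0) 0 l.succ = vv (lam l) (c l) 1 := by
  rw [← rho1B_vv]
  unfold rhoMatrixOdd skewOf
  rw [Matrix.of_apply, if_pos (Fin.succ_pos l)]
  beta_reduce
  rw [if_pos (by simp), dif_neg (by simp)]
  rfl

theorem rmo_sub {m k : ℕ} (lam : Fin m → ℕ) (c : Fin m → ℕ → ℂ) (g : Fin k → Fin m)
    (hg : StrictMono g) :
    (rhoMatrixOdd lam c (fun _ => 0)).submatrix (fun i => (g i).succ) (fun i => (g i).succ) =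
      skewOf fun i j => vv (lam (g i)) (c (g i)) (vv (lam (g j)) (c (g j)) 1) := by
  unfold rhoMatrixOdd
  rw [skewOf_submatrix _ (fun i => (g i).succ) (fun _ _ h => Fin.succ_lt_succ_iff.2 (hg h))]
  congr 1
  funext i j
  rw [vv_vv_one, if_neg (by simp), dif_neg (by simp)]
  rfl

theorem pf_odd (n : ℕ) (lam : Fin (2 * n + 1) → ℕ) (c : Fin (2 * n + 1) → ℕ → ℂ) :
    wick (2 * n + 1) (fun i => vv (lam i) (c i)) =
      pfaffian (rhoMatrixOdd lam c (fun _ => 0)) := by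
  have e1 := pfaffian_expand (even_two_mul n) (rhoMatrixOdd lam c (fun _ => 0))
  have := wick_D (2 * n) (even_two_mul n)
      (fun i => vv (lam i) (c i)) (fun i => kap (lam i) (c i))
      (fun i j p => vv_anti _ _ _ _) 0
  simp only [Dk_zero] at this
  refine this.trans (Eq.trans ?_ e1.symm)
  refine Finset.sum_congr rfl fun l _ => ?_
  rw [rmo_zero, rmo_sub _ _ _ (Fin.strictMono_succAbove l), ← pf_even n (fun i => lam (l.succAbove i))
      (fun i => c (l.succAbove i)), Algebra.smul_def ((-1 : ℂ) ^ (l : ℕ))]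
  simp

end


noncomputable section
open MvPolynomial

theorem pderiv_Dk (i k : ℕ) (p : BRing) : pderiv i (Dk k p) = Dk k (pderiv i p) := by
  induction p using MvPolynomial.induction_on generalizing k with
  | C a => rw [Dk_C, pderiv_C, map_zero]; split_ifs <;> simp
  | add p q hp hq => simp only [map_add, hp, hq]
  | mul_X p l hp =>
    have e : pderiv i (X l : BRing) = if i = l then 1 else 0 := by
      rw [pderiv_X]; by_cases h : i = l <;> simp [h]
    rw [mul_comm p, Dk_X_mul, map_sub, pderiv_mul, pderiv_mul, map_add, Dk_X_mul, hp, e]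
    rcases eq_or_ne i l with rfl | h2
    · by_cases h : 2 * i + 1 ≤ k <;> simp [h, hp] <;> ring
    · by_cases h : 2 * l + 1 ≤ k <;> simp [h, h2, hp]

theorem deriv_shA (p : BRing) : ∃ L₀ : ℕ, ∀ L, L₀ ≤ L →
    Polynomial.derivative (shA p) = ∑ i ∈ Finset.range L,
      Polynomial.C (-2 : BRing) * (Polynomial.X ^ (2 * i) * shA (pderiv i p)) := by
  induction p using MvPolynomial.induction_on with
  | C a =>
    refine ⟨0, fun L _ => ?_⟩
    have hC : shA (C a) = Polynomial.C (C a) := by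
      rw [← MvPolynomial.algebraMap_eq, AlgHom.commutes]; rfl
    simp [hC]
  | add p q hp hq =>
    obtain ⟨L₁, h₁⟩ := hp
    obtain ⟨L₂, h₂⟩ := hq
    refine ⟨max L₁ L₂, fun L hL => ?_⟩
    simp only [map_add, h₁ L (by omega), h₂ L (by omega), mul_add, Finset.sum_add_distrib]
  | mul_X p l hp =>
    obtain ⟨L₁, h₁⟩ := hp
    refine ⟨max L₁ (l + 1), fun L hL => ?_⟩
    have hX : shA (X l) = Polynomial.C (MvPolynomial.X l) -
      Polynomial.C (MvPolynomial.C (cl l)) * Polynomial.X ^ (2 * l + 1) := by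
      simp [shA, cl]
    have hd : Polynomial.derivative (shA (X l)) = Polynomial.C (-2 : BRing) * Polynomial.X ^ (2 * l) := by
      rw [hX, map_sub, Polynomial.derivative_C, Polynomial.derivative_C_mul,
        Polynomial.derivative_X_pow, zero_sub, ← mul_assoc, ← Polynomial.C_mul]
      have : C (cl l) * ((2 * l + 1 : ℕ) : BRing) = 2 := by
        rw [← map_natCast (C : ℂ →+* BRing), ← C_mul, cl, div_mul_cancel₀ _ (Nat.cast_ne_zero.2 (by omega))]
        exact map_ofNat C 2
      rw [this, Nat.add_sub_cancel, Polynomial.C_neg]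
      exact (neg_mul _ _).symm
    have e : ∀ i, pderiv i (X l : BRing) = if i = l then 1 else 0 := by
      intro i
      rw [pderiv_X]; by_cases h : i = l <;> simp [h]
    have e2 : ∀ i, shA (pderiv i (p * X l)) =
        shA (pderiv i p) * shA (X l) + if i = l then shA p else 0 := by
      intro i
      rw [pderiv_mul, e, map_add, map_mul]
      split_ifs <;> simp
    simp only [e2, mul_add, Finset.sum_add_distrib, mul_ite, mul_zero]
    rw [Finset.sum_ite_eq', if_pos (Finset.mem_range.2 (by omega)), map_mul,
      Polynomial.derivative_mul, h₁ L (by omega), hd, Finset.sum_mul]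
    refine congrArg₂ (· + ·) ?_ ?_
    · exact Finset.sum_congr rfl fun i _ => by simp only [mul_assoc]
    · rw [mul_comm, mul_assoc]

theorem vacuum (τ : BRing) (h : ∀ j : ℤ, 0 < j → psi j τ = 0) : ∃ a, τ = C a := by
  obtain ⟨N, hN⟩ := Dk_bound τ
  have hD : ∀ k, 1 ≤ k → Dk k τ = 0 := tri (fun k => Dk k τ) N hN (fun j hj => by
    rw [← psi_eq _ _ N hN]; exact h j (by omega))
  have hs : ∀ i k, Dk k (pderiv i τ) = if k = 0 then pderiv i τ else 0 := by
    intro i k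
    split_ifs with hk
    · rw [hk, Dk_zero]
    · rw [← pderiv_Dk, hD k (by omega), map_zero]
  have hp : ∀ i, pderiv i τ = 0 := by
    intro i
    obtain ⟨L₀, hL⟩ := deriv_shA τ
    have h1 := hL (max L₀ (i + 1)) (by omega)
    have h2 := congrArg (fun q => Polynomial.coeff q (2 * i)) h1
    simp only [Polynomial.coeff_derivative, Polynomial.finsetSum_coeff] at h2
    rw [← Dk_apply, hD _ (by omega), zero_mul, Finset.sum_eq_single i] at h2
    · rw [Polynomial.coeff_C_mul, Polynomial.coeff_X_pow_mul', if_pos le_rfl, ← Dk_apply,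
        hs, if_pos (by omega)] at h2
      simpa using h2.symm
    · intro b _ hb
      rw [Polynomial.coeff_C_mul, Polynomial.coeff_X_pow_mul', ← Dk_apply,
        hs]
      split_ifs with h3 h4
      · omega
      · simp
      · simp
    · intro hi; exact absurd (Finset.mem_range.2 (by omega)) hi
  refine ⟨coeff 0 τ, ?_⟩
  ext m
  rw [coeff_C]
  split_ifs with hm
  · rw [hm]
  · obtain ⟨i, hi⟩ : ∃ i, m i ≠ 0 := by
      by_contra! hc
      exact hm (Finsupp.ext fun i => (hc i).symm)
    have := coeff_pderiv (i := i) τ (m - Finsupp.single i 1)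
    rw [hp, coeff_zero, tsub_add_cancel_of_le
      (Finsupp.single_le_iff.2 (Nat.one_le_iff_ne_zero.2 hi))] at this
    rcases mul_eq_zero.1 this.symm with h4 | h4
    · exact h4
    · exact absurd h4 (Nat.cast_add_one_ne_zero _)

theorem shP_coeff (p : BRing) (k : ℕ) : (shiftPlus p).coeff k = ((-1 : ℂ) ^ k) • Dk k p := by
  let shP : BRing →ₐ[ℂ] Polynomial BRing := MvPolynomial.aeval
    (fun i => Polynomial.C (MvPolynomial.X i) +
      Polynomial.C (MvPolynomial.C ((2 : ℂ) / ((2 * i + 1 : ℕ) : ℂ))) *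
        Polynomial.X ^ (2 * i + 1))
  change (shP p).coeff k = _
  induction p using MvPolynomial.induction_on generalizing k with
  | C a =>
    have hC : shP (C a) = Polynomial.C (C a) := by
      rw [← MvPolynomial.algebraMap_eq, AlgHom.commutes]; rfl
    rw [hC, Dk_C, Polynomial.coeff_C]
    split_ifs with h
    · simp [h]
    · simp
  | add p q hp hq => simp only [map_add, Polynomial.coeff_add, hp, hq, smul_add]
  | mul_X p l hp =>
    have hX : shP (X l) = Polynomial.C (MvPolynomial.X l) +
      Polynomial.C (MvPolynomial.C (cl l)) * Polynomial.X ^ (2 * l + 1) := by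
      simp [shP, cl]
    rw [mul_comm p, Dk_X_mul, map_mul, hX, add_mul, Polynomial.coeff_add, Polynomial.coeff_C_mul,
      mul_assoc, Polynomial.coeff_C_mul, Polynomial.coeff_X_pow_mul', hp, smul_sub, sub_eq_add_neg,
      mul_smul_comm]
    congr 1
    split_ifs with h
    · rw [hp]
      obtain ⟨r, rfl⟩ := Nat.exists_eq_add_of_le h
      rw [Nat.add_sub_cancel_left, ← MvPolynomial.smul_eq_C_mul, smul_smul, smul_smul, ← neg_smul,
        pow_add, pow_succ, pow_mul]
      congr 1
      simp
      ring
    · simp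

theorem sTildeNegZ_eq (m : ℤ) : sTildeNegZ m = ((-1 : ℂ) ^ m) • sTildeZ m := by
  unfold sTildeNegZ sTildeZ
  split_ifs with h
  · obtain ⟨n, rfl⟩ := Int.eq_ofNat_of_zero_le h
    rw [Int.toNat_natCast, zpow_natCast]
    exact sB_neg n
  · simp

theorem left_eq (τ : BRing) (m : ℤ) : leftCoeff τ m = psi (-m) τ := by
  obtain ⟨N, hN⟩ := Dk_bound τ
  rw [psi_eq _ _ N hN, leftCoeff, finsum_eq_sum_of_support_subset (s := Finset.range N)]
  · refine Finset.sum_congr rfl fun k _ => ?_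
    rw [shA_eq, ← Dk_apply]
    congr 2; ring
  · intro k hk
    by_contra hc
    apply hk
    simp only [Finset.coe_range, Set.mem_Iio, not_lt] at hc
    simp only [shA_eq, ← Dk_apply, hN k hc, mul_zero]

theorem right_eq (τ : BRing) (m : ℤ) : rightCoeff τ m = ((-1 : ℂ) ^ m) • psi (-m) τ := by
  obtain ⟨N, hN⟩ := Dk_bound τ
  rw [psi_eq _ _ N hN, rightCoeff, finsum_eq_sum_of_support_subset (s := Finset.range N),
    Finset.smul_sum]
  · refine Finset.sum_congr rfl fun k _ => ?_
    rw [shP_coeff, sTildeNegZ_eq, smul_mul_smul_comm]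
    congr 1
    · rw [zpow_add₀ (by norm_num), zpow_natCast, mul_assoc, ← mul_pow]; simp
    · congr 2; ring
  · intro k hk
    by_contra hc
    apply hk
    simp only [Finset.coe_range, Set.mem_Iio, not_lt] at hc
    simp only [shP_coeff, hN k hc, smul_zero, mul_zero]

theorem psi_bound (τ : BRing) : ∃ N : ℕ, ∀ j : ℤ, N < j → psi j τ = 0 := by
  obtain ⟨N, hN⟩ := Dk_bound τ
  refine ⟨N, fun j hj => ?_⟩
  rw [psi_eq _ _ N hN]
  refine Finset.sum_eq_zero fun k hk => ?_
  rw [Finset.mem_range] at hk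
  rw [sTildeZ_neg (by omega), zero_mul]

theorem coeff_tensor (m : ℕ →₀ ℕ) (p q : BRing) :
    coeff m (sumAlgEquiv ℂ ℕ ℕ (inL p * inR q)) = coeff m p • q := by
  have h1 : sumAlgEquiv ℂ ℕ ℕ (inR q) = C q :=
    congrArg (fun f => f q) (sumAlgEquiv_comp_rename_inr (R := ℂ) (S₁ := ℕ) (S₂ := ℕ))
  have h2 : sumAlgEquiv ℂ ℕ ℕ (inL p) = map C p :=
    congrArg (fun f => f p) (sumAlgEquiv_comp_rename_inl (R := ℂ) (S₁ := ℕ) (S₂ := ℕ))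
  rw [map_mul, h1, h2, mul_comm, coeff_C_mul, coeff_map, MvPolynomial.smul_eq_C_mul, mul_comm]

/-- functional form of the bilinear identity -/
def BK (N : ℕ) (τ : BRing) : Prop :=
  (∀ j : ℤ, N < j → psi j τ = 0) ∧ ∀ f : BRing →ₗ[ℂ] ℂ,
    ∑ m ∈ Finset.Icc (-N : ℤ) N, ((-1 : ℂ) ^ m * f (psi m τ)) • psi (-m) τ = f τ • τ

theorem BK_of (τ : BRing) (h : SatisfiesBKP τ) : ∃ N, BK N τ := by
  obtain ⟨N, hN⟩ := psi_bound τ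
  refine ⟨N, hN, fun f => ?_⟩
  unfold SatisfiesBKP at h
  simp only [left_eq, right_eq, neg_neg] at h
  rw [finsum_eq_sum_of_support_subset (s := Finset.Icc (-N : ℤ) N)] at h
  · ext μ
    have h1 := congrArg (fun x => f (coeff μ (sumAlgEquiv ℂ ℕ ℕ x))) h
    simp only [map_sum, coeff_sum, coeff_tensor, map_smul, smul_eq_mul] at h1
    rw [coeff_sum]
    simp only [coeff_smul, smul_eq_mul]
    rw [mul_comm, ← h1]
    refine Finset.sum_congr rfl fun m _ => ?_
    rw [zpow_neg, ← inv_zpow, show (-1 : ℂ)⁻¹ = -1 by norm_num]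
    ring
  · intro m hm
    by_contra hc
    apply hm
    simp only [Finset.coe_Icc, Set.mem_Icc, not_and_or, not_le] at hc
    rcases hc with hc | hc
    · simp only [hN (-m) (by omega), map_zero, zero_mul]
    · simp only [hN m hc, smul_zero, map_zero, mul_zero]

end


noncomputable section
open MvPolynomial

theorem exists_fun (x y : BRing) (h : ∀ s : ℂ, y ≠ s • x) :
    ∃ f : BRing →ₗ[ℂ] ℂ, f x = 0 ∧ f y = 1 := by
  have hy : y ∉ Submodule.span ℂ {x} := by
    intro hc
    obtain ⟨s, hs⟩ := Submodule.mem_span_singleton.1 hc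
    exact h s hs.symm
  obtain ⟨f, hf1, hf2⟩ := Submodule.exists_le_ker_of_notMem hy
  refine ⟨(f y)⁻¹ • f, ?_, ?_⟩
  · have : f x = 0 := hf2 (Submodule.mem_span_singleton_self x)
    simp [this]
  · simp [hf1]

theorem psi_anti (i j : ℤ) (h : i + j ≠ 0) (p : BRing) : psi i (psi j p) = - psi j (psi i p) := by
  have := clifford i j p
  rw [if_neg h, zero_smul] at this
  exact eq_neg_of_add_eq_zero_left this

theorem psi_sq (i : ℤ) (h : i ≠ 0) (p : BRing) : psi i (psi i p) = 0 := by
  have := psi_anti i i (by omega) p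
  exact self_eq_neg.1 this

theorem BK_psi (N l : ℕ) (hl : 1 ≤ l) (τ : BRing) (h : BK N τ) : BK N (psi l τ) := by
  obtain ⟨h1, h2⟩ := h
  have hl0 : (l : ℤ) ≠ 0 := by omega
  refine ⟨fun j hj => ?_, fun f => ?_⟩
  · rw [psi_anti _ _ (by omega), h1 j hj]; simp
  · have h3 := congrArg (psi l) (h2 (f ∘ₗ psi l))
    rw [map_sum, map_smul] at h3
    rw [LinearMap.comp_apply] at h3
    rw [← h3]
    refine Finset.sum_congr rfl fun m _ => ?_
    rw [map_smul, LinearMap.comp_apply]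
    rcases eq_or_ne m l with rfl | hm
    · rw [psi_sq _ hl0]; simp
    rcases eq_or_ne m (-l) with rfl | hm'
    · rw [neg_neg, psi_sq _ hl0]; simp
    · rw [psi_anti m l (by omega), psi_anti (-m) l (by omega), map_neg]
      simp

theorem step (N d : ℕ) (τ : BRing) (h : BK N τ) (hd : ∀ j : ℤ, (d + 1 : ℕ) < j → psi j τ = 0)
    (hne : psi (d + 1 : ℕ) τ ≠ 0) :
    ∃ (c : ℕ → ℂ) (a : ℂ), a ≠ 0 ∧ τ = a • vv (d + 1) c (psi (d + 1 : ℕ) τ) := by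
  set l := d + 1 with hl
  have hl0 : (l : ℤ) ≠ 0 := by omega
  obtain ⟨f, hf0, hf1⟩ := exists_fun τ (psi l τ) (by
    intro s hs
    have h1 := psi_sq l hl0 τ
    rw [hs, map_smul] at h1
    rcases smul_eq_zero.1 h1 with h1 | h1
    · apply hne; rw [hs, h1, zero_smul]
    · exact hne h1)
  let F : ℤ → BRing := fun m => ((-1 : ℂ) ^ m * f (psi m τ)) • psi (-m) τ
  have hF : ∑ m ∈ Finset.Icc (-N : ℤ) N, F m = 0 := by
    rw [h.2 f, hf0, zero_smul]
  have hs : ∀ m, F m ≠ 0 → -(N : ℤ) ≤ m ∧ m ≤ l ∧ m ≤ N := by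
    intro m hm
    refine ⟨?_, ?_, ?_⟩
    · by_contra hc
      exact hm (by simp only [F]; rw [h.1 (-m) (by omega), smul_zero])
    · by_contra hc
      exact hm (by simp only [F]; rw [hd m (by omega)]; simp)
    · by_contra hc
      exact hm (by simp only [F]; rw [h.1 m (by omega)]; simp)
  obtain ⟨c, hc⟩ := sC_surj (fun i => (-1 : ℂ) ^ (l : ℤ) *
    ((-1 : ℂ) ^ ((l : ℤ) - i) * f (psi ((l : ℤ) - i) τ))) (by
      simp only [Nat.cast_zero, sub_zero, hf1, mul_one]
      rw [← mul_zpow]; simp)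
  have hv : vv l c τ = 0 := by
    obtain ⟨M₀, hM⟩ := vv_trunc l c τ
    rw [hM (max M₀ (l + N + 1)) (by omega)]
    have e : ∀ i : ℕ, (sqrt2⁻¹ * sG i c) • psi ((i : ℤ) - l) τ =
        (sqrt2⁻¹ * (-1 : ℂ) ^ (l : ℤ)) • F ((l : ℤ) - i) := by
      intro i
      simp only [F, hc, neg_sub, smul_smul, mul_assoc]
    simp only [e]
    rw [← Finset.smul_sum]
    have : ∑ i ∈ Finset.range (max M₀ (l + N + 1)), F ((l : ℤ) - i) = 0 := by
      rw [← hF, ← finsum_eq_sum_of_support_subset F (s := Finset.Icc (-N : ℤ) N),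
        finsum_eq_sum_of_support_subset F
          (s := (Finset.range (max M₀ (l + N + 1))).image (fun i : ℕ => (l : ℤ) - i)),
        Finset.sum_image]
      · intro x _ y _ hxy
        simp only at hxy
        omega
      · intro m hm
        have := hs m hm
        simp only [Finset.coe_image, Set.mem_image, Finset.coe_range, Set.mem_Iio]
        exact ⟨(l - m).toNat, by omega, by omega⟩
      · intro m hm
        have := hs m hm
        simp only [Finset.coe_Icc, Set.mem_Icc]
        omega
    rw [this, smul_zero]
  have ha := vv_anti l c l τ
  rw [hv, map_zero, zero_add] at ha
  have hk : kap l c l ≠ 0 := by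
    unfold kap
    rw [if_pos le_rfl]
    simp [sG_zero, sqrt2_ne]
  refine ⟨c, (kap l c l)⁻¹, inv_ne_zero hk, ?_⟩
  rw [ha, smul_smul, inv_mul_cancel₀ hk, one_smul]

theorem main_ind (N d : ℕ) : ∀ τ : BRing, τ ≠ 0 → BK N τ → (∀ j : ℤ, d < j → psi j τ = 0) →
    ∀ r : ℕ, ∃ (k : ℕ) (lam : Fin k → ℕ) (c : Fin k → ℕ → ℂ) (a : ℂ), k % 2 = r % 2 ∧
      StrictAnti lam ∧ (∀ i, lam i ≤ d) ∧ a ≠ 0 ∧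
      τ = a • wick k (fun i => vv (lam i) (c i)) := by
  induction d with
  | zero =>
    intro τ hτ _ hd r
    obtain ⟨a, rfl⟩ := vacuum τ (by simpa using hd)
    have ha : a ≠ 0 := by rintro rfl; simp at hτ
    rcases Nat.even_or_odd r with hr | hr
    · refine ⟨0, fun i => i.elim0, fun i => i.elim0, a, ?_, fun i => i.elim0, fun i => i.elim0,
        ha, ?_⟩
      · rw [Nat.even_iff] at hr; omega
      · simp [wick, MvPolynomial.smul_eq_C_mul]
    · refine ⟨1, fun _ => 0, fun _ _ => 0, a * sqrt2, ?_, Subsingleton.strictAnti _,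
        fun _ => le_rfl, mul_ne_zero ha sqrt2_ne, ?_⟩
      · rw [Nat.odd_iff] at hr; omega
      · have h1 : sB 0 (tShift fun _ => 0) = 1 := by rw [sB_eq]; exact sG_zero _
        simp only [wick]
        rw [vv_one, h1, smul_smul, mul_assoc, mul_inv_cancel₀ sqrt2_ne, mul_one,
          MvPolynomial.smul_eq_C_mul, mul_one]
  | succ d ih =>
    intro τ hτ hB hd r
    by_cases h0 : psi (d + 1 : ℕ) τ = 0
    · obtain ⟨k, lam, c, a, h1, h2, h3, h4, h5⟩ := ih τ hτ hB (by
        intro j hj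
        rcases eq_or_ne j (d + 1 : ℕ) with rfl | hj'
        · exact h0
        · exact hd j (by omega)) r
      exact ⟨k, lam, c, a, h1, h2, fun i => (h3 i).trans (Nat.le_succ d), h4, h5⟩
    · obtain ⟨c₀, a₀, ha₀, hτ₀⟩ := step N d τ hB hd h0
      obtain ⟨k, lam, c, a, h1, h2, h3, h4, h5⟩ := ih (psi (d + 1 : ℕ) τ) h0
        (BK_psi N (d + 1) (by omega) τ hB) (by
        intro j hj
        rcases eq_or_ne j (d + 1 : ℕ) with rfl | hj'
        · exact psi_sq _ (by omega) _
        · rw [psi_anti _ _ (by omega), hd j (by omega)]; simp) (r + 1)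
      refine ⟨k + 1, Fin.cons (d + 1) lam, Fin.cons c₀ c, a₀ * a, by omega, ?_, ?_,
        mul_ne_zero ha₀ h4, ?_⟩
      · intro i j hij
        induction j using Fin.cases with
        | zero => exact absurd hij (Fin.not_lt_zero _)
        | succ j =>
          induction i using Fin.cases with
          | zero => simpa using Nat.lt_succ_of_le (h3 j)
          | succ i => simpa using h2 (Fin.succ_lt_succ_iff.1 hij)
      · intro i
        induction i using Fin.cases with
        | zero => simp
        | succ i => simpa using (h3 i).trans (Nat.le_succ d)
      · simp only [wick, Fin.cons_zero, Fin.cons_succ]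
        rw [mul_smul, ← map_smul, ← h5]
        exact hτ₀

theorem main_thm (τ : BRing) (hτ : τ ≠ 0)
    (h : SatisfiesBKP τ) :
    ∃ (n : ℕ) (lam : Fin (2 * n + 1) → ℕ) (_ : StrictAnti lam)
      (c : Fin (2 * n + 1) → ℕ → ℂ) (b : Fin (2 * n + 1) → ℂ) (a : ℂ),
      a ≠ 0 ∧ τ = a • pfaffian (rhoMatrixOdd lam c b) := by
  obtain ⟨N, hN⟩ := BK_of τ h
  obtain ⟨k, lam, c, a, h1, h2, h3, h4, h5⟩ := main_ind N N τ hτ hN hN.1 1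
  obtain ⟨n, rfl⟩ : ∃ n, k = 2 * n + 1 := ⟨k / 2, by omega⟩
  exact ⟨n, lam, h2, c, fun _ => 0, a, h4, by rw [← pf_odd]; exact h5⟩

end

noncomputable section

/-- Every nonzero polynomial tau-function of the DKP hierarchy in the odd
sector `V₁`, i.e. every nonzero `τ ∈ ℂ[t₁,t₃,t₅,…]` satisfying the BKP bilinear identity,
is of the form `τ = a · Pf(A)` for some `n ≥ 0`, integers `λ_1 > ⋯ > λ_{2n+1} ≥ 0`,
sequences `c_i`, constants `b_i ∈ ℂ` and a nonzero `a ∈ ℂ`, where `A` is the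
`(2n+2) × (2n+2)` skew-symmetric matrix with `A_{0,j} = ρ_{λ_j}(t̃+c_j; b_j)` and
`A_{i,j} = ρ_{λ_i,λ_j}(t̃+c_i, t̃+c_j; b_i, b_j)` for `1 ≤ i < j ≤ 2n+1`. -/
theorem polynomial_tau_DKP_odd_classification (τ : BRing) (hτ : τ ≠ 0)
    (h : SatisfiesBKP τ) :
    ∃ (n : ℕ) (lam : Fin (2 * n + 1) → ℕ) (_ : StrictAnti lam)
      (c : Fin (2 * n + 1) → ℕ → ℂ) (b : Fin (2 * n + 1) → ℂ) (a : ℂ),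
      a ≠ 0 ∧ τ = a • pfaffian (rhoMatrixOdd lam c b) := by
  exact main_thm τ hτ h

end
end

section
/- Let (τ_0, τ_1) be a pair of nonzero polynomials in ℂ[t_1,t_3,t_5,…], each satisfying the BKP bilinear identity (the bosonic form of the DKP hierarchy), and together satisfying the MDKP bilinear identity. Then there exist an extended strict partition λ = (λ_1 > ⋯ > λ_k ≥ 0), sequences c_1,…,c_k of complex numbers, constants b_1,…,b_k ∈ ℂ, nonzero scalars a_0, a_1 ∈ ℂ, and an index 1 ≤ j ≤ k such that either k = 2n+1 is odd and τ_0 = a_0 · ρ_{(λ_1,…,λ_{j−1},λ_{j+1},…,λ_{2n+1})}(t̃; c_1,…,c_{j−1},c_{j+1},…,c_{2n+1}; b_1,…,b_{j−1},b_{j+1},…,b_{2n+1}), τ_1 = a_1 · ρ_{(λ_1,…,λ_{2n+1})}(t̃; c_1,…,c_{2n+1}; b_1,…,b_{2n+1}), or k = 2n is even and τ_0 = a_0 · ρ_{(λ_1,…,λ_{2n})}(t̃; c_1,…,c_{2n}; b_1,…,b_{2n}), τ_1 = a_1 · ρ_{(λ_1,…,λ_{j−1},λ_{j+1},…,λ_{2n})}(t̃;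 c_1,…,c_{j−1},c_{j+1},…,c_{2n}; b_1,…,b_{j−1},b_{j+1},…,b_{2n}). -/
noncomputable section
namespace MDKP
open MvPolynomial

/-- generic operator -/
def gop (S : ℤ → BRing) (g : BRing →ₐ[ℂ] Polynomial BRing) (m : ℤ) : BRing →ₗ[ℂ] BRing :=
  (Polynomial.lsum (R := ℂ) fun k => LinearMap.mulLeft ℂ (S (m + k))) ∘ₗ g.toLinearMap

def phiM (S : ℤ → BRing) (m : ℤ) : Polynomial BRing →ₗ[ℂ] BRing :=
  Polynomial.lsum (R := ℂ) fun k => LinearMap.mulLeft ℂ (S (m + k))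

lemma phiM_monomial (S : ℤ → BRing) (m : ℤ) (k : ℕ) (a : BRing) :
    phiM S m (Polynomial.monomial k a) = S (m + k) * a := by
  simp only [phiM, Polynomial.lsum_apply]
  rw [Polynomial.sum_monomial_index]
  · simp
  · simp

lemma phiM_CX (S : ℤ → BRing) (m : ℤ) (x : BRing) (j : ℕ) (q : Polynomial BRing) :
    phiM S m (Polynomial.C x * Polynomial.X ^ j * q) = x * phiM S (m + j) q := by
  induction q using Polynomial.induction_on' with
  | add p q hp hq => rw [mul_add, map_add, hp, hq, map_add, mul_add]
  | monomial n a =>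
    rw [Polynomial.C_mul_X_pow_eq_monomial, Polynomial.monomial_mul_monomial, phiM_monomial,
      phiM_monomial]
    push_cast
    rw [add_assoc]; ring

lemma finsum_phiM (S : ℤ → BRing) (m : ℤ) (q : Polynomial BRing) :
    (∑ᶠ k : ℕ, S (m + k) * q.coeff k) = phiM S m q := by
  simp only [phiM, Polynomial.lsum_apply, Polynomial.sum_def]
  rw [finsum_eq_sum_of_support_subset (s := q.support)]
  · rfl
  · intro k hk
    simp only [Function.mem_support] at hk
    simp only [Finset.mem_coe, Polynomial.mem_support_iff]
    intro h; apply hk; rw [h, mul_zero]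

lemma phiM_zero_of_lt (S : ℤ → BRing) (hS : ∀ n < 0, S n = 0) (q : Polynomial BRing) :
    ∃ M : ℕ, ∀ m : ℤ, m < -M → phiM S m q = 0 := by
  refine ⟨q.natDegree, fun m hm => ?_⟩
  simp only [phiM, Polynomial.lsum_apply, Polynomial.sum_def]
  apply Finset.sum_eq_zero
  intro k hk
  have := Polynomial.le_natDegree_of_mem_supp k hk
  rw [hS _ (by omega)]; simp

def gM : BRing →ₐ[ℂ] Polynomial BRing := MvPolynomial.aeval
    (fun i => Polynomial.C (MvPolynomial.X i) -
      Polynomial.C (MvPolynomial.C ((2 : ℂ) / ((2 * i + 1 : ℕ) : ℂ))) *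
        Polynomial.X ^ (2 * i + 1))

def gP : BRing →ₐ[ℂ] Polynomial BRing := MvPolynomial.aeval
    (fun i => Polynomial.C (MvPolynomial.X i) +
      Polynomial.C (MvPolynomial.C ((2 : ℂ) / ((2 * i + 1 : ℕ) : ℂ))) *
        Polynomial.X ^ (2 * i + 1))

/-- the operator `v_m` -/
def v (m : ℤ) : BRing →ₗ[ℂ] BRing := phiM sTildeZ m ∘ₗ gM.toLinearMap

def u (m : ℤ) : BRing →ₗ[ℂ] BRing := phiM sTildeNegZ m ∘ₗ gP.toLinearMap

lemma leftCoeff_eq (τ : BRing) (m : ℤ) : leftCoeff τ m = v m τ := finsum_phiM _ _ _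
lemma rightCoeff_eq (τ : BRing) (m : ℤ) : rightCoeff τ m = u m τ := finsum_phiM _ _ _

/-- constant `2/(2i+1)` -/
def cc (i : ℕ) : ℂ := (2 : ℂ) / ((2 * i + 1 : ℕ) : ℂ)

lemma cc_mul (i : ℕ) : ((2 * i + 1 : ℕ) : ℂ) * cc i = 2 := by
  unfold cc
  have : ((2 * i + 1 : ℕ) : ℂ) ≠ 0 := Nat.cast_ne_zero.mpr (by omega)
  exact mul_div_cancel₀ 2 this

lemma v_X_mul (m : ℤ) (i : ℕ) (p : BRing) :
    v m (X i * p) = X i * v m p - cc i • v (m + (2 * i + 1)) p := by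
  have h : gM (X i * p) = Polynomial.C (X i) * Polynomial.X ^ 0 * gM p -
      Polynomial.C (C (cc i)) * Polynomial.X ^ (2 * i + 1) * gM p := by
    rw [map_mul, ← sub_mul]; congr 1; simp [gM, cc]
  simp only [v, LinearMap.comp_apply, AlgHom.toLinearMap_apply]
  rw [h, map_sub, phiM_CX, phiM_CX, MvPolynomial.smul_eq_C_mul]; simp

lemma u_X_mul (m : ℤ) (i : ℕ) (p : BRing) :
    u m (X i * p) = X i * u m p + cc i • u (m + (2 * i + 1)) p := by
  have h : gP (X i * p) = Polynomial.C (X i) * Polynomial.X ^ 0 * gP p +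
      Polynomial.C (C (cc i)) * Polynomial.X ^ (2 * i + 1) * gP p := by
    rw [map_mul, ← add_mul]; congr 1; simp [gP, cc]
  simp only [u, LinearMap.comp_apply, AlgHom.toLinearMap_apply]
  rw [h, map_add, phiM_CX, phiM_CX, MvPolynomial.smul_eq_C_mul]; simp

lemma v_one (m : ℤ) : v m 1 = sTildeZ m := by
  simp only [v, LinearMap.comp_apply, AlgHom.toLinearMap_apply, map_one]
  rw [← Polynomial.C_1, ← Polynomial.monomial_zero_left, phiM_monomial]; simp

lemma u_one (m : ℤ) : u m 1 = sTildeNegZ m := by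
  simp only [u, LinearMap.comp_apply, AlgHom.toLinearMap_apply, map_one]
  rw [← Polynomial.C_1, ← Polynomial.monomial_zero_left, phiM_monomial]; simp

lemma S_neg {m : ℤ} (hm : m < 0) : sTildeZ m = 0 := by
  unfold sTildeZ; rw [if_neg (by omega)]

lemma v_bdd (p : BRing) : ∃ M : ℕ, ∀ m : ℤ, m < -M → v m p = 0 :=
  phiM_zero_of_lt _ (fun _ h => S_neg h) _

lemma S_zero : sTildeZ 0 = 1 := by simp [sTildeZ, schurPoly]

/-- induction principle for polynomials -/
lemma poly_ind {P : BRing → Prop} (h1 : P 1) (hs : ∀ (c : ℂ) p, P p → P (c • p))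
    (ha : ∀ p q, P p → P q → P (p + q)) (hX : ∀ i p, P p → P (X i * p)) (p : BRing) : P p := by
  induction p using MvPolynomial.induction_on with
  | C a => have := hs a 1 h1; rwa [MvPolynomial.smul_eq_C_mul, mul_one] at this
  | add p q hp hq => exact ha _ _ hp hq
  | mul_X p i hp => rw [mul_comm]; exact hX _ _ hp

/-! Schur recursions -/

lemma schur_rec (R : Type*) [CommRing R] [Algebra ℂ R] (x : ℕ → R) (n : ℕ) :
    ((n + 1 : ℕ) : ℂ) • aeval x (schurPoly (n + 1)) =
      ∑ j ∈ Finset.range (n + 1), ((j + 1 : ℕ) : ℂ) • (x (j + 1) * aeval x (schurPoly (n - j))) := by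
  rw [schurPoly, map_smul, smul_smul]
  have : ((n + 1 : ℕ) : ℂ) * ((n : ℂ) + 1)⁻¹ = 1 := by
    push_cast; apply mul_inv_cancel₀; exact_mod_cast Nat.succ_ne_zero n
  rw [this, one_smul, map_sum]
  refine Finset.sum_congr rfl fun j _ => ?_
  rw [map_smul, map_mul, aeval_X]; push_cast; rfl

lemma schur_scale (n : ℕ) :
    aeval (fun j => -(tTilde j)) (schurPoly n) = (-1 : ℂ) ^ n • aeval tTilde (schurPoly n) := by
  induction n using Nat.strong_induction_on with
  | _ n ih =>
  cases n with
  | zero => simp [schurPoly]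
  | succ n =>
    have hn : ((n + 1 : ℕ) : ℂ) ≠ 0 := by exact_mod_cast Nat.succ_ne_zero n
    apply smul_right_injective BRing hn
    simp only
    rw [smul_comm, schur_rec, schur_rec, Finset.smul_sum]
    refine Finset.sum_congr rfl fun j hj => ?_
    rw [Finset.mem_range] at hj
    rw [ih (n - j) (by omega), smul_comm]
    congr 1
    by_cases hj2 : (j + 1) % 2 = 1
    · obtain ⟨i, rfl⟩ : ∃ i, j = 2 * i := ⟨j / 2, by omega⟩
      have : (-1 : ℂ) ^ (n + 1) = -(-1) ^ (n - 2 * i) := by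
        have e : n + 1 = (n - 2 * i) + 2 * i + 1 := by omega
        conv_lhs => rw [e]
        rw [pow_succ, pow_add, pow_mul]; simp
      rw [this, neg_smul, neg_mul, mul_smul_comm]
    · simp [tTilde, hj2]

lemma Sneg_eq (m : ℤ) : sTildeNegZ m = (-1 : ℂ) ^ m • sTildeZ m := by
  unfold sTildeNegZ sTildeZ
  split_ifs with h
  · lift m to ℕ using h
    rw [Int.toNat_natCast, schur_scale, zpow_natCast]
  · simp

lemma npow_odd (m : ℤ) (i : ℕ) : (-1 : ℂ) ^ (m + (2 * i + 1)) = -(-1 : ℂ) ^ m := by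
  rw [zpow_add₀ (by norm_num), zpow_add₀ (by norm_num), zpow_mul]; simp

lemma npow_odd' (m : ℤ) (i : ℕ) : (-1 : ℂ) ^ (m - (2 * i + 1)) = -(-1 : ℂ) ^ m := by
  have := npow_odd (m - (2 * i + 1)) i
  rw [sub_add_cancel] at this; rw [this, neg_neg]

lemma u_eq (p : BRing) : ∀ m : ℤ, u m p = (-1 : ℂ) ^ m • v m p := by
  induction p using poly_ind with
  | h1 => intro m; rw [u_one, v_one, Sneg_eq]
  | hs c p h => intro m; rw [map_smul, map_smul, h, smul_comm]
  | ha p q hp hq => intro m; rw [map_add, map_add, hp, hq, smul_add]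
  | hX i p hp =>
    intro m
    rw [u_X_mul, v_X_mul, hp, hp, npow_odd, smul_sub, mul_smul_comm, neg_smul, smul_neg, sub_eq_add_neg,
      smul_comm]

lemma S_rec (n : ℤ) (K : ℕ) (hK : n ≤ 2 * K) :
    (n : ℂ) • sTildeZ n =
      ∑ i ∈ Finset.range K, ((2 * i + 1 : ℕ) : ℂ) • (X i * sTildeZ (n - (2 * i + 1))) := by
  by_cases hn : n ≤ 0
  · rw [Finset.sum_eq_zero]
    · rcases hn.lt_or_eq with h | h
      · rw [S_neg h, smul_zero]
      · simp [h]
    · intro i _; rw [S_neg (by omega)]; simp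
  · obtain ⟨k, rfl⟩ : ∃ k : ℕ, n = (k + 1 : ℕ) := ⟨(n - 1).toNat, by omega⟩
    have e1 : sTildeZ ((k + 1 : ℕ) : ℤ) = aeval tTilde (schurPoly (k + 1)) := by
      unfold sTildeZ; rw [if_pos (by omega)]; simp
    rw [e1, Int.cast_natCast, schur_rec]
    rw [← Finset.sum_filter_of_ne (s := Finset.range (k + 1)) (p := fun j => j % 2 = 0)]
    swap
    · intro j _ h; by_contra h2; apply h; simp [tTilde, show ¬ ((j + 1) % 2 = 1) by omega]
    rw [← Finset.sum_filter_of_ne (s := Finset.range K) (p := fun i => 2 * i < k + 1)]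
    swap
    · intro j _ h; by_contra h2; apply h; rw [S_neg (by push_cast; omega)]; simp
    symm
    refine Finset.sum_bij (fun i _ => 2 * i) ?_ ?_ ?_ ?_
    · intro i hi; simp only [Finset.mem_filter, Finset.mem_range] at hi ⊢; omega
    · intro i _ j _ h; omega
    · intro j hj; simp only [Finset.mem_filter, Finset.mem_range] at hj
      exact ⟨j / 2, by simp only [Finset.mem_filter, Finset.mem_range]; omega, by omega⟩
    · intro i hi; simp only [Finset.mem_filter, Finset.mem_range] at hi
      congr 2
      · simp [tTilde, show (2 * i + 1) % 2 = 1 by omega]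
      · unfold sTildeZ; rw [if_pos (by push_cast; omega)]; congr 2; omega

lemma pderiv_S (i : ℕ) (n : ℤ) : pderiv i (sTildeZ n) = sTildeZ (n - (2 * i + 1)) := by
  by_cases hn : n < 0
  · rw [S_neg hn, S_neg (by omega), map_zero]
  · lift n to ℕ using by omega
    induction n using Nat.strong_induction_on with
    | _ n ih =>
    rcases Nat.eq_zero_or_pos n with rfl | hpos
    · rw [Nat.cast_zero, S_zero, S_neg (by omega)]; simp
    · have hn : ((n : ℤ) : ℂ) ≠ 0 := by exact_mod_cast hpos.ne'
      apply smul_right_injective BRing hn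
      simp only
      rw [← Derivation.map_smul, S_rec n (n + i + 1) (by push_cast; omega), map_sum]
      have key : ∀ k ∈ Finset.range (n + i + 1),
          pderiv i (((2 * k + 1 : ℕ) : ℂ) • (X k * sTildeZ ((n : ℤ) - (2 * k + 1)))) =
          ((2 * k + 1 : ℕ) : ℂ) • (X k * sTildeZ (((n : ℤ) - (2 * i + 1)) - (2 * k + 1))) +
          if k = i then ((2 * i + 1 : ℕ) : ℂ) • sTildeZ ((n : ℤ) - (2 * i + 1)) else 0 := by
        intro k _
        have ih' : pderiv i (sTildeZ ((n : ℤ) - (2 * k + 1))) =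
            sTildeZ ((n : ℤ) - (2 * i + 1) - (2 * k + 1)) := by
          by_cases h : (n : ℤ) - (2 * k + 1) < 0
          · rw [S_neg h, S_neg (by omega), map_zero]
          · have e : ((n - (2 * k + 1) : ℕ) : ℤ) = (n : ℤ) - (2 * k + 1) := by omega
            rw [← e, ih _ (by omega) (by omega), e]; congr 1; ring
        rw [Derivation.map_smul, Derivation.leibniz, ih', smul_add]
        congr 1
        rw [pderiv_X]
        split_ifs with h
        · subst h; simp
        · rw [Pi.single_eq_of_ne (by exact h)]; simp
      rw [Finset.sum_congr rfl key, Finset.sum_add_distrib,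
        ← S_rec _ _ (by push_cast; omega), Finset.sum_ite_eq',
        if_pos (by rw [Finset.mem_range]; omega), ← add_smul]
      congr 1; push_cast; ring

lemma pderiv_v (i : ℕ) (p : BRing) :
    ∀ m : ℤ, pderiv i (v m p) = v m (pderiv i p) + v (m - (2 * i + 1)) p := by
  induction p using poly_ind with
  | h1 => intro m; rw [v_one, v_one, pderiv_S]; simp
  | hs c p h => intro m; simp only [map_smul, Derivation.map_smul, h, smul_add]
  | ha p q hp hq => intro m; simp only [map_add, hp, hq]; abel
  | hX k p hp =>
    intro m
    rw [v_X_mul, v_X_mul, map_sub, Derivation.map_smul, Derivation.leibniz, Derivation.leibniz, hp, hp,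
      smul_eq_mul, smul_eq_mul, smul_eq_mul, smul_eq_mul, map_add, v_X_mul, pderiv_X]
    have e : m + (2 * k + 1) - (2 * i + 1) = m - (2 * i + 1) + (2 * (k : ℤ) + 1) := by ring
    rw [e]
    by_cases h : k = i
    · subst h; simp only [Pi.single_eq_same, mul_one, smul_add, mul_add]; abel
    · rw [Pi.single_eq_of_ne (by exact h)]; simp only [mul_zero, map_zero, smul_add, mul_add]; abel

def ev : BRing →+* ℂ := MvPolynomial.eval (fun _ => 0)

lemma ev_smul (c : ℂ) (p : BRing) : ev (c • p) = c * ev p := by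
  simp [ev]
lemma ev_X (i : ℕ) : ev (X i) = 0 := by simp [ev]

lemma ev_S (n : ℤ) : ev (sTildeZ n) = if n = 0 then 1 else 0 := by
  split_ifs with h
  · rw [h, S_zero, map_one]
  · by_cases hn : n < 0
    · rw [S_neg hn, map_zero]
    · have h1 := congrArg ev (S_rec n n.toNat (by omega))
      rw [ev_smul, map_sum, Finset.sum_eq_zero] at h1
      · have : (n : ℂ) ≠ 0 := by exact_mod_cast h
        simpa [this] using h1
      · intro i _; rw [ev_smul, map_mul, ev_X]; simp

lemma ev_v_pos (p : BRing) : ∀ m : ℤ, 0 < m → ev (v m p) = 0 := by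
  induction p using poly_ind with
  | h1 => intro m hm; rw [v_one, ev_S, if_neg hm.ne']
  | hs c p h => intro m hm; rw [map_smul, ev_smul, h m hm, mul_zero]
  | ha p q hp hq => intro m hm; rw [map_add, map_add, hp m hm, hq m hm, add_zero]
  | hX i p hp =>
    intro m hm; rw [v_X_mul, map_sub, map_mul, ev_X, ev_smul, hp (m + (2 * i + 1)) (by omega)]; simp

lemma ev_v_zero (p : BRing) : ev (v 0 p) = ev p := by
  induction p using poly_ind with
  | h1 => rw [v_one, S_zero]
  | hs c p h => rw [map_smul, ev_smul, h, ev_smul]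
  | ha p q hp hq => rw [map_add, map_add, hp, hq, map_add]
  | hX i p hp => rw [v_X_mul, map_sub, map_mul, map_mul, ev_X, ev_smul, ev_v_pos p (0 + (2 * i + 1)) (by omega)]; simp

/-- vanishing principle -/
lemma vanish (W : Set BRing) (h0 : ∀ p ∈ W, ev p = 0)
    (h1 : ∀ p ∈ W, ∀ i, pderiv i p ∈ Submodule.span ℂ W) : ∀ p ∈ W, p = 0 := by
  have h0' : ∀ p ∈ Submodule.span ℂ W, ev p = 0 := by
    intro p hp
    induction hp using Submodule.span_induction with
    | mem x h => exact h0 x h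
    | zero => simp
    | add x y _ _ hx hy => rw [map_add, hx, hy, add_zero]
    | smul a x _ hx => rw [ev_smul, hx, mul_zero]
  have h1' : ∀ p ∈ Submodule.span ℂ W, ∀ i, pderiv i p ∈ Submodule.span ℂ W := by
    intro p hp i
    induction hp using Submodule.span_induction with
    | mem x h => exact h1 x h i
    | zero => simp
    | add x y _ _ hx hy => rw [map_add]; exact Submodule.add_mem _ hx hy
    | smul a x _ hx => rw [Derivation.map_smul]; exact Submodule.smul_mem _ _ hx
  have key : ∀ (n : ℕ) (d : ℕ →₀ ℕ), d.degree = n → ∀ p ∈ Submodule.span ℂ W, coeff d p = 0 := by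
    intro n
    induction n with
    | zero =>
      intro d hd p hp
      rw [Finsupp.degree_eq_zero_iff] at hd
      rw [hd]
      have := h0' p hp
      rw [ev, MvPolynomial.eval_zero'] at this
      exact this
    | succ n ih =>
      intro d hd p hp
      have hne : d ≠ 0 := by rintro rfl; simp at hd
      obtain ⟨i, hi⟩ := Finsupp.ne_iff.mp hne
      have hi' : d i ≠ 0 := hi
      have e : (d - Finsupp.single i 1) + Finsupp.single i 1 = d :=
        tsub_add_cancel_of_le (Finsupp.single_le_iff.mpr (Nat.one_le_iff_ne_zero.mpr hi'))
      have hdeg : (d - Finsupp.single i 1).degree = n := by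
        have := congrArg Finsupp.degree e
        rw [map_add, Finsupp.degree_single, hd] at this; omega
      have h := ih _ hdeg _ (h1' p hp i)
      rw [coeff_pderiv, e] at h
      rcases mul_eq_zero.mp h with h | h
      · exact h
      · exfalso
        have : ((((d - Finsupp.single i 1 : ℕ →₀ ℕ) i + 1 : ℕ)) : ℂ) ≠ 0 := Nat.cast_ne_zero.mpr (by omega)
        apply this; push_cast; exact h
  intro p hp
  ext d
  rw [key _ d rfl p (Submodule.subset_span hp), coeff_zero]

end MDKP
end

noncomputable section
namespace MDKP
open MvPolynomial

def dd (m : ℤ) : ℂ := if m < 0 then 0 else if m = 0 then 1 else 2 * (-1) ^ m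

lemma dd_sum (m : ℕ) : ∀ K : ℕ, m ≤ 2 * K →
    ∑ i ∈ Finset.range K, dd ((m : ℤ) - (2 * i + 1)) = m * (-1) ^ (m + 1) := by
  induction m using Nat.twoStepInduction with
  | zero => intro K _; rw [Finset.sum_eq_zero]; · simp
            intro i _; unfold dd; rw [if_pos (by push_cast; omega)]
  | one =>
    intro K hK
    rw [Finset.sum_eq_single 0]
    · simp [dd]
    · intro i _ hi; unfold dd; rw [if_pos (by push_cast; omega)]
    · intro h; exfalso; apply h; rw [Finset.mem_range]; omega
  | more m ih _ =>
    intro K hK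
    obtain ⟨K, rfl⟩ : ∃ L, K = L + 1 := ⟨K - 1, by omega⟩
    rw [Finset.sum_range_succ']
    have h := ih K (by omega)
    have e : ∀ i ∈ Finset.range K, dd (((m + 2 : ℕ) : ℤ) - (2 * ((i + 1 : ℕ) : ℤ) + 1)) =
        dd ((m : ℤ) - (2 * i + 1)) := by
      intro i _; congr 1; push_cast; ring
    rw [Finset.sum_congr rfl e, h]
    have e2 : dd (((m + 2 : ℕ) : ℤ) - (2 * ((0 : ℕ) : ℤ) + 1)) = 2 * (-1) ^ (m + 1) := by
      have : ((m + 2 : ℕ) : ℤ) - (2 * ((0 : ℕ) : ℤ) + 1) = ((m + 1 : ℕ) : ℤ) := by push_cast; ring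
      rw [this]; unfold dd; rw [if_neg (by omega), if_neg (by omega), zpow_natCast]
    rw [e2]; push_cast; ring

lemma ev_v_S_nat (m : ℕ) : ∀ n : ℤ, ev (v n (sTildeZ m)) = if n + m = 0 then dd m else 0 := by
  induction m using Nat.strong_induction_on with
  | _ m ih =>
  intro n
  rcases Nat.eq_zero_or_pos m with rfl | hpos
  · rw [Nat.cast_zero, S_zero, v_one, ev_S]; simp [dd]
  · have hm : (m : ℂ) ≠ 0 := by exact_mod_cast hpos.ne'
    have h := congrArg (fun p => ev (v n p)) (S_rec m m (by omega))
    simp only [map_smul, map_sum, ev_smul, v_X_mul, map_sub, map_mul, ev_X, zero_mul, zero_sub] at h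
    have key : ∀ i ∈ Finset.range m, ((2 * i + 1 : ℕ) : ℂ) * -(cc i *
        ev (v (n + (2 * i + 1)) (sTildeZ ((m : ℤ) - (2 * i + 1))))) =
        if n + m = 0 then -2 * dd ((m : ℤ) - (2 * i + 1)) else 0 := by
      intro i _
      have : ev (v (n + (2 * i + 1)) (sTildeZ ((m : ℤ) - (2 * i + 1)))) =
          if n + m = 0 then dd ((m : ℤ) - (2 * i + 1)) else 0 := by
        by_cases hlt : (m : ℤ) - (2 * i + 1) < 0
        · rw [S_neg hlt]; simp [dd, hlt]
        · have e : ((m - (2 * i + 1) : ℕ) : ℤ) = (m : ℤ) - (2 * i + 1) := by omega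
          rw [← e, ih _ (by omega), e]
          congr 1
          rw [eq_iff_iff]; omega
      rw [this, mul_neg, ← mul_assoc, cc_mul]; split_ifs <;> ring
    rw [Finset.sum_congr rfl key] at h
    apply mul_left_cancel₀ hm
    rw [Int.cast_natCast] at h
    rw [h]
    split_ifs with h0
    · rw [← Finset.mul_sum, dd_sum m m (by omega)]
      unfold dd; rw [if_neg (by omega), if_neg (by omega), zpow_natCast]; ring
    · simp

lemma ev_v_S (n m : ℤ) : ev (v n (sTildeZ m)) = if n + m = 0 then dd m else 0 := by
  by_cases h : m < 0
  · rw [S_neg h]; simp [dd, h]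
  · lift m to ℕ using by omega
    exact ev_v_S_nat m n

def kap (m n : ℤ) : ℂ := if m + n = 0 then 2 * (-1) ^ m else 0

lemma npow_neg (m : ℤ) : (-1 : ℂ) ^ (-m) = (-1) ^ m := by
  rw [zpow_neg]; rcases Int.even_or_odd m with h | h
  · rw [h.neg_one_zpow]; simp
  · rw [h.neg_one_zpow]; norm_num

lemma npow_sq (m : ℤ) : (-1 : ℂ) ^ m * (-1) ^ m = 1 := by
  rcases Int.even_or_odd m with h | h
  · rw [h.neg_one_zpow]; simp
  · rw [h.neg_one_zpow]; norm_num

lemma cliff_one (m n : ℤ) : v m (sTildeZ n) + v n (sTildeZ m) = C (kap m n) := by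
  rw [← sub_eq_zero]
  have H := vanish {p | ∃ m n : ℤ, p = v m (sTildeZ n) + v n (sTildeZ m) - C (kap m n)} ?_ ?_
  · exact H _ ⟨m, n, rfl⟩
  · rintro p ⟨m, n, rfl⟩
    rw [map_sub, map_add, ev_v_S, ev_v_S, add_comm n m]
    have : ev (C (kap m n)) = kap m n := by simp [ev]
    rw [this]; unfold kap
    split_ifs with h
    · obtain rfl : n = -m := by omega
      unfold dd
      rcases lt_trichotomy m 0 with h | h | h
      · rw [if_neg (by omega), if_neg (by omega), if_pos h, npow_neg]; ring
      · subst h; norm_num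
      · rw [if_pos (by omega), if_neg (by omega), if_neg (by omega)]; ring
    · ring
  · rintro p ⟨m, n, rfl⟩ i
    have : pderiv i (v m (sTildeZ n) + v n (sTildeZ m) - C (kap m n)) =
      (v (m - (2 * i + 1)) (sTildeZ n) + v n (sTildeZ (m - (2 * i + 1)))
          - C (kap (m - (2 * i + 1)) n)) +
      (v m (sTildeZ (n - (2 * i + 1))) + v (n - (2 * i + 1)) (sTildeZ m)
          - C (kap m (n - (2 * i + 1)))) := by
      have hk : kap (m - (2 * i + 1)) n + kap m (n - (2 * i + 1)) = 0 := by
        unfold kap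
        by_cases h : m + n = 2 * i + 1
        · rw [if_pos (by omega), if_pos (by omega), npow_odd']; ring
        · rw [if_neg (by omega), if_neg (by omega)]; ring
      have hk' : (C (kap (m - (2 * i + 1)) n) : BRing) = - C (kap m (n - (2 * i + 1))) := by
        rw [← map_neg]; congr 1; linear_combination hk
      rw [hk', map_sub, map_add, pderiv_v, pderiv_v, pderiv_C, pderiv_S, pderiv_S]; abel
    rw [this]
    exact Submodule.add_mem _ (Submodule.subset_span ⟨_, _, rfl⟩) (Submodule.subset_span ⟨_, _, rfl⟩)

lemma cliff (p : BRing) : ∀ m n : ℤ, v m (v n p) + v n (v m p) = kap m n • p := by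
  induction p using poly_ind with
  | h1 => intro m n; rw [v_one, v_one, cliff_one, MvPolynomial.smul_eq_C_mul, mul_one]
  | hs c p h => intro m n; simp only [map_smul]; rw [← smul_add, h, smul_comm]
  | ha p q hp hq =>
    intro m n; simp only [map_add]; rw [smul_add, ← hp, ← hq]; abel
  | hX i p hp =>
    intro m n
    simp only [v_X_mul, map_sub, map_smul]
    have e1 := hp m n
    have e2 := hp (m + (2 * i + 1)) n
    have e3 := hp m (n + (2 * i + 1))
    have hk : kap (m + (2 * i + 1)) n + kap m (n + (2 * i + 1)) = 0 := by
        unfold kap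
        by_cases h : m + n = -(2 * i + 1)
        · rw [if_pos (by omega), if_pos (by omega), npow_odd]; ring
        · rw [if_neg (by omega), if_neg (by omega)]; ring
    have e4 : v (m + (2 * i + 1)) (v n p) + v n (v (m + (2 * i + 1)) p) +
      (v m (v (n + (2 * i + 1)) p) + v (n + (2 * i + 1)) (v m p)) = 0 := by
      rw [e2, e3, ← add_smul, hk, zero_smul]
    rw [← mul_smul_comm, ← e1]
    simp only [MvPolynomial.smul_eq_C_mul] at *
    linear_combination (- C (cc i)) * e4

lemma v_S (m n : ℤ) (K : ℕ) (hK : n < K) :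
    v m (sTildeZ n) = ∑ k ∈ Finset.range K, dd k • (sTildeZ (m + k) * sTildeZ (n - k)) := by
  rw [← sub_eq_zero]
  have H := vanish {p | ∃ m n : ℤ, n < K ∧ p = v m (sTildeZ n) -
    ∑ k ∈ Finset.range K, dd k • (sTildeZ (m + k) * sTildeZ (n - k))} ?_ ?_
  · exact H _ ⟨m, n, hK, rfl⟩
  · rintro p ⟨m, n, hn, rfl⟩
    rw [map_sub, ev_v_S, map_sum, sub_eq_zero]
    simp only [ev_smul, map_mul, ev_S]
    by_cases h : n < 0
    · rw [Finset.sum_eq_zero]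
      · unfold dd; simp [h]
      · intro k _; rw [if_neg (show ¬ (n - (k : ℤ) = 0) by omega)]; simp
    · lift n to ℕ using by omega
      rw [Finset.sum_eq_single n]
      · simp
      · intro k _ hk; rw [if_neg (show ¬ ((n : ℤ) - (k : ℤ) = 0) by omega)]; simp
      · intro h; exfalso; apply h; rw [Finset.mem_range]; omega
  · rintro p ⟨m, n, hn, rfl⟩ i
    have : pderiv i (v m (sTildeZ n) -
      ∑ k ∈ Finset.range K, dd k • (sTildeZ (m + k) * sTildeZ (n - k))) =
      (v (m - (2 * i + 1)) (sTildeZ n) -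
      ∑ k ∈ Finset.range K, dd k • (sTildeZ ((m - (2 * i + 1)) + k) * sTildeZ (n - k))) +
      (v m (sTildeZ (n - (2 * i + 1))) -
      ∑ k ∈ Finset.range K, dd k • (sTildeZ (m + k) * sTildeZ ((n - (2 * i + 1)) - k))) := by
      have : ∀ k ∈ Finset.range K, pderiv i (dd k • (sTildeZ (m + k) * sTildeZ (n - k))) =
        dd k • (sTildeZ ((m - (2 * i + 1)) + k) * sTildeZ (n - k)) +
        dd k • (sTildeZ (m + k) * sTildeZ ((n - (2 * i + 1)) - k)) := by
        intro k _
        rw [Derivation.map_smul, Derivation.leibniz, pderiv_S, pderiv_S, ← smul_add,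
          smul_eq_mul, smul_eq_mul]
        rw [show m + k - (2 * (i : ℤ) + 1) = (m - (2 * i + 1)) + k by ring,
          show n - k - (2 * (i : ℤ) + 1) = (n - (2 * i + 1)) - k by ring]
        congr 1; ring
      rw [map_sub, map_sum, Finset.sum_congr rfl this, Finset.sum_add_distrib, pderiv_v, pderiv_S]
      abel
    rw [this]
    exact Submodule.add_mem _ (Submodule.subset_span ⟨_, _, hn, rfl⟩)
      (Submodule.subset_span ⟨_, _, by omega, rfl⟩)

end MDKP
end

noncomputable section
namespace MDKP
open MvPolynomial

abbrev E : Type := ℤ →₀ ℂ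

def V : E →ₗ[ℂ] Module.End ℂ BRing := Finsupp.linearCombination ℂ v

lemma V_single (m : ℤ) (x : ℂ) : V (Finsupp.single m x) = x • v m := by
  simp [V]

def sh (i : ℕ) : E →ₗ[ℂ] E := Finsupp.lmapDomain ℂ ℂ (fun m : ℤ => m - (2 * i + 1))

lemma sh_single (i : ℕ) (m : ℤ) (x : ℂ) :
    sh i (Finsupp.single m x) = Finsupp.single (m - (2 * i + 1)) x := by
  simp [sh]

lemma pderiv_V (i : ℕ) (a : E) (p : BRing) :
    pderiv i (V a p) = V a (pderiv i p) + V (sh i a) p := by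
  induction a using Finsupp.induction_linear with
  | zero => simp
  | add a b ha hb => simp only [map_add, LinearMap.add_apply, ha, hb]; abel
  | single m x =>
    rw [sh_single, V_single, V_single]
    simp only [LinearMap.smul_apply, Derivation.map_smul, pderiv_v, smul_add]

def bet (m : ℤ) : E →ₗ[ℂ] ℂ := Finsupp.linearCombination ℂ (kap m)

lemma bet_single (m n : ℤ) (x : ℂ) : bet m (Finsupp.single n x) = x * kap m n := by
  simp [bet]

lemma v_V (m : ℤ) (a : E) (p : BRing) : v m (V a p) = bet m a • p - V a (v m p) := by
  rw [eq_sub_iff_add_eq]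
  induction a using Finsupp.induction_linear with
  | zero => simp
  | add a b ha hb =>
    simp only [map_add, LinearMap.add_apply, add_smul]; rw [← ha, ← hb]; abel
  | single n x =>
    rw [bet_single, V_single]
    simp only [LinearMap.smul_apply, map_smul]
    rw [← smul_add, cliff, smul_smul]

def Pop : ∀ {k : ℕ}, (Fin k → E) → BRing → BRing
  | 0, _, p => p
  | _ + 1, b, p => V (b 0) (Pop (fun i => b i.succ) p)

def P {k : ℕ} (b : Fin k → E) : BRing := Pop b 1

lemma P_succ {k : ℕ} (b : Fin (k + 1) → E) : P b = V (b 0) (P (fun i => b i.succ)) := rfl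
lemma Pop_succ {k : ℕ} (b : Fin (k + 1) → E) (p : BRing) :
   Pop b p = V (b 0) (Pop (fun i => b i.succ) p) := rfl

lemma Pop_zero_arg {k : ℕ} (b : Fin k → E) : Pop b 0 = 0 := by
  induction k with
  | zero => rfl
  | succ k ih => rw [Pop_succ, ih, map_zero]

lemma Pop_anti {k : ℕ} (m : ℤ) (b : Fin (k + 1) → E) (p : BRing) :
    v m (Pop b p) = ∑ l : Fin (k + 1), ((-1 : ℂ) ^ (l : ℕ) * bet m (b l)) •
      Pop (b ∘ l.succAbove) p + (-1 : ℂ) ^ (k + 1) • Pop b (v m p) := by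
  induction k with
  | zero => rw [Pop_succ, v_V]; simp [Pop, sub_eq_add_neg]
  | succ k ih =>
    rw [Pop_succ, v_V, ih, Fin.sum_univ_succ (n := k + 1), Pop_succ b]
    simp only [map_add, map_sum, map_smul]
    have h0 : b ∘ (0 : Fin (k + 2)).succAbove = fun i => b i.succ := by
      ext i; simp
    have h1 : ∀ l : Fin (k + 1), Pop (b ∘ l.succ.succAbove) p =
      V (b 0) (Pop ((fun i => b i.succ) ∘ l.succAbove) p) := by
      intro l
      rw [Pop_succ]
      congr 2
      ext i; simp [Function.comp]
    simp only [h0, h1, Fin.val_succ, Fin.val_zero]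
    rw [sub_eq_add_neg, neg_add, ← Finset.sum_neg_distrib]
    refine Eq.trans ?_ (add_assoc _ _ _).symm
    congr 1
    · simp
    · congr 1
      · apply Finset.sum_congr rfl; intro l _; rw [← neg_smul]; congr 1; ring
      · rw [← neg_smul]; congr 1; ring

lemma pderiv_P {k : ℕ} (i : ℕ) (b : Fin k → E) :
    pderiv i (P b) = ∑ l : Fin k, P (Function.update b l (sh i (b l))) := by
  induction k with
  | zero => simp [P, Pop]
  | succ k ih =>
    rw [P_succ, pderiv_V, ih, Fin.sum_univ_succ, map_sum, add_comm]
    congr 1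
    · apply Finset.sum_congr rfl; intro l _
      rw [P_succ (Function.update b l.succ _)]
      rw [Function.update_of_ne (Fin.succ_ne_zero l).symm]
      congr 2
      ext j : 1
      by_cases h : j = l
      · subst h; simp
      · rw [Function.update_of_ne h, Function.update_of_ne (by simpa using h)]

def Oop (a : E) (x : ℂ) : Module.End ℂ BRing := V a + x • LinearMap.id

lemma pderiv_Oop (i : ℕ) (a : E) (x : ℂ) (p : BRing) :
    pderiv i (Oop a x p) = Oop a x (pderiv i p) + Oop (sh i a) 0 p := by
  simp only [Oop, LinearMap.add_apply, LinearMap.smul_apply, LinearMap.id_apply, map_add,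
    pderiv_V, Derivation.map_smul, zero_smul, add_zero]
  abel

lemma ev_P_id {k : ℕ} (hk : Even k) (b : Fin (k + 1) → E) :
    ev (P b) = ∑ l : Fin (k + 1), (-1 : ℂ) ^ (l : ℕ) * (ev (V (b l) 1) *
      ev (P (b ∘ l.succAbove))) := by
  have h1 : ∀ a : E, 2 * ev (V a 1) = bet 0 a := by
    intro a
    have := congrArg ev (v_V 0 a 1)
    rw [v_one, S_zero, ev_v_zero, map_sub, ev_smul, map_one ev, mul_one] at this
    linear_combination this
  have h2 := congrArg ev (Pop_anti 0 b 1)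
  rw [v_one, S_zero, ev_v_zero, hk.add_one.neg_one_pow, neg_one_smul, map_add, map_neg, map_sum]
    at h2
  simp only [ev_smul] at h2
  change ev (P b) = _ at h2
  have h3 : 2 * ev (P b) = ∑ l : Fin (k + 1), ((-1 : ℂ) ^ (l : ℕ) * bet 0 (b l)) *
      ev (Pop (b ∘ l.succAbove) 1) := by
    change _ = _ + - ev (P b) at h2
    linear_combination h2
  apply mul_left_cancel₀ (two_ne_zero (α := ℂ))
  rw [h3, Finset.mul_sum]
  apply Finset.sum_congr rfl; intro l _
  rw [← h1]; change _ * ev (P _) = _; ring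

lemma ev_P_v {k : ℕ} (hk : Even k) (m : ℤ) (b : Fin (k + 1) → E) :
    ev (v m (P b)) = ∑ l : Fin (k + 1), (-1 : ℂ) ^ (l : ℕ) * (ev (v m (V (b l) 1)) *
      ev (P (b ∘ l.succAbove))) := by
  rcases lt_trichotomy m 0 with h | h | h
  · rw [P, Pop_anti, v_one, S_neg h, Pop_zero_arg, smul_zero, add_zero, map_sum]
    apply Finset.sum_congr rfl; intro l _
    rw [v_V, v_one, S_neg h, map_zero, sub_zero, ev_smul, ev_smul, map_one]
    change _ * ev (P _) = _; ring
  · subst h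
    simp only [ev_v_zero]; exact ev_P_id hk b
  · simp only [ev_v_pos _ m h]; simp

lemma ev_P_O {k : ℕ} (hk : Even k) (a : E) (x : ℂ) (b : Fin (k + 1) → E) :
    ev (Oop a x (P b)) = ∑ l : Fin (k + 1), (-1 : ℂ) ^ (l : ℕ) * (ev (Oop a x (V (b l) 1)) *
      ev (P (b ∘ l.succAbove))) := by
  have hV : ev (V a (P b)) = ∑ l : Fin (k + 1), (-1 : ℂ) ^ (l : ℕ) * (ev (V a (V (b l) 1)) *
      ev (P (b ∘ l.succAbove))) := by
    induction a using Finsupp.induction_linear with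
    | zero => simp
    | add a b ha hb =>
      simp only [map_add, LinearMap.add_apply, ha, hb, ← Finset.sum_add_distrib]
      apply Finset.sum_congr rfl; intro l _; ring
    | single n x =>
      simp only [V_single, LinearMap.smul_apply, ev_smul, ev_P_v hk, Finset.mul_sum]
      apply Finset.sum_congr rfl; intro l _; ring
  simp only [Oop, LinearMap.add_apply, LinearMap.smul_apply, LinearMap.id_apply, map_add, ev_smul]
  rw [hV, ev_P_id hk, Finset.mul_sum, ← Finset.sum_add_distrib]
  apply Finset.sum_congr rfl; intro l _; ring

def Q {k : ℕ} (a : E) (x : ℂ) (b : Fin (k + 1) → E) : BRing :=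
  Oop a x (P b) - ∑ l : Fin (k + 1), (-1 : ℂ) ^ (l : ℕ) • (Oop a x (V (b l) 1) *
      P (b ∘ l.succAbove))

lemma pderiv_Q {k : ℕ} (i : ℕ) (a : E) (x : ℂ) (b : Fin (k + 1) → E) :
    pderiv i (Q a x b) = Q (sh i a) 0 b +
      ∑ j, Q a x (Function.update b j (sh i (b j))) := by
  have h1 : ∀ l : Fin (k + 1), pderiv i ((-1 : ℂ) ^ (l : ℕ) • (Oop a x (V (b l) 1) * P (b ∘ l.succAbove))) =
    (-1 : ℂ) ^ (l : ℕ) • (Oop (sh i a) 0 (V (b l) 1) * P (b ∘ l.succAbove)) +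
    ∑ j, (-1 : ℂ) ^ (l : ℕ) • (Oop a x (V (Function.update b j (sh i (b j)) l) 1) *
      P (Function.update b j (sh i (b j)) ∘ l.succAbove)) := by
    intro l
    rw [Fin.sum_univ_succAbove _ l]
    have e1 : Function.update b l (sh i (b l)) ∘ l.succAbove = b ∘ l.succAbove := by
      ext j : 1
      simp [Fin.succAbove_ne]
    have e2 : ∀ j, Function.update b (l.succAbove j) (sh i (b (l.succAbove j))) ∘ l.succAbove =
      Function.update (b ∘ l.succAbove) j (sh i ((b ∘ l.succAbove) j)) := by
      intro j
      rw [Function.update_comp_eq_of_injective _ Fin.succAbove_right_injective]; rfl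
    have e3 : ∀ j, Function.update b (l.succAbove j) (sh i (b (l.succAbove j))) l = b l := by
      intro j; rw [Function.update_of_ne (Fin.succAbove_ne l j).symm]
    simp only [e1, e2, e3, Function.update_self]
    rw [Derivation.map_smul, Derivation.leibniz, pderiv_Oop, pderiv_V, pderiv_P,
      ← Finset.smul_sum, ← Finset.mul_sum, ← smul_add, ← smul_add, pderiv_one, map_zero, zero_add]
    congr 1
    simp only [smul_eq_mul]; ring
  unfold Q
  rw [map_sub, map_sum, Finset.sum_congr rfl (fun l _ => h1 l), pderiv_Oop, pderiv_P, map_sum,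
    Finset.sum_add_distrib, Finset.sum_sub_distrib, Finset.sum_comm]
  abel

lemma wick {k : ℕ} (hk : Even k) (a : E) (x : ℂ) (b : Fin (k + 1) → E) :
    Oop a x (P b) = ∑ l : Fin (k + 1), (-1 : ℂ) ^ (l : ℕ) • (Oop a x (V (b l) 1) *
      P (b ∘ l.succAbove)) := by
  rw [← sub_eq_zero]
  refine vanish {p | ∃ a x, ∃ b : Fin (k + 1) → E, p = Q a x b} ?_ ?_ _ ⟨a, x, b, rfl⟩
  · rintro p ⟨a, x, b, rfl⟩
    rw [Q, map_sub, map_sum, ev_P_O hk, sub_eq_zero]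
    apply Finset.sum_congr rfl; intro l _
    rw [ev_smul, map_mul]
  · rintro p ⟨a, x, b, rfl⟩ i
    rw [pderiv_Q]
    refine Submodule.add_mem _ (Submodule.subset_span ⟨_, _, _, rfl⟩)
      (Submodule.sum_mem _ fun j _ => Submodule.subset_span ⟨_, _, _, rfl⟩)

lemma wick_odd {k : ℕ} (hk : Even k) (b : Fin (k + 1) → E) :
    P b = ∑ l : Fin (k + 1), (-1 : ℂ) ^ (l : ℕ) • (V (b l) 1 * P (b ∘ l.succAbove)) := by
  have := wick hk 0 1 b
  simpa [Oop] using this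

lemma wick_even {k : ℕ} (hk : Even k) (b : Fin (k + 2) → E) :
    P b = ∑ l : Fin (k + 1), (-1 : ℂ) ^ (l : ℕ) • (V (b 0) (V (b l.succ) 1) *
      P (b ∘ Fin.succ ∘ l.succAbove)) := by
  have := wick hk (b 0) 0 (fun i => b i.succ)
  rw [P_succ]
  simpa [Oop, Function.comp_def] using this

end MDKP
end

noncomputable section
namespace MDKP

def ext1 {m : ℕ} (π : Equiv.Perm (Fin m)) : Equiv.Perm (Fin (m + 1)) :=
  Equiv.Perm.decomposeFin.symm (0, π)

lemma ext1_zero {m : ℕ} (π : Equiv.Perm (Fin m)) : ext1 π 0 = 0 := by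
  simp [ext1]

lemma ext1_succ {m : ℕ} (π : Equiv.Perm (Fin m)) (i : Fin m) : ext1 π i.succ = (π i).succ := by
  simp [ext1]

lemma ext1_sign {m : ℕ} (π : Equiv.Perm (Fin m)) :
    Equiv.Perm.sign (ext1 π) = Equiv.Perm.sign π := by
  simp [ext1, Equiv.Perm.decomposeFin.symm_sign]

def G {m : ℕ} (x : Fin (m + 1) × Equiv.Perm (Fin m)) : Equiv.Perm (Fin (m + 1)) :=
  x.1.cycleRange.symm * ext1 x.2

lemma G_zero {m : ℕ} (x : Fin (m + 1) × Equiv.Perm (Fin m)) : G x 0 = x.1 := by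
  simp [G, ext1_zero]

lemma G_succ {m : ℕ} (x : Fin (m + 1) × Equiv.Perm (Fin m)) (i : Fin m) :
    G x i.succ = x.1.succAbove (x.2 i) := by
  simp [G, ext1_succ]

lemma G_sign {m : ℕ} (x : Fin (m + 1) × Equiv.Perm (Fin m)) :
    Equiv.Perm.sign (G x) = (-1) ^ (x.1 : ℕ) * Equiv.Perm.sign x.2 := by
  rw [G, Equiv.Perm.sign_mul, Equiv.Perm.sign_symm, Fin.sign_cycleRange, ext1_sign]

lemma G_bij {m : ℕ} : Function.Bijective (G (m := m)) := by
  rw [Fintype.bijective_iff_injective_and_card]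
  constructor
  · rintro ⟨j, π⟩ ⟨j', π'⟩ h
    have h0 : j = j' := by
      have := congrArg (fun σ => σ 0) h
      simpa [G_zero] using this
    subst h0
    congr 1
    ext1 i
    have := congrArg (fun σ => σ i.succ) h
    simp only [G_succ] at this
    exact Fin.succAbove_right_injective this
  · simp [Fintype.card_perm, Nat.factorial_succ]

lemma F_one {m : ℕ} (x : Fin (m + 1) × Equiv.Perm (Fin m)) (k' : ℕ) (e : k' = 1)
    (h : k' < m + 2) : ext1 (G x) ⟨k', h⟩ = x.1.succ := by
  subst e
  have : (⟨1, h⟩ : Fin (m + 2)) = Fin.succ 0 := rfl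
  rw [this, ext1_succ, G_zero]

lemma F_zero {m : ℕ} (x : Fin (m + 1) × Equiv.Perm (Fin m)) (k' : ℕ) (e : k' = 0)
    (h : k' < m + 2) : ext1 (G x) ⟨k', h⟩ = 0 := by
  subst e; exact ext1_zero _

lemma F_add {m : ℕ} (x : Fin (m + 1) × Equiv.Perm (Fin m)) (k k' : ℕ) (e : k' = k + 2)
    (h : k' < m + 2) (h' : k < m) :
    ext1 (G x) ⟨k', h⟩ = (x.1.succAbove (x.2 ⟨k, h'⟩)).succ := by
  subst e
  have : (⟨k + 2, h⟩ : Fin (m + 2)) = Fin.succ (Fin.succ ⟨k, h'⟩) := rfl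
  rw [this, ext1_succ, G_succ]

lemma cond_zero {n : ℕ} (σ : Equiv.Perm (Fin (2 * n + 2))) (h : pfaffianCond σ) : σ 0 = 0 := by
  obtain ⟨k, hk⟩ := σ.surjective 0
  obtain ⟨k, hkl⟩ := k
  rcases Nat.even_or_odd' k with ⟨i, rfl | rfl⟩
  · rcases Nat.eq_zero_or_pos i with rfl | hi
    · exact hk
    · have := h.2 ⟨0, by omega⟩ ⟨i, by omega⟩ hi
      simp only [hk] at this
      exact absurd this (Fin.not_lt_zero _)
  · have := h.1 ⟨i, by omega⟩
    simp only [hk] at this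
    exact absurd this (Fin.not_lt_zero _)

lemma cond_F {m : ℕ} (x : Fin (m + 1) × Equiv.Perm (Fin m)) :
    pfaffianCond (ext1 (G x)) ↔ pfaffianCond x.2 := by
  have hmono : ∀ a b : Fin m, (x.1.succAbove a).succ < (x.1.succAbove b).succ ↔ a < b := by
    intro a b
    rw [Fin.succ_lt_succ_iff, (Fin.strictMono_succAbove x.1).lt_iff_lt]
  constructor
  · rintro ⟨h1, h2⟩
    constructor
    · intro i
      have := h1 ⟨i + 1, by have := i.isLt; omega⟩
      have hi := i.isLt
      rwa [F_add x (2 * i) _ (by simp; ring) _ (by omega),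
        F_add x (2 * i + 1) _ (by simp; ring) _ (by omega), hmono] at this
    · intro i j hij
      have hi := i.isLt
      have hj := j.isLt
      have := h2 ⟨i + 1, by omega⟩ ⟨j + 1, by omega⟩ (by simpa using hij)
      rwa [F_add x (2 * i) _ (by simp; ring) _ (by omega),
        F_add x (2 * j) _ (by simp; ring) _ (by omega), hmono] at this
  · rintro ⟨h1, h2⟩
    constructor
    · rintro ⟨i, hi⟩
      rcases i with _ | i
      · rw [F_zero x _ (by simp), F_one x _ (by simp)]; exact Fin.succ_pos _
      · rw [F_add x (2 * i) _ (by simp; ring) _ (by omega),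
          F_add x (2 * i + 1) _ (by simp; ring) _ (by omega), hmono]
        exact h1 ⟨i, by omega⟩
    · rintro ⟨i, hi⟩ ⟨j, hj⟩ hij
      have hij' : i < j := hij
      rcases j with _ | j
      · omega
      rcases i with _ | i
      · rw [F_zero x _ (by simp), F_add x (2 * j) _ (by simp; ring) _ (by omega)]
        exact Fin.succ_pos _
      · rw [F_add x (2 * i) _ (by simp; ring) _ (by omega),
          F_add x (2 * j) (2 * (j + 1)) (by ring) _ (by omega), hmono]
        exact h2 ⟨i, by omega⟩ ⟨j, by omega⟩ (by simp; omega)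

lemma prod_F {R : Type*} [CommRing R] {m : ℕ} (A : Matrix (Fin (m + 2)) (Fin (m + 2)) R)
    (x : Fin (m + 1) × Equiv.Perm (Fin m)) :
    ∏ i : Fin ((m + 2) / 2),
          A (ext1 (G x) ⟨2 * i.val, by have := i.isLt; omega⟩)
            (ext1 (G x) ⟨2 * i.val + 1, by have := i.isLt; omega⟩) =
    A 0 x.1.succ * ∏ i : Fin (m / 2),
      A.submatrix (Fin.succ ∘ x.1.succAbove) (Fin.succ ∘ x.1.succAbove)
        (x.2 ⟨2 * i.val, by have := i.isLt; omega⟩)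
            (x.2 ⟨2 * i.val + 1, by have := i.isLt; omega⟩) := by
  have e : m / 2 + 1 = (m + 2) / 2 := by omega
  rw [← Equiv.prod_comp (finCongr e), Fin.prod_univ_succ]
  congr 1
  · rw [F_zero x _ (by simp), F_one x _ (by simp)]
  apply Finset.prod_congr rfl
  intro i _
  have hi := i.isLt
  rw [F_add x (2 * i) _ (by simp; ring) _ (by omega),
      F_add x (2 * i + 1) _ (by simp; ring) _ (by omega)]
  rfl

lemma pf_expand {R : Type*} [CommRing R] (n : ℕ)
    (A : Matrix (Fin (2 * n + 2)) (Fin (2 * n + 2)) R) :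
    pfaffian A = ∑ j : Fin (2 * n + 1), (-1) ^ (j : ℕ) * (A 0 j.succ *
      pfaffian (A.submatrix (Fin.succ ∘ j.succAbove) (Fin.succ ∘ j.succAbove))) := by
  classical
  unfold pfaffian
  rw [← Equiv.sum_comp (Equiv.Perm.decomposeFin.symm), Fintype.sum_prod_type,
    Finset.sum_eq_single 0]
  · change ∑ e, (if pfaffianCond (ext1 e) then (Equiv.Perm.sign (ext1 e) : ℤ) •
        ∏ i : Fin ((2 * n + 2) / 2),
          A (ext1 e ⟨2 * i.val, by have := i.isLt; omega⟩)
            (ext1 e ⟨2 * i.val + 1, by have := i.isLt; omega⟩) else 0) = _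
    rw [← Equiv.sum_comp (Equiv.ofBijective G G_bij), Fintype.sum_prod_type]
    apply Finset.sum_congr rfl; intro j _
    rw [Finset.mul_sum, Finset.mul_sum]
    apply Finset.sum_congr rfl; intro π _
    simp only [Equiv.ofBijective_apply, cond_F, prod_F, ext1_sign, G_sign]
    split_ifs with h
    · simp only [zsmul_eq_mul]; push_cast; ring
    · simp
  · intro p _ hp
    apply Finset.sum_eq_zero; intro e _
    rw [if_neg]
    intro hc
    have := cond_zero _ hc
    simp at this
    exact hp this
  · simp

lemma pf_zero {R : Type*} [CommRing R] (A : Matrix (Fin 0) (Fin 0) R) : pfaffian A = 1 := by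
  classical
  unfold pfaffian
  rw [Fintype.sum_subsingleton _ 1, if_pos]
  · simp
  · exact ⟨fun i => i.elim0, fun i => i.elim0⟩

end MDKP
end

noncomputable section
namespace MDKP
open MvPolynomial

section ps
variable {R : Type*} [CommRing R] [Algebra ℂ R]

def Dx (x : ℕ → R) : PowerSeries R := PowerSeries.mk fun j => ((j + 1 : ℕ) : ℂ) • x (j + 1)

def Ex (x : ℕ → R) : PowerSeries R := PowerSeries.mk fun n => aeval x (schurPoly n)

lemma uniq (x : ℕ → R) (F : PowerSeries R) (h0 : PowerSeries.coeff 0 F = 1)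
    (h : PowerSeries.derivative R F = Dx x * F) (n : ℕ) :
    PowerSeries.coeff n F = aeval x (schurPoly n) := by
  induction n using Nat.strong_induction_on with
  | _ n ih =>
  rcases n with _ | n
  · rw [h0]; simp [schurPoly]
  · have h1 := congrArg (PowerSeries.coeff n) h
    rw [PowerSeries.coeff_derivative, PowerSeries.coeff_mul,
      Finset.Nat.sum_antidiagonal_eq_sum_range_succ_mk] at h1
    have h2 := schur_rec R x n
    have hn : ((n + 1 : ℕ) : ℂ) ≠ 0 := by exact_mod_cast Nat.succ_ne_zero n
    apply smul_right_injective R hn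
    change _ = ((n + 1 : ℕ) : ℂ) • _
    rw [h2]
    change ((n + 1 : ℕ) : ℂ) • _ = _
    have : ((n + 1 : ℕ) : ℂ) • PowerSeries.coeff (n + 1) F =
       PowerSeries.coeff (n + 1) F * ((n : R) + 1) := by
      rw [Algebra.smul_def, mul_comm]; simp
    rw [this, h1]
    apply Finset.sum_congr rfl
    intro j hj
    rw [ih (n - j) (by omega)]
    simp [Dx]

lemma Ex_ode (x : ℕ → R) : PowerSeries.derivative R (Ex x) = Dx x * Ex x := by
  ext n
  rw [PowerSeries.coeff_derivative, PowerSeries.coeff_mul,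
      Finset.Nat.sum_antidiagonal_eq_sum_range_succ_mk]
  have h2 := schur_rec R x n
  have : ((n + 1 : ℕ) : ℂ) • PowerSeries.coeff (n + 1) (Ex x) =
       PowerSeries.coeff (n + 1) (Ex x) * ((n : R) + 1) := by
      rw [Algebra.smul_def, mul_comm]; simp
  rw [← this]
  simp only [Ex, PowerSeries.coeff_mk]
  rw [h2]
  apply Finset.sum_congr rfl
  intro j hj
  simp [Dx]

lemma Ex_zero (x : ℕ → R) : PowerSeries.coeff 0 (Ex x) = 1 := by simp [Ex, schurPoly]

lemma schur_add (x y : ℕ → R) (n : ℕ) :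
    aeval (fun j => x j + y j) (schurPoly n) =
    ∑ i ∈ Finset.range (n + 1), aeval x (schurPoly i) * aeval y (schurPoly (n - i)) := by
  rw [← uniq (fun j => x j + y j) (Ex x * Ex y) ?_ ?_ n]
  · rw [PowerSeries.coeff_mul, Finset.Nat.sum_antidiagonal_eq_sum_range_succ_mk]
    simp [Ex]
  · rw [PowerSeries.coeff_mul]; simp [Ex, schurPoly]
  · rw [Derivation.leibniz, Ex_ode, Ex_ode, smul_eq_mul, smul_eq_mul]
    have : Dx (fun j => x j + y j) = Dx x + Dx y := by
      ext n; simp [Dx]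
    rw [this]; ring
end ps

lemma exists_c (α : ℕ → ℂ) (h0 : α 0 = 1) : ∃ c : ℕ → ℂ, ∀ n, sC n c = α n := by
  set F : PowerSeries ℂ := PowerSeries.mk α
  have hF : PowerSeries.constantCoeff F ≠ 0 := by simp [F, h0]
  set D := PowerSeries.derivative ℂ F * F⁻¹
  refine ⟨fun j => PowerSeries.coeff (j - 1) D / j, fun n => ?_⟩
  have := uniq (fun j => PowerSeries.coeff (j - 1) D / j) F (by simp [F, h0]) ?_ n
  · rw [sC, ← MvPolynomial.coe_aeval_eq_eval]
    simp only [F, PowerSeries.coeff_mk] at this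
    exact this.symm
  · have e : Dx (fun j => PowerSeries.coeff (j - 1) D / (j : ℂ)) = D := by
      ext n
      have hn : ((n + 1 : ℕ) : ℂ) ≠ 0 := by exact_mod_cast Nat.succ_ne_zero n
      rw [Dx, PowerSeries.coeff_mk, smul_eq_mul, mul_div_cancel₀ _ hn]
      simp
    rw [e, mul_assoc, PowerSeries.inv_mul_cancel _ hF, mul_one]

lemma sB_shift (c : ℕ → ℂ) (n : ℕ) : sB n (tShift c) =
    ∑ i ∈ Finset.range (n + 1), sC i c • sTildeZ ((n : ℤ) - i) := by
  have h := schur_add (R := BRing) (fun j => C (c j)) tTilde n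
  have : tShift c = fun j => C (c j) + tTilde j := by
    ext1 j; rw [tShift, add_comm]
  rw [sB, this, h]
  apply Finset.sum_congr rfl
  intro i hi
  rw [Finset.mem_range] at hi
  have e1 : (aeval (fun j => (C (c j) : BRing))) (schurPoly i) = C (sC i c) := by
    rw [sC, ← MvPolynomial.coe_aeval_eq_eval]
    exact (MvPolynomial.aeval_algebraMap_apply BRing c (schurPoly i))
  have e2 : sTildeZ ((n : ℤ) - i) = aeval tTilde (schurPoly (n - i)) := by
    rw [sTildeZ, if_pos (by omega)]; congr 2; omega
  rw [e1, e2, MvPolynomial.smul_eq_C_mul]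

lemma sB_shift' (c : ℕ → ℂ) (K : ℕ) (hK : ∀ i, K ≤ i → sC i c = 0) (n : ℕ) :
    ∑ i ∈ Finset.range K, sC i c • sTildeZ ((n : ℤ) - i) = sB n (tShift c) := by
  rw [sB_shift]
  trans ∑ i ∈ Finset.range (max K (n + 1)), sC i c • sTildeZ ((n : ℤ) - i)
  · apply Finset.sum_subset
    · intro i; simp only [Finset.mem_range]; omega
    · intro i _ hi
      simp only [Finset.mem_range] at hi
      rw [hK i (by omega), zero_smul]
  · symm
    apply Finset.sum_subset
    · intro i; simp only [Finset.mem_range]; omega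
    · intro i _ hi
      simp only [Finset.mem_range] at hi
      rw [S_neg (by omega), smul_zero]

def Aop (l : ℕ) (c : ℕ → ℂ) (K : ℕ) : E :=
  ∑ i ∈ Finset.range K, Finsupp.single ((l : ℤ) - i) (sqrt2⁻¹ * sC i c)

lemma V_Aop (l : ℕ) (c : ℕ → ℂ) (K : ℕ) (p : BRing) :
    V (Aop l c K) p = sqrt2⁻¹ • ∑ i ∈ Finset.range K, sC i c • v ((l : ℤ) - i) p := by
  rw [Aop, map_sum, LinearMap.sum_apply, Finset.smul_sum]
  apply Finset.sum_congr rfl; intro i _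
  rw [V_single, LinearMap.smul_apply, smul_smul]

lemma sqrt2_sq : sqrt2⁻¹ * sqrt2⁻¹ = (2 : ℂ)⁻¹ := by
  rw [← mul_inv]; congr 1
  rw [sqrt2, ← Complex.ofReal_mul, Real.mul_self_sqrt (by norm_num)]; norm_num

lemma sqrt2_ne : sqrt2⁻¹ ≠ 0 := by
  intro h; have := sqrt2_sq; rw [h] at this; norm_num at this

lemma rho1_eq (l : ℕ) (c : ℕ → ℂ) (K : ℕ) (hK : ∀ i, K ≤ i → sC i c = 0) :
    rho1B l (tShift c) 0 = V (Aop l c K) 1 := by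
  rw [rho1B, V_Aop, map_zero, add_zero, ← sB_shift' c K hK]
  simp only [v_one]

lemma rho2_eq (l l' : ℕ) (c c' : ℕ → ℂ) (K K' : ℕ) (hK : ∀ i, K ≤ i → sC i c = 0)
    (hK' : ∀ i, K' ≤ i → sC i c' = 0) :
    rhoB l l' (tShift c) (tShift c') 0 0 = V (Aop l c K) (V (Aop l' c' K') 1) := by
  have e1 : rhoB l l' (tShift c) (tShift c') 0 0 = (2 : ℂ)⁻¹ • ∑ k ∈ Finset.range (l' + 1),
      dd k • (sB (l + k) (tShift c) * sB (l' - k) (tShift c')) := by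
    rw [rhoB, map_zero, sub_zero, add_zero, smul_mul_smul_comm, sqrt2_sq, Finset.sum_range_succ',
      smul_add, add_comm]
    congr 1
    · rw [Finset.smul_sum, Finset.range_eq_Ico, Finset.sum_Ico_add' (fun k => (2 : ℂ)⁻¹ •
        dd (k : ℕ) • (sB (l + k) (tShift c) * sB (l' - k) (tShift c'))) 0 l' 1]
      rw [zero_add]
      apply Finset.sum_congr
      · ext x; simp
      · intro k hk
        rw [Finset.mem_Ico] at hk
        rw [smul_smul]; congr 1
        rw [dd, if_neg (by omega), if_neg (by omega), zpow_natCast]; ring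
    · simp [dd]
  rw [e1, V_Aop, V_Aop]
  simp only [map_smul, map_sum, v_one]
  have e2 : ∀ i ∈ Finset.range K, ∀ i' ∈ Finset.range K',
     v ((l : ℤ) - i) (sTildeZ ((l' : ℤ) - i')) = ∑ k ∈ Finset.range (l' + 1),
      dd k • (sTildeZ (((l + k : ℕ) : ℤ) - i) * sTildeZ (((l' - k : ℕ) : ℤ) - i')) := by
    intro i _ i' _
    rw [v_S _ _ (l' + 1) (by push_cast; omega)]
    apply Finset.sum_congr rfl
    intro k hk
    rw [Finset.mem_range] at hk
    congr 3
    · push_cast; ring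
    · rw [Nat.cast_sub (by omega)]; ring
  have e3 : ∀ k ∈ Finset.range (l' + 1),
      dd k • (sB (l + k) (tShift c) * sB (l' - k) (tShift c')) =
      ∑ i ∈ Finset.range K, ∑ i' ∈ Finset.range K', sC i c • sC i' c' •
       dd k • (sTildeZ (((l + k : ℕ) : ℤ) - i) * sTildeZ (((l' - k : ℕ) : ℤ) - i')) := by
    intro k _
    rw [← sB_shift' c K hK, ← sB_shift' c' K' hK', Finset.sum_mul_sum, Finset.smul_sum]
    apply Finset.sum_congr rfl; intro i _
    rw [Finset.smul_sum]
    apply Finset.sum_congr rfl; intro i' _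
    simp only [MvPolynomial.smul_eq_C_mul]; ring
  rw [Finset.sum_congr rfl e3, Finset.sum_comm, ← sqrt2_sq, mul_smul]
  congr 1
  rw [Finset.smul_sum]
  apply Finset.sum_congr rfl; intro i hi
  rw [Finset.sum_comm, smul_comm (sC i c)]
  congr 1
  rw [Finset.smul_sum]
  apply Finset.sum_congr rfl; intro i' hi'
  rw [e2 i hi i' hi', Finset.smul_sum, Finset.smul_sum]

lemma skewOf_sub {R : Type*} [CommRing R] {m n : ℕ} (f : Fin m → Fin m → R) (g : Fin n → Fin m)
    (hg : StrictMono g) : (skewOf f).submatrix g g = skewOf fun i j => f (g i) (g j) := by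
  ext i j
  simp [skewOf, hg.lt_iff_lt]

lemma sm {m : ℕ} (j : Fin (m + 1)) : StrictMono (Fin.succ ∘ j.succAbove) :=
  (Fin.strictMono_succ).comp (Fin.strictMono_succAbove j)

lemma neg_one_pow_smul (k : ℕ) (p : BRing) : (-1 : ℂ) ^ k • p = (-1) ^ k * p := by
  rw [MvPolynomial.smul_eq_C_mul]; simp

lemma pf_even (n : ℕ) : ∀ b : Fin (2 * n) → E,
    pfaffian (skewOf fun i j => V (b i) (V (b j) 1)) = P b := by
  induction n with
  | zero => intro b; exact pf_zero _
  | succ n ih =>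
    intro b
    rw [wick_even (even_two_mul n) b]
    refine (pf_expand n _).trans ?_
    apply Finset.sum_congr rfl; intro j _
    rw [skewOf_sub _ _ (sm j), neg_one_pow_smul]
    congr 2
    exact ih (b ∘ Fin.succ ∘ j.succAbove)

lemma pf_odd (n : ℕ) (b : Fin (2 * n + 1) → E) (f : Fin (2 * n + 2) → Fin (2 * n + 2) → BRing)
    (h0 : ∀ j, f 0 j.succ = V (b j) 1) (h1 : ∀ i j, f i.succ j.succ = V (b i) (V (b j) 1)) :
    pfaffian (skewOf f) = P b := by
  rw [wick_odd (even_two_mul n) b, pf_expand]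
  apply Finset.sum_congr rfl; intro j _
  rw [skewOf_sub _ _ (sm j), neg_one_pow_smul]
  congr 2
  · rw [← h0]; simp [skewOf]
  · rw [← pf_even]
    simp only [Function.comp, h1]

lemma rhoTau_eq {k : ℕ} (lam : Fin k → ℕ) (c : Fin k → ℕ → ℂ) (K : Fin k → ℕ)
    (hK : ∀ i j, K i ≤ j → sC j (c i) = 0) :
    rhoTau lam c (fun _ => 0) = P (fun i => Aop (lam i) (c i) (K i)) := by
  rw [rhoTau]
  split_ifs with h
  · obtain ⟨n, rfl⟩ : ∃ n, k = 2 * n := ⟨k / 2, by omega⟩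
    rw [← pf_even, rhoMatrixEven]
    congr 2
    ext1 i; ext1 j
    exact rho2_eq _ _ _ _ _ _ (hK i) (hK j)
  · obtain ⟨n, rfl⟩ : ∃ n, k = 2 * n + 1 := ⟨k / 2, by omega⟩
    rw [rhoMatrixOdd]
    apply pf_odd
    · intro j
      simp only [Fin.val_zero, if_true, Fin.val_succ, Nat.add_sub_cancel, Fin.eta,
        Nat.succ_ne_zero, dite_false]
      exact rho1_eq _ _ _ (hK j)
    · intro i j
      simp only [if_false, Fin.val_succ, Nat.add_sub_cancel, Fin.eta,
        Nat.succ_ne_zero, dite_false]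
      exact rho2_eq _ _ _ _ _ _ (hK i) (hK j)

lemma Pop_snoc {k : ℕ} (b : Fin (k + 1) → E) (p : BRing) :
    Pop b p = Pop (fun i => b i.castSucc) (V (b (Fin.last k)) p) := by
  induction k with
  | zero => rfl
  | succ k ih =>
    rw [Pop_succ, ih, Pop_succ (fun i : Fin (k + 1) => b i.castSucc)]; rfl

lemma Pop_smul {k : ℕ} (b : Fin k → E) (x : ℂ) (p : BRing) : Pop b (x • p) = x • Pop b p := by
  induction k with
  | zero => rfl
  | succ k ih => rw [Pop_succ, ih, map_smul, Pop_succ]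

end MDKP
end

noncomputable section
namespace MDKP
open MvPolynomial

def op (M : ℕ) (c : ℤ → ℂ) : E := ∑ m ∈ Finset.Icc (-(M : ℤ)) M, Finsupp.single m (c m)

lemma V_op (M : ℕ) (c : ℤ → ℂ) (p : BRing) :
    V (op M c) p = ∑ m ∈ Finset.Icc (-(M : ℤ)) M, c m • v m p := by
  rw [op, map_sum, LinearMap.sum_apply]
  simp only [V_single, LinearMap.smul_apply]

lemma bet_op (M : ℕ) (c : ℤ → ℂ) (m : ℤ) (hm : m ∈ Finset.Icc (-(M : ℤ)) M) :
    bet (-m) (op M c) = 2 * (-1) ^ m * c m := by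
  rw [op, map_sum]
  simp only [bet_single]
  rw [Finset.sum_eq_single m]
  · rw [kap, if_pos (by ring), npow_neg]; ring
  · intro k _ hk; rw [kap, if_neg (by omega), mul_zero]
  · intro h; exact absurd hm h

def cf (f : BRing →ₗ[ℂ] ℂ) (τ : BRing) (m : ℤ) : ℂ := (-1) ^ m * f (v (-m) τ)

lemma op_func (f : BRing →ₗ[ℂ] ℂ) (d : ℕ →₀ ℕ) : ∃ Φ : BRing2 →ₗ[ℂ] ℂ, ∀ p q : BRing,
    Φ (inL p * inR q) = coeff d p * f q := by
  let Ξ := MvPolynomial.sumAlgEquiv ℂ ℕ ℕ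
  refine ⟨f ∘ₗ ((lcoeff BRing d).restrictScalars ℂ) ∘ₗ Ξ.toLinearMap, ?_⟩
  intro p q
  have e1 : Ξ (inL p) = MvPolynomial.map C p := by
    change Ξ (rename Sum.inl p) = _
    induction p using MvPolynomial.induction_on with
    | C a => simp [Ξ]
    | add p q hp hq => rw [map_add, map_add, hp, hq, map_add]
    | mul_X p i hp => rw [map_mul, map_mul, hp, map_mul, rename_X, map_X]; simp [Ξ]
  have e2 : Ξ (inR q) = C q := by
    change Ξ (rename Sum.inr q) = _
    induction q using MvPolynomial.induction_on with
    | C a => simp [Ξ]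
    | add p q hp hq => rw [map_add, map_add, hp, hq, map_add]
    | mul_X p i hp => rw [map_mul, map_mul, hp, map_mul, rename_X]; simp [Ξ]
  change f (coeff d (Ξ (inL p * inR q))) = _
  rw [map_mul, e1, e2, mul_comm, coeff_C_mul, coeff_map, mul_comm, ← MvPolynomial.smul_eq_C_mul,
    map_smul, smul_eq_mul]

lemma func_form (τ₀ τ₁ : BRing) (h : SatisfiesMDKP τ₀ τ₁) : ∃ M0 : ℕ, ∀ M : ℕ, M0 ≤ M →
    ∀ f : BRing →ₗ[ℂ] ℂ, V (op M (cf f τ₁)) τ₀ = f τ₀ • τ₁ := by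
  obtain ⟨M1, h1⟩ := v_bdd τ₀
  obtain ⟨M2, h2⟩ := v_bdd τ₁
  refine ⟨max M1 M2, fun M hM f => ?_⟩
  rw [SatisfiesMDKP, finsum_eq_sum_of_support_subset (s := Finset.Icc (-(M : ℤ)) M)] at h
  · ext d
    obtain ⟨Φ, hΦ⟩ := op_func f d
    have h3 := congrArg Φ h
    rw [map_sum] at h3
    simp only [hΦ, leftCoeff_eq, rightCoeff_eq, u_eq, map_smul] at h3
    rw [V_op, coeff_sum, coeff_smul, smul_eq_mul, mul_comm, ← h3]
    apply Finset.sum_congr rfl; intro m _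
    rw [coeff_smul, cf, npow_neg]; simp only [smul_eq_mul]; ring
  · intro m hm
    rw [Function.mem_support] at hm
    rw [Finset.coe_Icc, Set.mem_Icc]
    by_contra hc
    apply hm
    rw [leftCoeff_eq, rightCoeff_eq, u_eq]
    by_cases hlt : m < -(M : ℤ)
    · rw [h1 m (by omega)]; simp
    · rw [h2 (-m) (by omega)]; simp

def BK (τ : BRing) : Prop := ∃ M0 : ℕ, ∀ M : ℕ, M0 ≤ M →
    ∀ f : BRing →ₗ[ℂ] ℂ, V (op M (cf f τ)) τ = f τ • τ

lemma exists_f (p q : BRing) (h : ∀ y : ℂ, q ≠ y • p) : ∃ f : BRing →ₗ[ℂ] ℂ, f p = 0 ∧ f q ≠ 0 := by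
  have : q ∉ Submodule.span ℂ {p} := by
    rw [Submodule.mem_span_singleton]; rintro ⟨y, hy⟩; exact h y hy.symm
  obtain ⟨f, hf, hf'⟩ := Submodule.exists_le_ker_of_notMem this
  refine ⟨f, ?_, hf⟩
  exact hf' (Submodule.subset_span rfl)

lemma proportional (τ₀ τ₁ : BRing) (hB : BK τ₀) (hM : SatisfiesMDKP τ₀ τ₁) (h₁ : τ₁ ≠ 0) :
    ∃ y : ℂ, τ₀ = y • τ₁ := by
  by_contra hc
  push Not at hc
  obtain ⟨f, hf1, hf0⟩ := exists_f τ₁ τ₀ hc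
  obtain ⟨M1, hM1⟩ := hB
  obtain ⟨M2, hM2⟩ := func_form _ _ hM
  set M := max M1 M2
  set a := op M (cf f τ₁) with ha
  have e1 : V a τ₀ = f τ₀ • τ₁ := hM2 M (le_max_right _ _) f
  have e2 := hM1 M (le_max_left _ _) (f ∘ₗ V a)
  rw [LinearMap.comp_apply, e1, map_smul, hf1, smul_zero, zero_smul, V_op] at e2
  have e3 : ∀ m ∈ Finset.Icc (-(M : ℤ)) M, cf (f ∘ₗ V a) τ₀ m • v m τ₀ =
     f τ₀ • (cf f τ₁ m • v m τ₀) := by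
    intro m hm
    have e4 := v_V (-m) a τ₀
    rw [e1, ha, bet_op _ _ m hm, ← ha, map_smul] at e4
    have e5 := congrArg f e4
    rw [map_smul, map_sub, map_smul, smul_eq_mul, smul_eq_mul] at e5
    rw [smul_smul]; congr 1
    rw [cf, LinearMap.comp_apply]
    have e6 : (-1 : ℂ) ^ m * cf f τ₁ m = f (v (-m) τ₁) := by
      rw [cf, ← mul_assoc, npow_sq, one_mul]
    rw [← e6] at e5
    linear_combination (-1 : ℂ) ^ m * e5 + f τ₀ * cf f τ₁ m * npow_sq m
  rw [Finset.sum_congr rfl e3, ← Finset.smul_sum, ← V_op, e1, smul_smul] at e2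
  rcases smul_eq_zero.mp e2 with h | h
  · exact (mul_ne_zero hf0 hf0) h
  · exact h₁ h

lemma vsq (N : ℤ) (hN : 0 < N) (p : BRing) : v (-N) (v (-N) p) = 0 := by
  have := cliff p (-N) (-N)
  rw [kap, if_neg (by omega), zero_smul, ← two_smul ℂ] at this
  exact (smul_eq_zero.mp this).resolve_left two_ne_zero

lemma BK_step (τ : BRing) (h : BK τ) (N : ℕ) (hN : 0 < N) : BK (v (-N) τ) := by
  obtain ⟨M0, h⟩ := h
  refine ⟨max M0 N, fun M hM f => ?_⟩
  set B := v (-(N : ℤ)) with hB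
  have hBB : B (B τ) = 0 := vsq N (by exact_mod_cast hN) τ
  have e := h M (by omega) (f ∘ₗ B)
  have e1 : ∀ m ∈ Finset.Icc (-(M : ℤ)) M, cf f (B τ) m • v m (B τ) =
      (if m = -N then (2 * f τ) • v m (B τ) else 0) - cf (f ∘ₗ B) τ m • v m (B τ) := by
    intro m _
    have := cliff τ (-m) (-N)
    rw [← hB] at this
    have h2 := congrArg f this
    rw [map_add, map_smul, smul_eq_mul] at h2
    have h3 : cf f (B τ) m = (if m = -N then 2 * f τ else 0) - cf (f ∘ₗ B) τ m := by
      rw [cf, cf, LinearMap.comp_apply, eq_sub_iff_add_eq, ← mul_add, h2]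
      split_ifs with hm
      · subst hm; rw [kap, if_pos (by ring), neg_neg, npow_neg]
        linear_combination 2 * f τ * npow_sq N
      · rw [kap, if_neg (by omega)]; ring
    rw [h3, sub_smul, ite_smul, zero_smul]
  rw [V_op, Finset.sum_congr rfl e1, Finset.sum_sub_distrib, Finset.sum_ite_eq', ← V_op]
  have e2 := v_V (-(N : ℤ)) (op M (cf (f ∘ₗ B) τ)) τ
  rw [← hB, e, bet_op _ _ _ (by rw [Finset.mem_Icc]; omega), cf, LinearMap.comp_apply, LinearMap.comp_apply,
    ← hB, hBB] at e2
  rw [map_zero, mul_zero, mul_zero, zero_smul, zero_sub, map_smul] at e2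
  rw [if_pos (by rw [Finset.mem_Icc]; omega), ← hB, hBB, smul_zero, zero_sub, ← e2]

lemma const_of_pderiv (q : BRing) (h : ∀ i, pderiv i q = 0) : q = C (ev q) := by
  rw [← sub_eq_zero]
  refine vanish {p | p = q - C (ev q)} ?_ ?_ _ rfl
  · rintro p rfl; simp [ev]
  · rintro p rfl i; rw [map_sub, h, pderiv_C, sub_zero]; exact Submodule.zero_mem _

lemma kill_const (n : ℕ) : ∀ p : BRing, (∀ d : ℕ →₀ ℕ, n < d.degree → coeff d p = 0) →
    (∀ m : ℤ, 0 < m → v (-m) p = 0) → p = C (ev p) := by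
  induction n with
  | zero =>
    intro p hp _
    apply const_of_pderiv
    intro i; ext d
    rw [coeff_pderiv, hp _ (by rw [map_add, Finsupp.degree_single]; omega), zero_mul, coeff_zero]
  | succ n ih =>
    intro p hp hk
    apply const_of_pderiv
    have h1 : ∀ i, pderiv i p = C (ev (pderiv i p)) := by
      intro i
      apply ih
      · intro d hd
        rw [coeff_pderiv, hp _ (by rw [map_add, Finsupp.degree_single]; omega), zero_mul]
      · intro m hm
        have := pderiv_v i p (-m)
        rw [hk m hm, map_zero, show -m - (2 * (i : ℤ) + 1) = -(m + (2 * i + 1)) by ring,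
          hk _ (by omega), add_zero] at this
        exact this.symm
    set q := p - ∑ i ∈ p.vars, ev (pderiv i p) • X i with hq
    have hvars : ∀ j, j ∉ p.vars → pderiv j p = 0 := fun j hj => pderiv_eq_zero_of_notMem_vars hj
    have h2 : ∀ j, pderiv j q = 0 := by
      intro j
      rw [hq, map_sub, map_sum]
      simp only [Derivation.map_smul, pderiv_X, Pi.single_apply]
      by_cases hj : j ∈ p.vars
      · rw [Finset.sum_eq_single j]
        · rw [if_pos rfl, MvPolynomial.smul_eq_C_mul, mul_one, ← h1, sub_self]
        · intro i _ hi; rw [if_neg hi, smul_zero]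
        · intro h; exact absurd hj h
      · rw [hvars j hj, Finset.sum_eq_zero, sub_zero]
        intro i hi; rw [if_neg, smul_zero]; rintro rfl; exact hj hi
    have h3 := const_of_pderiv q h2
    have h4 : p = ev q • 1 + ∑ i ∈ p.vars, ev (pderiv i p) • X i := by
      rw [MvPolynomial.smul_eq_C_mul, mul_one, ← h3, hq]; ring
    intro j
    rw [h1 j]
    by_cases hj : j ∈ p.vars
    swap
    · rw [hvars j hj]; simp
    have h5 := congrArg (fun r => ev (v (-(2 * j + 1 : ℤ)) r)) h4
    rw [hk _ (by omega), map_zero, map_add, map_smul, v_one, S_neg (by omega), smul_zero, zero_add,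
      map_sum, map_sum] at h5
    rw [Finset.sum_eq_single j] at h5
    · have := v_X_mul (-(2 * j + 1 : ℤ)) j 1
      rw [mul_one] at this
      rw [map_smul, this, v_one, v_one, S_neg (by omega), mul_zero, zero_sub, ev_smul, map_neg,
        ev_smul, ev_S, if_pos (by ring)] at h5
      have hc : cc j ≠ 0 := by
        intro h; have := cc_mul j; rw [h] at this; norm_num at this
      have : ev (pderiv j p) = 0 := by
        have h6 : ev (pderiv j p) * cc j = 0 := by linear_combination h5
        exact (mul_eq_zero.mp h6).resolve_right hc
      rw [this, map_zero]
    · intro i _ hi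
      have := v_X_mul (-(2 * j + 1 : ℤ)) i 1
      rw [mul_one] at this
      rw [map_smul, this, v_one, v_one, S_neg (by omega), mul_zero, zero_sub, ev_smul, map_neg,
        ev_smul, ev_S, if_neg (by omega)]; ring
    · intro h; exact absurd hj h

lemma op_eq (M N : ℕ) (hN : N ≤ M) (a : ℤ → ℂ) (ha : ∀ m : ℤ, N < m → a m = 0) :
    op M a = ∑ i ∈ Finset.range (N + M + 1), Finsupp.single ((N : ℤ) - i) (a ((N : ℤ) - i)) := by
  rw [op, ← Finset.sum_subset (s₁ := Finset.Icc (-(M : ℤ)) N)]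
  · apply Finset.sum_nbij' (fun m : ℤ => ((N : ℤ) - m).toNat) (fun i : ℕ => (N : ℤ) - i)
    · intro m hm; rw [Finset.mem_Icc] at hm; rw [Finset.mem_range]; omega
    · intro m hm; rw [Finset.mem_range] at hm; rw [Finset.mem_Icc]; omega
    · intro m hm; rw [Finset.mem_Icc] at hm; omega
    · intro m hm; omega
    · intro m hm; rw [Finset.mem_Icc] at hm
      rw [show (N : ℤ) - (((N : ℤ) - m).toNat : ℤ) = m by omega]
  · intro m; simp only [Finset.mem_Icc]; omega
  · intro m _ hm
    rename_i h0
    simp only [Finset.mem_Icc] at h0 hm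
    rw [ha m (by omega), Finsupp.single_zero]

lemma classify (N : ℕ) : ∀ τ : BRing, τ ≠ 0 → BK τ → (∀ m : ℤ, N < m → v (-m) τ = 0) →
    ∃ (k : ℕ) (lam : Fin k → ℕ) (c : Fin k → ℕ → ℂ) (K : Fin k → ℕ) (x : ℂ),
      StrictAnti lam ∧ x ≠ 0 ∧ (∀ i, 0 < lam i ∧ lam i ≤ N) ∧
      (∀ i j, K i ≤ j → sC j (c i) = 0) ∧
      τ = x • P (fun i => Aop (lam i) (c i) (K i)) := by
  induction N with
  | zero =>
    intro τ h0 _ hk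
    have h := kill_const τ.totalDegree τ (fun d hd => by
      apply coeff_eq_zero_of_totalDegree_lt
      exact hd) (by simpa using hk)
    refine ⟨0, Fin.elim0, Fin.elim0, Fin.elim0, ev τ, fun i => i.elim0, ?_, fun i => i.elim0,
      fun i => i.elim0, ?_⟩
    · intro h1; rw [h1, map_zero] at h; exact h0 h
    · change τ = ev τ • 1
      rw [MvPolynomial.smul_eq_C_mul, mul_one]; exact h
  | succ N ih =>
    intro τ h0 hB hk
    set B := v (-((N + 1 : ℕ) : ℤ)) with hBdef
    by_cases hz : B τ = 0
    · obtain ⟨k, lam, c, K, x, h1, h2, h3, h4, h5⟩ := ih τ h0 hB (by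
        intro m hm
        rcases eq_or_lt_of_le (show ((N + 1 : ℕ) : ℤ) ≤ m by push_cast; omega) with h | h
        · rw [← h]; exact hz
        · exact hk m h)
      exact ⟨k, lam, c, K, x, h1, h2, fun i => ⟨(h3 i).1, by have := (h3 i).2; omega⟩, h4, h5⟩
    · have hBB : B (B τ) = 0 := vsq _ (by positivity) τ
      obtain ⟨f, hf0, hf1⟩ := exists_f τ (B τ) (by
        intro y hy
        rw [hy, map_smul, hy, smul_smul] at hBB
        rcases smul_eq_zero.mp hBB with h | h
        · apply hz; rw [hy, mul_self_eq_zero.mp h, zero_smul]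
        · exact h0 h)
      obtain ⟨M0, hM0⟩ := id hB
      set M := max M0 (N + 1)
      have hV := hM0 M (le_max_left _ _) f
      rw [hf0, zero_smul] at hV
      have h2 := v_V (-((N + 1 : ℕ) : ℤ)) (op M (cf f τ)) τ
      rw [hV, map_zero, bet_op _ _ _ (by rw [Finset.mem_Icc]; omega), ← hBdef] at h2
      have hcf : (-1) ^ ((N + 1 : ℕ) : ℤ) * cf f τ ((N + 1 : ℕ) : ℤ) = f (B τ) := by
        rw [cf, ← mul_assoc, npow_sq, one_mul]
      rw [mul_assoc, hcf] at h2
      have h2' : V (op M (cf f τ)) (B τ) = (2 * f (B τ)) • τ := (sub_eq_zero.mp h2.symm).symm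
      obtain ⟨k, lam, c, K, x, g1, g2, g3, g4, g5⟩ := ih (B τ) hz
        (BK_step τ hB (N + 1) (by omega)) (by
        intro m hm
        have := cliff τ (-m) (-((N + 1 : ℕ) : ℤ))
        rw [kap, if_neg (by omega), zero_smul, ← hBdef] at this
        rcases eq_or_lt_of_le (show ((N + 1 : ℕ) : ℤ) ≤ m by push_cast; omega) with h | h
        · rw [← h]; exact hBB
        · rw [hk m h, map_zero, add_zero] at this; exact this)
      set a := cf f τ
      have ha0 : ∀ m : ℤ, ((N + 1 : ℕ) : ℤ) < m → a m = 0 := by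
        intro m hm; simp only [a, cf, hk m hm, map_zero, mul_zero]
      set y := a ((N + 1 : ℕ) : ℤ) with hy
      have hy0 : y ≠ 0 := by
        intro h; rw [h, mul_zero] at hcf; exact hf1 hcf.symm
      set K0 := (N + 1) + M + 1 with hK0
      obtain ⟨c0, hc0⟩ := exists_c (fun i => if i < K0 then y⁻¹ * a (((N + 1 : ℕ) : ℤ) - i) else 0)
        (by simp only [Nat.cast_zero, sub_zero]
            rw [if_pos (by omega), ← hy, inv_mul_cancel₀ hy0])
      have hop : V (Aop (N + 1) c0 K0) (B τ) = (sqrt2⁻¹ * y⁻¹ * (2 * f (B τ))) • τ := by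
        rw [mul_smul, ← h2', op_eq M (N + 1) (le_max_right _ _) a ha0, V_Aop, map_sum,
          LinearMap.sum_apply, mul_smul]
        congr 1
        rw [Finset.smul_sum]
        apply Finset.sum_congr rfl
        intro i hi
        rw [Finset.mem_range] at hi
        rw [hc0, if_pos hi, V_single, LinearMap.smul_apply, mul_smul]
      have hz0 : sqrt2⁻¹ * y⁻¹ * (2 * f (B τ)) ≠ 0 :=
        mul_ne_zero (mul_ne_zero sqrt2_ne (inv_ne_zero hy0)) (mul_ne_zero two_ne_zero hf1)
      refine ⟨k + 1, Fin.cons (N + 1) lam, Fin.cons c0 c, Fin.cons K0 K,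
        (sqrt2⁻¹ * y⁻¹ * (2 * f (B τ)))⁻¹ * x, ?_, mul_ne_zero (inv_ne_zero hz0) g2, ?_, ?_, ?_⟩
      · intro i j
        refine Fin.cases ?_ (fun i => ?_) i
        · refine Fin.cases ?_ (fun j => ?_) j
          · intro h; exact absurd h (lt_irrefl _)
          · intro _; simp only [Fin.cons_zero, Fin.cons_succ]; have := (g3 j).2; omega
        · refine Fin.cases ?_ (fun j => ?_) j
          · intro h; exact absurd h (Fin.not_lt_zero _)
          · intro h; simp only [Fin.cons_succ]; exact g1 (Fin.succ_lt_succ_iff.mp h)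
      · intro i
        refine Fin.cases ?_ (fun i => ?_) i
        · simp
        · simp only [Fin.cons_succ]; have := g3 i; omega
      · intro i
        refine Fin.cases ?_ (fun i => ?_) i
        · intro j hj
          simp only [Fin.cons_zero] at hj ⊢
          rw [hc0, if_neg (by omega)]
        · simp only [Fin.cons_succ]; exact g4 i
      · rw [P_succ]
        simp only [Fin.cons_zero, Fin.cons_succ]
        rw [mul_smul, ← map_smul, ← g5, hop, smul_smul, inv_mul_cancel₀ hz0, one_smul]

lemma sC_zero_seq (i : ℕ) (hi : 1 ≤ i) : sC i (fun _ => 0) = 0 := by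
  obtain ⟨n, rfl⟩ : ∃ n, i = n + 1 := ⟨i - 1, by omega⟩
  rw [sC, schurPoly]
  simp

lemma main_aux (τ₀ τ₁ : BRing) (h₀ : τ₀ ≠ 0) (h₁ : τ₁ ≠ 0)
    (hB₀ : SatisfiesBKP τ₀) (hM : SatisfiesMDKP τ₀ τ₁) :
    ∃ (m : ℕ) (lam : Fin (m + 1) → ℕ) (_ : StrictAnti lam)
      (c : Fin (m + 1) → ℕ → ℂ) (b : Fin (m + 1) → ℂ) (a₀ a₁ : ℂ) (j : Fin (m + 1)),
      a₀ ≠ 0 ∧ a₁ ≠ 0 ∧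
      (((m + 1) % 2 = 1 ∧
          τ₀ = a₀ • rhoTau (lam ∘ j.succAbove) (c ∘ j.succAbove) (b ∘ j.succAbove) ∧
          τ₁ = a₁ • rhoTau lam c b) ∨
        ((m + 1) % 2 = 0 ∧
          τ₀ = a₀ • rhoTau lam c b ∧
          τ₁ = a₁ • rhoTau (lam ∘ j.succAbove) (c ∘ j.succAbove) (b ∘ j.succAbove))) := by
  have hBK : BK τ₀ := func_form τ₀ τ₀ hB₀
  obtain ⟨y, hy⟩ := proportional τ₀ τ₁ hBK hM h₁
  have hy0 : y ≠ 0 := by rintro rfl; rw [zero_smul] at hy; exact h₀ hy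
  have hy' : τ₁ = y⁻¹ • τ₀ := by rw [hy, smul_smul, inv_mul_cancel₀ hy0, one_smul]
  obtain ⟨N, hN⟩ := v_bdd τ₀
  obtain ⟨k, lam, c, K, x, g1, g2, g3, g4, g5⟩ := classify N τ₀ h₀ hBK
    (fun m hm => hN _ (by omega))
  let lam' : Fin (k + 1) → ℕ := Fin.snoc lam 0
  let c' : Fin (k + 1) → ℕ → ℂ := Fin.snoc c (fun _ => 0)
  let K' : Fin (k + 1) → ℕ := Fin.snoc K 1
  have r1 : rhoTau lam c (fun _ => 0) = P (fun i => Aop (lam i) (c i) (K i)) :=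
    rhoTau_eq lam c K g4
  have r2 : rhoTau lam' c' (fun _ => 0) = sqrt2⁻¹ • P (fun i => Aop (lam i) (c i) (K i)) := by
    rw [rhoTau_eq lam' c' K', P, Pop_snoc]
    · simp only [lam', c', K', Fin.snoc_last, Fin.snoc_castSucc]
      rw [V_Aop]
      have : ∑ i ∈ Finset.range 1, sC i (fun _ => 0) • v (((0 : ℕ) : ℤ) - i) 1 = 1 := by
        simp [sC, schurPoly, v_one, S_zero]
      rw [this, Pop_smul]; rfl
    · intro i
      refine Fin.lastCases ?_ (fun i => ?_) i
      · simp only [c', K', Fin.snoc_last]; exact sC_zero_seq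
      · simp only [c', K', Fin.snoc_castSucc]; exact g4 i
  have e1 : lam' ∘ (Fin.last k).succAbove = lam := by
    ext i; simp [lam', Fin.succAbove_last]
  have e2 : c' ∘ (Fin.last k).succAbove = c := by
    ext i; simp [c', Fin.succAbove_last]
  have hs := sqrt2_ne
  refine ⟨k, lam', ?_, c', fun _ => 0, if (k + 1) % 2 = 1 then x else x * (sqrt2⁻¹)⁻¹,
    if (k + 1) % 2 = 1 then y⁻¹ * (x * (sqrt2⁻¹)⁻¹) else y⁻¹ * x, Fin.last k, ?_, ?_, ?_⟩
  · intro i j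
    refine Fin.lastCases ?_ (fun i => ?_) i
    · intro h; exact absurd h (not_lt.mpr (Fin.le_last _))
    · refine Fin.lastCases ?_ (fun j => ?_) j
      · intro _; simp only [lam', Fin.snoc_last, Fin.snoc_castSucc]; exact (g3 i).1
      · intro h; simp only [lam', Fin.snoc_castSucc]; exact g1 (Fin.castSucc_lt_castSucc_iff.mp h)
  · split_ifs
    · exact g2
    · exact mul_ne_zero g2 (inv_ne_zero hs)
  · split_ifs
    · exact mul_ne_zero (inv_ne_zero hy0) (mul_ne_zero g2 (inv_ne_zero hs))
    · exact mul_ne_zero (inv_ne_zero hy0) g2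
  · have s1 : τ₀ = x • rhoTau lam c (fun _ => 0) := by rw [r1]; exact g5
    have s2 : τ₀ = (x * (sqrt2⁻¹)⁻¹) • rhoTau lam' c' (fun _ => 0) := by
      rw [r2, smul_smul, mul_assoc, inv_mul_cancel₀ hs, mul_one]; exact g5
    rw [e1, e2]
    change (_ ∧ _ = _ • rhoTau lam c (fun _ => 0) ∧ _) ∨ (_ ∧ _ ∧ _ = _ • rhoTau lam c (fun _ => 0))
    by_cases hk : (k + 1) % 2 = 1
    · left
      rw [if_pos hk, if_pos hk]
      refine ⟨hk, s1, ?_⟩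
      rw [mul_smul, ← s2]; exact hy'
    · right
      rw [if_neg hk, if_neg hk]
      refine ⟨by omega, s2, ?_⟩
      rw [mul_smul, ← s1]; exact hy'

end MDKP
end

noncomputable section

/-- Let `(τ₀, τ₁)` be a pair of nonzero polynomials in `ℂ[t₁,t₃,t₅,…]`,
each satisfying the BKP bilinear identity (the bosonic form of the DKP hierarchy), and
together satisfying the MDKP bilinear identity.  Then there are an extended strict
partition `λ = (λ_1 > ⋯ > λ_k ≥ 0)` (with `k = m+1 ≥ 1`), sequences `c_1,…,c_k`,
constants `b_1,…,b_k ∈ ℂ`, nonzero `a₀, a₁ ∈ ℂ` and an index `j` such that either `k` is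
odd, `τ₀ = a₀ ρ_{λ with part j removed}` and `τ₁ = a₁ ρ_λ`, or `k` is even,
`τ₀ = a₀ ρ_λ` and `τ₁ = a₁ ρ_{λ with part j removed}`. -/
theorem polynomial_tau_MDKP_classification (τ₀ τ₁ : BRing) (h₀ : τ₀ ≠ 0) (h₁ : τ₁ ≠ 0)
    (hB₀ : SatisfiesBKP τ₀) (hB₁ : SatisfiesBKP τ₁) (hM : SatisfiesMDKP τ₀ τ₁) :
    ∃ (m : ℕ) (lam : Fin (m + 1) → ℕ) (_ : StrictAnti lam)
      (c : Fin (m + 1) → ℕ → ℂ) (b : Fin (m + 1) → ℂ) (a₀ a₁ : ℂ) (j : Fin (m + 1)),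
      a₀ ≠ 0 ∧ a₁ ≠ 0 ∧
      (((m + 1) % 2 = 1 ∧
          τ₀ = a₀ • rhoTau (lam ∘ j.succAbove) (c ∘ j.succAbove) (b ∘ j.succAbove) ∧
          τ₁ = a₁ • rhoTau lam c b) ∨
        ((m + 1) % 2 = 0 ∧
          τ₀ = a₀ • rhoTau lam c b ∧
          τ₁ = a₁ • rhoTau (lam ∘ j.succAbove) (c ∘ j.succAbove) (b ∘ j.succAbove))) := by
  exact MDKP.main_aux τ₀ τ₁ h₀ h₁ hB₀ hM

end
end
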